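/- Fix ε with 0 < ε < 3/5. For every δ > 0 there exists y₀ ≥ 2 such that for all real numbers x, y, z with y ≥ y₀, 2 ≤ y ≤ z ≤ x, 1 ≤ log(x/z)/log y, and log x/log y ≤ exp((log y)^{3/5−ε}), one has |Ψ(x,y,z) − (Ψ(x,y) + ∫_y^z Ψ(x/t, y)/log t dt)| ≤ δ·(Ψ(x,y) + ∫_y^z Ψ(x/t, y)/log t dt). In other words, Ψ(x,y,z) = (Ψ(x,y) + ∫_y^z Ψ(x/t,y)/log t dt)(1 + o(1)) as y → ∞, uniformly in the stated region. -/

import Mathlib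

/-- `smoothCount x y` = Ψ(x,y), the number of positive integers `n ≤ x`
all of whose prime factors are `≤ y`. -/
noncomputable def smoothCount (x y : ℝ) : ℕ :=
  Nat.card {n : ℕ // 0 < n ∧ (n : ℝ) ≤ x ∧ ∀ p : ℕ, p.Prime → p ∣ n → (p : ℝ) ≤ y}

/-- `semismoothCount x y z` = Ψ(x,y,z), the number of positive integers `n ≤ x`
of the form `n = m * p` with `m` being `y`-smooth and `p = 1` or a prime `≤ z`. -/
noncomputable def semismoothCount (x y z : ℝ) : ℕ :=
  Nat.card {n : ℕ // 0 < n ∧ (n : ℝ) ≤ x ∧ ∃ m p : ℕ, n = m * p ∧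
    (∀ q : ℕ, q.Prime → q ∣ m → (q : ℝ) ≤ y) ∧ (p = 1 ∨ (p.Prime ∧ (p : ℝ) ≤ z))}


section
open Complex Metric Set

theorem SSA0 {f : ℂ → ℂ} (hf : Differentiable ℂ f) {R S M : ℝ} (hR : 0 < R) (hM : 0 < M)
    (hnz : ∀ z ∈ ball (0:ℂ) R, f z ≠ 0) (hS : ∀ z ∈ ball (0:ℂ) R, ‖f z‖ ≤ S)
    (hSM : S ≤ ‖f 0‖ * Real.exp M) {z : ℂ} (hz : ‖z‖ ≤ R / 2) :
    ‖deriv f z / f z‖ ≤ 24 * M / R := by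
  have h0 : (0:ℂ) ∈ ball (0:ℂ) R := by simpa using hR
  have hd : DifferentiableOn ℂ (fun z => deriv f z / f z) (ball 0 R) := by
    have h1 : Differentiable ℂ (deriv f) := by
      have := hf.contDiff (n := 2)
      exact this.differentiable_deriv_two
    exact h1.differentiableOn.div hf.differentiableOn hnz
  obtain ⟨h, hh0, hh⟩ : ∃ h : ℂ → ℂ, h 0 = 0 ∧ ∀ z ∈ ball (0:ℂ) R, HasDerivAt h (deriv f z / f z) z := by
    obtain ⟨h, hh⟩ := hd.isExactOn_ball
    refine ⟨fun z => h z - h 0, by simp, fun z hz => (hh z hz).sub_const _⟩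
  have hconst : ∀ w ∈ ball (0:ℂ) R, f w * exp (-h w) = f 0 := by
    intro w hw
    have key : ∀ z ∈ ball (0:ℂ) R, HasDerivAt (fun w => f w * exp (-h w)) 0 z := by
      intro z hz
      have h1 := (hf z).hasDerivAt.mul ((hh z hz).neg.cexp)
      refine h1.congr_deriv ?_
      have h2 : f z * (deriv f z / f z) = deriv f z := by field_simp [hnz z hz]
      simp only [Pi.neg_apply]
      linear_combination -(exp (-h z)) * h2
    have := (convex_ball (0:ℂ) R).is_const_of_fderivWithin_eq_zero (𝕜 := ℂ) (f := fun w => f w * exp (-h w))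
      (fun z hz => (key z hz).differentiableAt.differentiableWithinAt)
      (fun z hz => by
        rw [fderivWithin_of_isOpen isOpen_ball hz]
        ext; simp [(key z hz).deriv]) hw h0
    simpa [hh0] using this
  have hre : ∀ w ∈ ball (0:ℂ) R, (h w).re ≤ M := by
    intro w hw
    have h1 := congrArg norm (hconst w hw)
    rw [norm_mul, Complex.norm_exp] at h1
    have h2 := hS w hw
    have h3 : 0 < ‖f 0‖ := norm_pos_iff.mpr (hnz 0 h0)
    have h4 : ‖f w‖ = ‖f 0‖ * Real.exp (h w).re := by
      rw [← h1, mul_assoc, ← Real.exp_add]; simp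
    have h5 : ‖f 0‖ * Real.exp (h w).re ≤ ‖f 0‖ * Real.exp M := by linarith
    exact Real.exp_le_exp.mp (le_of_mul_le_mul_left h5 h3)
  have hbc : ∀ w, ‖w‖ ≤ 3 * R / 4 → ‖h w‖ ≤ 6 * M := by
    intro w hw
    have hwb : w ∈ ball (0:ℂ) R := by simp; linarith
    have := Complex.borelCaratheodory_zero hM
      (fun z hz => (hh z hz).differentiableAt.differentiableWithinAt) hre hR hwb hh0
    refine this.trans ?_
    rw [div_le_iff₀ (by linarith)]
    nlinarith
  have hzb : z ∈ ball (0:ℂ) R := by simp; linarith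
  rw [← (hh z hzb).deriv]
  have hsub : closedBall z (R/4) ⊆ ball 0 R := by
    intro w hw
    simp only [mem_closedBall, dist_eq_norm, mem_ball, sub_zero] at *
    have := norm_add_le (w - z) z
    simp at this
    linarith
  have := Complex.norm_deriv_le_of_forall_mem_sphere_norm_le (f := h) (c := z) (R := R/4) (C := 6*M) (by linarith)
    (DifferentiableOn.diffContOnCl (by
      rw [closure_ball _ (by positivity)]
      exact fun w hw => (hh w (hsub hw)).differentiableAt.differentiableWithinAt))
    (fun w hw => hbc w (by
      have hw' : ‖w - z‖ = R/4 := by simpa [dist_eq_norm] using hw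
      have := norm_add_le (w - z) z
      simp at this
      linarith))
  refine this.trans (le_of_eq ?_)
  field_simp; ring

/-- dividing out a zero with a Blaschke factor -/
theorem SSA_div {f : ℂ → ℂ} (hf : Differentiable ℂ f) {r S : ℝ} (hr : 0 < r)
    (h0 : f 0 ≠ 0) (hS : ∀ z ∈ closedBall (0:ℂ) r, ‖f z‖ ≤ S)
    {ρ : ℂ} (hρ : f ρ = 0) (hρr : ‖ρ‖ < r) :
    ∃ G : ℂ → ℂ, Differentiable ℂ G ∧ (∀ z ∈ closedBall (0:ℂ) r, ‖G z‖ ≤ S) ∧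
      ‖G 0‖ = ‖f 0‖ * (r / ‖ρ‖) ∧
      (∀ z ∈ closedBall (0:ℂ) r, G z = 0 → f z = 0) ∧
      deriv f 0 / f 0 = deriv G 0 / G 0 + (-1 / ρ + starRingEnd ℂ ρ / r ^ 2) := by
  have hρ0 : ρ ≠ 0 := by rintro rfl; exact h0 hρ
  have hD : Differentiable ℂ (dslope f ρ) := by
    have := (Complex.differentiableOn_dslope (f := f) (s := univ) (c := ρ) Filter.univ_mem).2 hf.differentiableOn
    exact differentiableOn_univ.mp this
  have hfD : ∀ z, f z = (z - ρ) * dslope f ρ z := by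
    intro z
    have := sub_smul_dslope f ρ z
    simp [hρ] at this
    exact this.symm
  set B : ℂ → ℂ := fun z => (r ^ 2 - starRingEnd ℂ ρ * z) / r with hB
  have hrc : (r:ℂ) ≠ 0 := by exact_mod_cast hr.ne'
  have hBd : Differentiable ℂ B := by
    intro z; simp only [hB]; fun_prop
  have hBsph : ∀ z : ℂ, ‖z‖ = r → ‖B z‖ = ‖z - ρ‖ := by
    intro z hz
    have h1 : (r:ℂ)^2 = z * starRingEnd ℂ z := by
      rw [Complex.mul_conj, Complex.normSq_eq_norm_sq, hz]; push_cast; ring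
    have h2 : (r:ℂ)^2 - starRingEnd ℂ ρ * z = z * starRingEnd ℂ (z - ρ) := by
      rw [h1, map_sub]; ring
    simp only [hB]
    rw [h2, norm_div, norm_mul, RCLike.norm_conj, hz]
    simp [abs_of_pos hr]
    field_simp
  have hBnz : ∀ z ∈ closedBall (0:ℂ) r, B z ≠ 0 := by
    intro z hz h
    simp only [hB] at h
    rw [div_eq_zero_iff, or_iff_left hrc, sub_eq_zero] at h
    have h1 := congrArg norm h
    simp [abs_of_pos hr] at h1 hz
    have : ‖ρ‖ * ‖z‖ < r^2 := by
      have := norm_nonneg z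
      have := norm_nonneg ρ
      nlinarith
    linarith
  have hGd : Differentiable ℂ (fun z => dslope f ρ z * B z) := hD.mul hBd
  refine ⟨fun z => dslope f ρ z * B z, hGd, ?_, ?_, ?_, ?_⟩
  · intro z hz
    have hsph : ∀ w ∈ frontier (ball (0:ℂ) r), ‖(fun z => dslope f ρ z * B z) w‖ ≤ S := by
      intro w hw
      rw [frontier_ball _ hr.ne'] at hw
      have hw' : ‖w‖ = r := by simpa using hw
      have := hS w (sphere_subset_closedBall hw)
      rw [hfD, norm_mul] at this
      simp only [norm_mul, hBsph w hw']
      linarith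
    exact Complex.norm_le_of_forall_mem_frontier_norm_le isBounded_ball hGd.diffContOnCl hsph
      (by rw [closure_ball _ hr.ne']; exact hz)
  · have h1 := hfD 0
    have h2 : ‖f 0‖ = ‖ρ‖ * ‖dslope f ρ 0‖ := by rw [h1]; simp
    have h3 : ‖ρ‖ ≠ 0 := by simpa using hρ0
    simp only [norm_mul, hB, h2]
    simp [abs_of_pos hr]
    field_simp
  · intro z hz h
    have := (mul_eq_zero.mp h).resolve_right (hBnz z hz)
    rw [hfD, this, mul_zero]
  · have hff : f = fun z => (z - ρ) * dslope f ρ z := funext hfD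
    have d1 : HasDerivAt f (1 * dslope f ρ 0 + (0 - ρ) * deriv (dslope f ρ) 0) 0 := by
      have := ((hasDerivAt_id (0:ℂ)).sub_const ρ).mul (hD 0).hasDerivAt
      refine (this.congr_of_eventuallyEq ?_)
      filter_upwards with z
      simpa using hfD z
    have dB : HasDerivAt B (-(starRingEnd ℂ ρ) / r) 0 := by
      have := (((hasDerivAt_id (0:ℂ)).const_mul (starRingEnd ℂ ρ)).const_sub ((r:ℂ)^2)).div_const (r:ℂ)
      simpa using this
    have d2 := (hD 0).hasDerivAt.mul dB
    have d2' : deriv (fun z => dslope f ρ z * B z) 0 = _ := d2.deriv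
    have hds : dslope f ρ 0 ≠ 0 := by
      intro h; apply h0; rw [hfD, h, mul_zero]
    have hB0 : B 0 = r := by simp only [hB]; field_simp; simp
    beta_reduce
    rw [d1.deriv, d2', hfD 0, hB0]
    field_simp
    ring

/-- Landau's lemma. -/
theorem SSA1 (n : ℕ) : ∀ {f : ℂ → ℂ} (_ : Differentiable ℂ f) {r S : ℝ} (_ : 0 < r)
    (_ : f 0 ≠ 0) (_ : ∀ z ∈ closedBall (0:ℂ) r, ‖f z‖ ≤ S)
    (_ : ∀ z ∈ closedBall (0:ℂ) r, f z = 0 → z.re ≤ 0)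
    (_ : S ≤ ‖f 0‖ * 2 ^ n), -(48 * (n + 1) / r) ≤ (deriv f 0 / f 0).re := by
  induction n with
  | zero =>
    intro f hf r S hr h0 hS hz hSn
    by_cases h : ∃ ρ ∈ closedBall (0:ℂ) (r/2), f ρ = 0
    · exfalso
      obtain ⟨ρ, hρ, hρ0⟩ := h
      have hρn : ‖ρ‖ ≤ r / 2 := by simpa using hρ
      obtain ⟨G, hG, hGS, hG0, -, -⟩ := SSA_div hf hr h0 hS hρ0 (by linarith)
      have h1 := hGS 0 (by simp; linarith)
      have hρ1 : 0 < ‖ρ‖ := by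
        rw [norm_pos_iff]; rintro rfl; exact h0 hρ0
      have h2 : 2 ≤ r / ‖ρ‖ := by rw [le_div_iff₀ hρ1]; linarith
      have h3 : 0 < ‖f 0‖ := norm_pos_iff.mpr h0
      rw [hG0] at h1
      nlinarith
    · push Not at h
      have := SSA0 hf (R := r/2) (S := S) (M := 1) (by linarith) one_pos
        (fun z hz => h z (ball_subset_closedBall hz))
        (fun z hz => hS z (closedBall_subset_closedBall (by linarith) (ball_subset_closedBall hz)))
        (hSn.trans (by gcongr; simp)) (z := 0) (by simp; linarith)
      have h2 := (abs_le.mp ((Complex.abs_re_le_norm _).trans this)).1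
      refine le_trans (le_of_eq ?_) h2
      field_simp; push_cast; norm_num
  | succ k ih =>
    intro f hf r S hr h0 hS hz hSn
    by_cases h : ∃ ρ ∈ closedBall (0:ℂ) (r/2), f ρ = 0
    · obtain ⟨ρ, hρ, hρ0⟩ := h
      have hρn : ‖ρ‖ ≤ r / 2 := by simpa using hρ
      obtain ⟨G, hG, hGS, hG0, hGz, hGf⟩ := SSA_div hf hr h0 hS hρ0 (by linarith)
      have hρ1 : 0 < ‖ρ‖ := by
        rw [norm_pos_iff]; rintro rfl; exact h0 hρ0
      have h2 : 2 ≤ r / ‖ρ‖ := by rw [le_div_iff₀ hρ1]; linarith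
      have h3 : 0 < ‖f 0‖ := norm_pos_iff.mpr h0
      have hG00 : 0 < ‖G 0‖ := by rw [hG0]; positivity
      have := ih hG hr (norm_pos_iff.mp hG00) hGS (fun z hzb hzz => hz z hzb (hGz z hzb hzz)) (by
        refine hSn.trans ?_
        rw [hG0, pow_succ']
        have : ‖f 0‖ * (2 * 2 ^ k) = ‖f 0‖ * 2 * 2 ^ k := by ring
        rw [this]
        gcongr)
      rw [hGf, add_re]
      have hre : 0 ≤ (-1 / ρ + starRingEnd ℂ ρ / r ^ 2).re := by
        have hρre : ρ.re ≤ 0 := hz ρ (closedBall_subset_closedBall (by linarith) hρ) hρ0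
        have e1 : (-1 / ρ).re = -ρ.re / ‖ρ‖^2 := by
          rw [neg_div, neg_re, one_div, Complex.inv_re, Complex.normSq_eq_norm_sq, neg_div]
        have e2 : (starRingEnd ℂ ρ / (r:ℂ) ^ 2).re = ρ.re / r^2 := by
          have : ((r:ℂ)^2) = ((r^2 : ℝ) : ℂ) := by push_cast; rfl
          rw [this, Complex.div_ofReal_re, Complex.conj_re]
        rw [add_re, e1, e2, neg_div]
        have : -ρ.re / r^2 ≤ -ρ.re / ‖ρ‖^2 := by
          apply div_le_div_of_nonneg_left (by linarith) (by positivity)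
          gcongr; linarith
        rw [neg_div, neg_div] at this
        linarith
      have h5 : 48 * ((k:ℝ) + 1) / r ≤ 48 * (((k+1:ℕ):ℝ) + 1) / r := by
        gcongr; simp
      linarith
    · push Not at h
      have hl := Real.log_two_lt_d9
      have hl0 := Real.log_pos one_lt_two
      have := SSA0 hf (R := r/2) (S := S) (M := (k+1+1)) (by linarith) (by positivity)
        (fun z hz => h z (ball_subset_closedBall hz))
        (fun z hz => hS z (closedBall_subset_closedBall (by linarith) (ball_subset_closedBall hz)))
        (hSn.trans (by
          gcongr
          have : (2:ℝ)^(k+1) ≤ Real.exp 1 ^ (k+1) := by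
            gcongr; have := Real.add_one_le_exp 1; linarith
          refine this.trans ?_
          rw [← Real.exp_nat_mul]
          apply Real.exp_le_exp.mpr; push_cast; linarith)) (z := 0) (by simp; linarith)
      have h2 := (abs_le.mp ((Complex.abs_re_le_norm _).trans this)).1
      refine le_trans (le_of_eq ?_) h2
      field_simp; push_cast; ring

theorem SSA1' (n : ℕ) {f : ℂ → ℂ} (hf : Differentiable ℂ f) {r S : ℝ} (hr : 0 < r)
    (h0 : f 0 ≠ 0) (hS : ∀ z ∈ closedBall (0:ℂ) r, ‖f z‖ ≤ S)
    (hz : ∀ z ∈ closedBall (0:ℂ) r, f z = 0 → z.re ≤ 0)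
    (hSn : S ≤ ‖f 0‖ * 2 ^ n) {a : ℝ} (ha : 0 < a) (har : a < r) (hfa : f (-(a:ℂ)) = 0) :
    -(48 * (n + 1) / r) + 1 / a - a / r ^ 2 ≤ (deriv f 0 / f 0).re := by
  have hna : ‖(-(a:ℂ))‖ = a := by simp [abs_of_pos ha]
  obtain ⟨G, hG, hGS, hG0, hGz, hGf⟩ := SSA_div hf hr h0 hS hfa (by rw [hna]; exact har)
  have h3 : 0 < ‖f 0‖ := norm_pos_iff.mpr h0
  rw [hna] at hG0
  have hG00 : 0 < ‖G 0‖ := by rw [hG0]; positivity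
  have := SSA1 n hG hr (norm_pos_iff.mp hG00) hGS (fun z hzb hzz => hz z hzb (hGz z hzb hzz)) (by
        refine hSn.trans ?_
        rw [hG0]
        gcongr
        have : 1 ≤ r / a := by rw [le_div_iff₀ ha]; linarith
        nlinarith)
  rw [hGf, add_re]
  have e : (-1 / (-(a:ℂ)) + starRingEnd ℂ (-(a:ℂ)) / (r:ℂ) ^ 2) = ((1 / a - a / r^2 : ℝ) : ℂ) := by
    rw [map_neg, Complex.conj_ofReal]; push_cast
    have : (a:ℂ) ≠ 0 := by exact_mod_cast ha.ne'
    field_simp; ring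
  rw [e, ofReal_re]; linarith

end

section
open Complex Metric Set Filter Topology

noncomputable def SSS (X : ℕ) (s : ℂ) : ℂ := ∑ n ∈ Finset.Icc 1 X, (n:ℂ) ^ (-s)

theorem SSS_succ (X : ℕ) (s : ℂ) : SSS (X+1) s = SSS X s + ((X+1:ℕ):ℂ) ^ (-s) := by
  unfold SSS; rw [Finset.sum_Icc_succ_top (by omega)]

noncomputable def SSg (n : ℕ) (s : ℂ) : ℂ :=
  (s - 1) * ((n+1:ℕ):ℂ) ^ (-s) + ((n+1:ℕ):ℂ) ^ (1-s) - (n:ℂ) ^ (1-s)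

theorem SSg_bound {n : ℕ} (hn : 1 ≤ n) {s : ℂ} (hs : 0 < s.re) :
    ‖SSg n s‖ ≤ ‖s‖ * ‖s - 1‖ * (n:ℝ) ^ (-s.re - 1) := by
  have hn' : (1:ℝ) ≤ n := by exact_mod_cast hn
  have hn0 : (0:ℝ) < n := by linarith
  -- derivative of u^{-s}
  have hder : ∀ (a : ℂ) (u : ℝ), 0 < u → HasDerivAt (fun u : ℝ => (u:ℂ) ^ a) (a * (u:ℂ)^(a-1)) u := by
    intro a u hu
    have := (hasDerivAt_id (u:ℂ)).cpow_const (c := a) (Or.inl (by simpa using hu))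
    simpa using this.comp_ofReal
  have step1 : ∀ u ∈ Icc (n:ℝ) (n+1), ‖((n+1:ℝ):ℂ) ^ (-s) - (u:ℂ)^(-s)‖ ≤ ‖s‖ * (n:ℝ) ^ (-s.re-1) := by
    intro u hu
    have hb : ∀ v ∈ Icc u (n+1:ℝ), HasDerivWithinAt (fun u : ℝ => (u:ℂ) ^ (-s)) (-s * (v:ℂ)^(-s-1)) (Icc u (n+1:ℝ)) v :=
      fun v hv => (hder (-s) v (by linarith [hv.1, hu.1])).hasDerivWithinAt
    have := norm_image_sub_le_of_norm_deriv_le_segment' (C := ‖s‖ * (n:ℝ) ^ (-s.re-1)) hb (fun v hv => by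
      have hv0 : 0 < v := by linarith [hv.1, hu.1]
      rw [norm_mul, norm_neg, Complex.norm_cpow_eq_rpow_re_of_pos hv0]
      simp only [sub_re, neg_re, one_re]
      gcongr ?_ * ?_
      apply Real.rpow_le_rpow_of_nonpos hn0 (by linarith [hv.1, hu.1]) (by linarith)) (n+1:ℝ) (right_mem_Icc.mpr hu.2)
    refine this.trans ?_
    have h1 : (n:ℝ)+1-u ≤ 1 := by linarith [hu.1]
    have : 0 ≤ ‖s‖ * (n:ℝ) ^ (-s.re-1) := by positivity
    nlinarith
  have hb : ∀ v ∈ Icc (n:ℝ) (n+1:ℝ), HasDerivWithinAt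
      (fun u : ℝ => (s-1) * ((n+1:ℝ):ℂ)^(-s) * ((u:ℂ) - n) + (u:ℂ)^(1-s))
      ((s-1) * (((n+1:ℝ):ℂ)^(-s) - (v:ℂ)^(-s))) (Icc (n:ℝ) (n+1:ℝ)) v := by
    intro v hv
    have h1 := hder (1-s) v (by linarith [hv.1])
    have h2 : HasDerivAt (fun u : ℝ => (s-1) * ((n+1:ℝ):ℂ)^(-s) * ((u:ℂ) - n)) ((s-1) * ((n+1:ℝ):ℂ)^(-s) * 1) v :=
      ((hasDerivAt_id (v:ℂ)).comp_ofReal.sub_const _).const_mul _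
    refine ((h2.add h1).congr_deriv ?_).hasDerivWithinAt
    have : (1 - s - 1) = -s := by ring
    rw [this]; ring
  have := norm_image_sub_le_of_norm_deriv_le_segment' (C := ‖s‖ * ‖s-1‖ * (n:ℝ) ^ (-s.re-1)) hb (fun v hv => by
    rw [norm_mul]
    have := step1 v (Ico_subset_Icc_self hv)
    calc ‖s - 1‖ * _ ≤ ‖s-1‖ * (‖s‖ * (n:ℝ) ^ (-s.re-1)) := by gcongr
      _ = _ := by ring) (n+1:ℝ) (right_mem_Icc.mpr (by linarith))
  have e : SSg n s = (s-1) * ((n+1:ℝ):ℂ)^(-s) * (((n+1:ℝ):ℂ) - n) + ((n+1:ℝ):ℂ)^(1-s) -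
     ((s-1) * ((n+1:ℝ):ℂ)^(-s) * (((n:ℝ):ℂ) - n) + ((n:ℝ):ℂ)^(1-s)) := by
    unfold SSg; push_cast; ring
  rw [e]
  simpa using this

theorem SSg_diff {n : ℕ} (hn : 1 ≤ n) : Differentiable ℂ (SSg n) := by
  have h1 : (n:ℂ) ≠ 0 := by exact_mod_cast (by omega : n ≠ 0)
  have h2 : ((n+1:ℕ):ℂ) ≠ 0 := by exact_mod_cast (by omega : n+1 ≠ 0)
  intro s
  unfold SSg
  refine DifferentiableAt.sub (DifferentiableAt.add (DifferentiableAt.mul (by fun_prop) ?_) ?_) ?_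
  · exact DifferentiableAt.const_cpow (by fun_prop) (Or.inl h2)
  · exact DifferentiableAt.const_cpow (by fun_prop) (Or.inl h2)
  · exact DifferentiableAt.const_cpow (by fun_prop) (Or.inl h1)

theorem SSS_diff (X : ℕ) : Differentiable ℂ (SSS X) := by
  intro s
  unfold SSS
  refine DifferentiableAt.fun_sum (fun n hn => ?_)
  have : 1 ≤ n := (Finset.mem_Icc.mp hn).1
  exact DifferentiableAt.const_cpow (by fun_prop) (Or.inl (by exact_mod_cast (by omega : n ≠ 0)))

theorem SSg_sum (X K : ℕ) (s : ℂ) : ∑ k ∈ Finset.range K, SSg (X+k) s =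
    (s-1) * (SSS (X+K) s - SSS X s) + ((X+K:ℕ):ℂ)^(1-s) - (X:ℂ)^(1-s) := by
  induction K with
  | zero => simp
  | succ K ih =>
    rw [Finset.sum_range_succ, ih, ← add_assoc, SSS_succ]
    unfold SSg
    ring

theorem SSg_summable {X : ℕ} (hX : 1 ≤ X) {σ : ℝ} (hs : 0 < σ) : Summable (fun k : ℕ => ((X+k:ℕ):ℝ)^(-σ-1)) := by
  have h1 : Summable (fun n : ℕ => (n:ℝ)^(-σ-1)) := Real.summable_nat_rpow.mpr (by linarith)
  have := (summable_nat_add_iff X).mpr h1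
  simpa [add_comm] using this

theorem SSB_re {X : ℕ} (hX : 1 ≤ X) {s : ℂ} (hs : 1 < s.re) :
    riemannZeta₁ s = (s-1) * SSS X s + (X:ℂ)^(1-s) + ∑' k, SSg (X+k) s := by
  have hs1 : s ≠ 1 := by rintro rfl; simp at hs
  have hsum : Summable (fun k => SSg (X+k) s) :=
    Summable.of_norm_bounded ((SSg_summable hX (by linarith : 0 < s.re)).mul_left (‖s‖*‖s-1‖))
      (fun k => SSg_bound (by omega) (by linarith))
  have h1 := hsum.hasSum.tendsto_sum_nat
  have hS : Tendsto (fun K => SSS K s) atTop (𝓝 (riemannZeta s)) := by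
    have e : ∀ K, SSS K s = ∑ n ∈ Finset.range K, 1 / ((n:ℂ)+1)^s := by
      intro K
      induction K with
      | zero => simp [SSS]
      | succ K ih => rw [SSS_succ, ih, Finset.sum_range_succ, Complex.cpow_neg]; simp
    simp_rw [e]
    rw [zeta_eq_tsum_one_div_nat_add_one_cpow hs]
    apply HasSum.tendsto_sum_nat
    apply Summable.hasSum
    have := (summable_nat_add_iff 1).mpr (Complex.summable_one_div_nat_cpow.mpr hs)
    simpa using this
  have h2 : Tendsto (fun K => (s-1) * (SSS (X+K) s - SSS X s) + ((X+K:ℕ):ℂ)^(1-s) - (X:ℂ)^(1-s)) atTop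
      (𝓝 ((s-1) * (riemannZeta s - SSS X s) + 0 - (X:ℂ)^(1-s))) := by
    have hadd : Tendsto (fun K : ℕ => X + K) atTop atTop := tendsto_atTop_mono (fun K => Nat.le_add_left K X) tendsto_id
    refine Tendsto.sub (Tendsto.add (Tendsto.const_mul _ ((hS.comp hadd).sub_const _)) ?_) tendsto_const_nhds
    refine Tendsto.comp (g := fun n : ℕ => (n:ℂ)^(1-s)) ?_ hadd
    rw [tendsto_zero_iff_norm_tendsto_zero]
    have h3 := (tendsto_rpow_neg_atTop (y := s.re - 1) (by linarith)).comp (tendsto_natCast_atTop_atTop (R := ℝ))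
    refine h3.congr' ?_
    filter_upwards [eventually_ge_atTop 1] with n hn
    rw [Complex.norm_natCast_cpow_of_pos (by omega)]
    simp
  simp_rw [SSg_sum] at h1
  have := tendsto_nhds_unique h1 h2
  rw [this, riemannZeta_eq_inv_sub_mul hs1]
  have : s - 1 ≠ 0 := sub_ne_zero.mpr hs1
  field_simp
  ring

theorem SSB_all {X : ℕ} (hX : 1 ≤ X) {s : ℂ} (hs : 1/4 < s.re) :
    riemannZeta₁ s = (s-1) * SSS X s + (X:ℂ)^(1-s) + ∑' k, SSg (X+k) s := by
  set B := ‖s‖ + 5 with hB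
  have hBpos : 0 < B := by positivity
  set U : Set ℂ := {z | 1/4 < z.re} ∩ ball 0 B with hU
  have hUo : IsOpen U := (isOpen_lt continuous_const continuous_re).inter isOpen_ball
  have hUc : IsPreconnected U := ((convex_halfSpace_re_gt (1/4)).inter (convex_ball 0 B)).isPreconnected
  have hX0 : (X:ℂ) ≠ 0 := by exact_mod_cast (by omega : X ≠ 0)
  have hd : DifferentiableOn ℂ (fun s => (s-1) * SSS X s + (X:ℂ)^(1-s) + ∑' k, SSg (X+k) s) U := by
    refine DifferentiableOn.add (DifferentiableOn.add (DifferentiableOn.mul (by fun_prop) (SSS_diff X).differentiableOn) ?_) ?_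
    · exact fun z _ => (DifferentiableAt.const_cpow (by fun_prop) (Or.inl hX0)).differentiableWithinAt
    · refine differentiableOn_tsum_of_summable_norm
        ((SSg_summable hX (by norm_num : (0:ℝ) < 1/4)).mul_left (B * (B+1))) ?_ hUo ?_
      · exact fun k => (SSg_diff (by omega)).differentiableOn
      · intro k w hw
        have hw2 : ‖w‖ < B := by simpa using hw.2
        have hw1 : 1/4 < w.re := hw.1
        refine (SSg_bound (by omega) (by linarith)).trans ?_
        have : ‖w - 1‖ ≤ B + 1 := (norm_sub_le _ _).trans (by simp; linarith)
        have h1 : (1:ℝ) ≤ ((X+k:ℕ):ℝ) := by exact_mod_cast (by omega : 1 ≤ X + k)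
        gcongr ?_ * ?_ * ?_
        apply Real.rpow_le_rpow_of_exponent_le h1 (by linarith)
  have hbig : (2:ℂ) ∈ U := by
    refine ⟨by simp; norm_num, ?_⟩
    simp only [mem_ball, dist_zero_right]; norm_num; linarith [norm_nonneg s]
  have := AnalyticOnNhd.eqOn_of_preconnected_of_eventuallyEq
    (differentiable_riemannZeta₁.differentiableOn.analyticOnNhd hUo) (hd.analyticOnNhd hUo) hUc hbig (by
      have : {z : ℂ | 1 < z.re} ∈ 𝓝 (2:ℂ) := (isOpen_lt continuous_const continuous_re).mem_nhds (by simp)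
      filter_upwards [this] with z hz
      exact SSB_re hX hz)
  exact this ⟨hs, by simp [hB]⟩

theorem SSB_tel {a σ : ℝ} (ha : 1 ≤ a) (hσ : 1/2 ≤ σ) (hσ3 : σ ≤ 3) :
    a ^ (-σ-1) ≤ 32 * (a ^ (-σ) - (a+1) ^ (-σ)) := by
  have ha0 : 0 < a := by linarith
  have h1 : σ * (a+1)^(-σ-1) ≤ a ^ (-σ) - (a+1)^(-σ) := by
    have hd : ∀ u ∈ Icc a (a+1), HasDerivAt (fun u : ℝ => -(u ^ (-σ))) (σ * u^(-σ-1)) u := by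
      intro u hu
      have := (Real.hasDerivAt_rpow_const (x := u) (p := -σ) (Or.inl (by linarith [hu.1]))).neg
      refine this.congr_deriv (by ring)
    obtain ⟨c, hc, hc2⟩ := exists_hasDerivAt_eq_slope (fun u : ℝ => -(u ^ (-σ))) (fun u => σ * u^(-σ-1))
      (by linarith : a < a+1) (fun u hu => (hd u hu).continuousAt.continuousWithinAt)
      (fun u hu => hd u (Ioo_subset_Icc_self hu))
    have h2 : (a+1)^(-σ-1) ≤ c^(-σ-1) :=
      Real.rpow_le_rpow_of_nonpos (by linarith [hc.1]) hc.2.le (by linarith)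
    simp at hc2
    nlinarith
  have h2 : a ^ (-σ-1) ≤ 16 * (a+1)^(-σ-1) := by
    have h3 : (2*a)^(-σ-1) ≤ (a+1)^(-σ-1) :=
      Real.rpow_le_rpow_of_nonpos (by linarith) (by linarith) (by linarith)
    rw [Real.mul_rpow (by norm_num) ha0.le] at h3
    have h4 : (2:ℝ)^(-4:ℝ) ≤ 2^(-σ-1) := Real.rpow_le_rpow_of_exponent_le (by norm_num) (by linarith)
    have h5 : (2:ℝ)^(-4:ℝ) = 1/16 := by
      rw [Real.rpow_neg (by norm_num)]; norm_num
    rw [h5] at h4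
    have : 0 < a^(-σ-1) := by positivity
    nlinarith
  have : 0 < (a+1)^(-σ-1) := by positivity
  nlinarith

theorem SSB1 {X : ℕ} (hX : 1 ≤ X) {s : ℂ} (hs : 1/2 ≤ s.re) (hs3 : s.re ≤ 3) :
    ‖riemannZeta₁ s - (s-1) * SSS X s - (X:ℂ)^(1-s)‖ ≤ 32 * ‖s‖ * ‖s-1‖ * (X:ℝ)^(-s.re) := by
  rw [SSB_all hX (by linarith)]
  have e : (s-1) * SSS X s + (X:ℂ)^(1-s) + ∑' k, SSg (X+k) s - (s-1) * SSS X s - (X:ℂ)^(1-s) = ∑' k, SSg (X+k) s := by ring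
  rw [e]
  have hsn : Summable (fun k => ‖SSg (X+k) s‖) :=
    Summable.of_nonneg_of_le (fun _ => norm_nonneg _) (fun k => SSg_bound (by omega) (by linarith))
     ((SSg_summable hX (by linarith : 0 < s.re)).mul_left (‖s‖*‖s-1‖))
  refine (norm_tsum_le_tsum_norm hsn).trans ?_
  refine hsn.tsum_le_of_sum_range_le (fun K => ?_)
  calc ∑ k ∈ Finset.range K, ‖SSg (X+k) s‖ ≤ ∑ k ∈ Finset.range K, ‖s‖ * ‖s-1‖ * (32 * (((X+k:ℕ):ℝ) ^ (-s.re) - ((X+(k+1):ℕ):ℝ) ^ (-s.re))) := by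
        refine Finset.sum_le_sum (fun k _ => (SSg_bound (by omega) (by linarith)).trans ?_)
        have h1 : (1:ℝ) ≤ ((X+k:ℕ):ℝ) := by exact_mod_cast (by omega : 1 ≤ X + k)
        have := SSB_tel h1 hs hs3
        have e2 : ((X+(k+1):ℕ):ℝ) = ((X+k:ℕ):ℝ) + 1 := by push_cast; ring
        rw [e2]
        gcongr
    _ = ‖s‖ * ‖s-1‖ * (32 * ((X:ℝ) ^ (-s.re) - ((X+K:ℕ):ℝ) ^ (-s.re))) := by
        rw [← Finset.mul_sum, ← Finset.mul_sum, Finset.sum_range_sub' (fun k => ((X+k:ℕ):ℝ) ^ (-s.re))]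
        simp
    _ ≤ _ := by
        have : 0 ≤ ((X+K:ℕ):ℝ) ^ (-s.re) := by positivity
        have h2 : 0 ≤ ‖s‖ * ‖s-1‖ := by positivity
        nlinarith [mul_nonneg h2 this]

/-- crude bound -/
theorem SSB2 {s : ℂ} (hs : 1/2 ≤ s.re) (hs3 : s.re ≤ 3) :
    ‖riemannZeta₁ s‖ ≤ 40 * (‖s‖ + 1) ^ 2 := by
  have := SSB1 (X := 1) le_rfl hs hs3
  simp [SSS] at this
  have h2 : ‖riemannZeta₁ s‖ ≤ ‖riemannZeta₁ s - (s-1) - 1‖ + ‖s‖ := by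
    have := norm_add_le (riemannZeta₁ s - (s-1) - 1) s
    have e : riemannZeta₁ s - (s-1) - 1 + s = riemannZeta₁ s := by ring
    rwa [e] at this
  have h3 : ‖s - 1‖ ≤ ‖s‖ + 1 := (norm_sub_le _ _).trans (by simp)
  have := norm_nonneg s
  nlinarith

end

section
open Complex Metric Set Filter Topology

theorem SSZ_deriv {s : ℂ} (hs : s ≠ 1) (hz : riemannZeta s ≠ 0) :
    -deriv riemannZeta s / riemannZeta s = 1 / (s - 1) - deriv riemannZeta₁ s / riemannZeta₁ s := by
  have hs' : s - 1 ≠ 0 := sub_ne_zero.mpr hs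
  have hd : HasDerivAt riemannZeta₁ (1 * riemannZeta s + (s-1) * deriv riemannZeta s) s := by
    have h1 := ((hasDerivAt_id s).sub_const 1).mul (differentiableAt_riemannZeta hs).hasDerivAt
    refine h1.congr_of_eventuallyEq ?_
    filter_upwards [isOpen_ne.mem_nhds hs] with z hz
    have : z - 1 ≠ 0 := sub_ne_zero.mpr hz
    simp only [Pi.mul_apply, id]
    rw [riemannZeta_eq_inv_sub_mul hz]; field_simp
  have e : riemannZeta₁ s = (s-1) * riemannZeta s := by rw [riemannZeta_eq_inv_sub_mul hs]; field_simp
  rw [hd.deriv, e]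
  field_simp
  ring

theorem SSZ_ne {s : ℂ} (hs : 1 ≤ s.re) : riemannZeta₁ s ≠ 0 := by
  by_cases h : s = 1
  · rw [h]; simp
  · have h1 := riemannZeta_ne_zero_of_one_le_re hs
    rw [riemannZeta_eq_inv_sub_mul h] at h1
    exact right_ne_zero_of_mul h1

theorem SSZ_real {σ : ℝ} (h1 : 1 < σ) (h3 : σ ≤ 3) :
    ∑' n : ℕ, ‖(LSeries.term 1 (σ:ℂ) n)‖ ≤ 640 / (σ - 1) := by
  have hne : (σ:ℂ) ≠ 1 := by
    intro h; have : σ = 1 := by exact_mod_cast h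
    linarith
  have e : ((∑' n : ℕ, ‖(LSeries.term 1 (σ:ℂ) n)‖ : ℝ) : ℂ) = riemannZeta σ := by
    rw [← LSeries_one_eq_riemannZeta (by simpa using h1), LSeries, ofReal_tsum]
    refine tsum_congr (fun n => ?_)
    rcases Nat.eq_zero_or_pos n with rfl | hn
    · simp
    · rw [LSeries.norm_term_eq, LSeries.term_of_ne_zero (by omega)]
      simp [hn.ne', Complex.ofReal_cpow]
  have h4 : ‖riemannZeta (σ:ℂ)‖ ≤ 640 / (σ - 1) := by
    rw [riemannZeta_eq_inv_sub_mul hne, norm_mul, norm_inv]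
    have h5 := SSB2 (s := σ) (by simp; linarith) (by simpa using h3)
    have h6 : ‖((σ:ℂ) - 1)‖ = σ - 1 := by
      rw [← ofReal_one, ← ofReal_sub, norm_real, Real.norm_of_nonneg (by linarith)]
    have h7 : ‖(σ:ℂ)‖ = σ := by rw [norm_real, Real.norm_of_nonneg (by linarith)]
    rw [h6, div_eq_inv_mul]
    rw [h7] at h5
    have : 0 < σ - 1 := by linarith
    gcongr
    nlinarith
  rw [← e, norm_real] at h4
  exact (le_abs_self _).trans h4

theorem SSZ_lower {s : ℂ} (h1 : 1 < s.re) (h3 : s.re ≤ 3) :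
    (s.re - 1)^2 / 640 ≤ ‖riemannZeta₁ s‖ := by
  have hne : s ≠ 1 := by rintro rfl; simp at h1
  have hmu : ‖LSeries (fun n => ((ArithmeticFunction.moebius n : ℤ) : ℂ)) s‖ ≤ 640 / (s.re - 1) := by
    refine le_trans ?_ (SSZ_real h1 h3)
    have hs1 : Summable (fun n => ‖LSeries.term 1 (s.re:ℂ) n‖) :=
      (LSeriesSummable_one_iff.mpr (by simpa using h1)).norm
    have hle : ∀ n, ‖LSeries.term (fun n => ((ArithmeticFunction.moebius n : ℤ) : ℂ)) s n‖ ≤ ‖LSeries.term 1 (s.re:ℂ) n‖ := by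
      intro n
      rw [LSeries.norm_term_eq, LSeries.norm_term_eq]
      split_ifs with h
      · exact le_rfl
      · simp only [ofReal_re, Pi.one_apply, norm_one]
        gcongr
        have := ArithmeticFunction.abs_moebius_le_one (n := n)
        rw [norm_intCast]; exact_mod_cast this
    have hsn := Summable.of_nonneg_of_le (fun _ => norm_nonneg _) hle hs1
    exact (norm_tsum_le_tsum_norm hsn).trans (hsn.tsum_le_tsum hle hs1)
  have hprod := ArithmeticFunction.LSeries_zeta_mul_Lseries_moebius h1
  have hz : LSeries (fun n => ((ArithmeticFunction.zeta n : ℕ) : ℂ)) s = riemannZeta s :=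
    ArithmeticFunction.LSeries_zeta_eq_riemannZeta h1
  have h4 : ‖riemannZeta s‖ * ‖LSeries (fun n => ((ArithmeticFunction.moebius n : ℤ) : ℂ)) s‖ = 1 := by
    rw [← norm_mul, ← hz]
    have := congrArg norm hprod
    simpa using this
  rw [riemannZeta_eq_inv_sub_mul hne, norm_mul, norm_inv] at h4
  have h5 : s.re - 1 ≤ ‖s - 1‖ := by
    have := (le_abs_self _).trans (abs_re_le_norm (s-1)); simpa using this
  have h6 : 0 < s.re - 1 := by linarith
  have h7 : 0 < ‖s - 1‖ := by linarith
  have h8 : ‖riemannZeta₁ s‖ * ‖LSeries (fun n => ((ArithmeticFunction.moebius n : ℤ) : ℂ)) s‖ = ‖s-1‖ := by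
    field_simp at h4; linarith
  have h9 : ‖riemannZeta₁ s‖ * (640 / (s.re - 1)) ≥ s.re - 1 := by
    have := mul_le_mul_of_nonneg_left hmu (norm_nonneg (riemannZeta₁ s))
    linarith
  rw [ge_iff_le, ← mul_div_assoc, le_div_iff₀ h6] at h9
  rw [div_le_iff₀ (by norm_num)]
  linarith

theorem SSZ_341 {σ t : ℝ} (hσ : 1 < σ) :
    0 ≤ (3 * (-deriv riemannZeta σ / riemannZeta σ) +
      4 * (-deriv riemannZeta (σ + t * I) / riemannZeta (σ + t * I)) +
      (-deriv riemannZeta (σ + (2*t:ℝ) * I) / riemannZeta (σ + (2*t:ℝ) * I))).re := by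
  set a : ℕ → ℂ := fun n => ((ArithmeticFunction.vonMangoldt n : ℝ) : ℂ) with ha
  have hre : ∀ t : ℝ, 1 < ((σ:ℂ) + t * I).re := by intro t; simpa using hσ
  have hL : ∀ t : ℝ, -deriv riemannZeta (σ + t * I) / riemannZeta (σ + t * I) = LSeries a (σ + t * I) :=
    fun t => (ArithmeticFunction.LSeries_vonMangoldt_eq_deriv_riemannZeta_div (hre t)).symm
  have hS : ∀ t : ℝ, LSeriesSummable a (σ + t * I) :=
    fun t => ArithmeticFunction.LSeriesSummable_vonMangoldt (hre t)
  have h0 := hL 0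
  have hS0 := hS 0
  simp only [ofReal_zero, zero_mul, add_zero] at h0 hS0
  rw [h0, hL, hL]
  unfold LSeries
  rw [← tsum_mul_left, ← tsum_mul_left, ← Summable.tsum_add (hS0.mul_left 3) ((hS t).mul_left 4),
    ← Summable.tsum_add ((hS0.mul_left 3).add ((hS t).mul_left 4)) (hS (2*t)), Complex.re_tsum
      (((hS0.mul_left 3).add ((hS t).mul_left 4)).add (hS (2*t)))]
  refine tsum_nonneg (fun n => ?_)
  rcases Nat.eq_zero_or_pos n with rfl | hn
  · simp
  · have hn0 : (n:ℂ) ≠ 0 := by exact_mod_cast hn.ne'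
    set c : ℂ := (n:ℂ) ^ (-(t * I)) with hc
    have hc1 : ‖c‖ = 1 := by
      rw [hc, Complex.norm_natCast_cpow_of_pos hn]; simp
    have e1 : ∀ z : ℂ, LSeries.term a (σ + z) n = ((ArithmeticFunction.vonMangoldt n * (n:ℝ)^(-σ) : ℝ) : ℂ) * (n:ℂ)^(-z) := by
      intro z
      rw [LSeries.term_of_ne_zero hn.ne', Complex.cpow_add _ _ hn0, ofReal_mul,
        Complex.ofReal_cpow (by positivity), Complex.cpow_neg]
      simp [ha, Complex.cpow_neg]
      field_simp
    have e0 := e1 0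
    simp only [add_zero, neg_zero, cpow_zero] at e0
    have e2 : (n:ℂ)^(-((2*t:ℝ) * I)) = c * c := by
      rw [hc, ← Complex.cpow_add _ _ hn0]; congr 1; push_cast; ring
    rw [e0, e1, e1, e2]
    have e3 : ∀ A : ℝ, (3 * ((A:ℂ) * 1) + 4 * ((A:ℂ) * c) + (A:ℂ) * (c*c)).re = A * (3 + 4 * c.re + (c.re^2 - c.im^2)) := by
      intro A; simp; ring
    rw [e3]
    have h2 : c.re^2 + c.im^2 = 1 := by
      have := Complex.normSq_eq_norm_sq c
      rw [hc1, Complex.normSq_apply] at this; nlinarith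
    apply mul_nonneg (mul_nonneg ArithmeticFunction.vonMangoldt_nonneg (by positivity))
    nlinarith [sq_nonneg (c.re + 1)]

end

section
open Complex Metric Set Filter Topology

theorem SSY_logT {T : ℝ} (hT : 3 ≤ T) : 1 ≤ Real.log T := by
  rw [Real.le_log_iff_exp_le (by linarith)]
  have := Real.exp_one_lt_d9
  linarith

/-- common data for Landau at s0 -/
theorem SSY_data {T : ℝ} (hT : 3 ≤ T) {s : ℂ} (h1 : 1 + 1 / T ^ 20 ≤ s.re) (h2 : s.re ≤ 2) (ht : |s.im| ≤ 2 * T) :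
    Differentiable ℂ (fun w => riemannZeta₁ (s + w)) ∧ riemannZeta₁ (s + 0) ≠ 0 ∧
    (∀ w ∈ closedBall (0:ℂ) (1/2), ‖riemannZeta₁ (s + w)‖ ≤ 640 * T^2) ∧
    (∀ w ∈ closedBall (0:ℂ) (1/2), riemannZeta₁ (s + w) = 0 → w.re ≤ 0) ∧
    640 * T^2 ≤ ‖riemannZeta₁ (s + 0)‖ * 2 ^ ⌈100 * Real.log T⌉₊ ∧
    48 * ((⌈100 * Real.log T⌉₊:ℝ) + 1) / (1/2) ≤ 9792 * Real.log T := by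
  have hL := SSY_logT hT
  have hT0 : 0 < T := by linarith
  have hpos : 0 < 1 / T^20 := by positivity
  refine ⟨?_, ?_, ?_, ?_, ?_, ?_⟩
  · exact differentiable_riemannZeta₁.comp (by fun_prop)
  · rw [add_zero]; exact SSZ_ne (by linarith)
  · intro w hw
    have hw' : ‖w‖ ≤ 1/2 := by simpa using hw
    have hre := (abs_le.mp ((abs_re_le_norm w).trans hw'))
    refine (SSB2 (by rw [add_re]; linarith [hre.1]) (by rw [add_re]; linarith [hre.2])).trans ?_
    have hs : ‖s‖ ≤ 2 + 2 * T := by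
      refine (norm_le_abs_re_add_abs_im s).trans ?_
      rw [abs_of_nonneg (by linarith : 0 ≤ s.re)]; linarith
    have := norm_add_le s w
    have h4 : ‖s + w‖ + 1 ≤ 4 * T := by linarith
    calc 40 * (‖s+w‖+1)^2 ≤ 40 * (4*T)^2 := by gcongr
      _ = _ := by ring
  · intro w _ hw
    by_contra h
    push Not at h
    exact SSZ_ne (s := s + w) (by rw [add_re]; linarith) hw
  · rw [add_zero]
    have h3 := SSZ_lower (s := s) (by linarith) (by linarith)
    have h4 : (1 / T^20)^2 / 640 ≤ ‖riemannZeta₁ s‖ := by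
      refine le_trans ?_ h3
      gcongr; linarith
    have h5 : T^60 ≤ 2 ^ ⌈100 * Real.log T⌉₊ := by
      have : Real.log (T^60) ≤ Real.log (2 ^ ⌈100 * Real.log T⌉₊) := by
        rw [Real.log_pow, Real.log_pow]
        have := Nat.le_ceil (100 * Real.log T)
        have := Real.log_two_gt_d9
        push_cast
        nlinarith
      exact (Real.log_le_log_iff (by positivity) (by positivity)).mp this
    have h6 : 640 * 640 * T^42 ≤ T^60 := by
      have : (3:ℝ)^18 ≤ T^18 := by gcongr
      have e : T^60 = T^18 * T^42 := by ring
      rw [e]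
      gcongr
      norm_num at this; linarith
    calc 640 * T^2 = (1 / T^20)^2 / 640 * (640 * 640 * T^42) := by field_simp
      _ ≤ ‖riemannZeta₁ s‖ * 2 ^ ⌈100 * Real.log T⌉₊ := by gcongr; linarith
  · have := Nat.ceil_lt_add_one (a := 100 * Real.log T) (by positivity)
    linarith

theorem SSY_dd (s : ℂ) : deriv (fun w => riemannZeta₁ (s + w)) 0 = deriv riemannZeta₁ s := by
  rw [deriv_comp_const_add]; simp

theorem SSY_lan {T : ℝ} (hT : 3 ≤ T) {s : ℂ} (h1 : 1 + 1 / T ^ 20 ≤ s.re) (h2 : s.re ≤ 2) (ht : |s.im| ≤ 2 * T) :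
    -(9792 * Real.log T) ≤ (deriv riemannZeta₁ s / riemannZeta₁ s).re := by
  obtain ⟨a1, a2, a3, a4, a5, a6⟩ := SSY_data hT h1 h2 ht
  have := SSA1 _ a1 (by norm_num) a2 a3 a4 a5
  rw [SSY_dd, add_zero] at this
  linarith

theorem SSY_lan' {T : ℝ} (hT : 3 ≤ T) {s : ℂ} (h1 : 1 + 1 / T ^ 20 ≤ s.re) (h2 : s.re ≤ 2) (ht : |s.im| ≤ 2 * T)
    {a : ℝ} (ha : 0 < a) (ha2 : a < 1/2) (hz : riemannZeta₁ (s - a) = 0) :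
    -(9792 * Real.log T) + 1 / a - 2 ≤ (deriv riemannZeta₁ s / riemannZeta₁ s).re := by
  obtain ⟨a1, a2, a3, a4, a5, a6⟩ := SSY_data hT h1 h2 ht
  have := SSA1' _ a1 (by norm_num) a2 a3 a4 a5 ha ha2 (by rw [← hz]; ring_nf)
  rw [SSY_dd, add_zero] at this
  have : a / (1/2)^2 ≤ 2 := by norm_num; linarith
  linarith

theorem SSY_zf1 {T : ℝ} (hT : 3 ≤ T) {s : ℂ} (ht1 : 1 ≤ |s.im|) (ht : |s.im| ≤ T)
    (hs : 1 - (1/2000000) / Real.log T ≤ s.re) : riemannZeta₁ s ≠ 0 := by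
  intro hz
  have hL := SSY_logT hT
  have hT0 : 0 < T := by linarith
  set L := Real.log T with hLdef
  have hLT : L ≤ T := by have := Real.log_le_sub_one_of_pos hT0; linarith
  have hβ : s.re < 1 := by
    by_contra h; push Not at h; exact SSZ_ne h hz
  set σ : ℝ := 1 + (1/160000) / L with hσ
  have hσ1 : 1 + 1 / T^20 ≤ σ := by
    rw [hσ, div_div]; gcongr
    have h3 : (3:ℝ)^19 ≤ T^19 := by gcongr
    have e : T^20 = T^19 * T := by ring
    rw [e]; norm_num at h3
    linarith [mul_le_mul_of_nonneg_right h3 hT0.le]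
  have hdl : (1/160000) / L ≤ 1/160000 := div_le_self (by norm_num) hL
  have hdl0 : 0 < (1/160000) / L := by positivity
  have hσ2 : σ ≤ 2 := by linarith
  have hσgt : 1 < σ := by linarith
  set t := s.im
  have h341 := SSZ_341 (σ := σ) (t := t) hσgt
  have hne : ∀ u : ℝ, ((σ:ℂ) + u * I) ≠ 1 := by
    intro u h; have := congrArg re h; simp at this; linarith
  have hzne : ∀ u : ℝ, riemannZeta ((σ:ℂ) + u * I) ≠ 0 := by
    intro u; exact riemannZeta_ne_zero_of_one_le_re (by simp; linarith)
  have hid : ∀ u : ℝ, -deriv riemannZeta (σ + u * I) / riemannZeta (σ + u * I) =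
      1 / (((σ-1:ℝ):ℂ) + u * I) - deriv riemannZeta₁ (σ + u*I) / riemannZeta₁ (σ + u*I) := by
    intro u
    rw [SSZ_deriv (hne u) (hzne u)]
    congr 2; push_cast; ring
  have hid0 := hid 0
  simp only [ofReal_zero, zero_mul, add_zero] at hid0
  rw [hid0, hid t, hid (2*t)] at h341
  have hlan : ∀ u : ℝ, |u| ≤ 2 * T → -(9792 * L) ≤ (deriv riemannZeta₁ (σ + u*I) / riemannZeta₁ (σ + u*I)).re := by
    intro u hu
    exact SSY_lan hT (by simpa using hσ1) (by simpa using hσ2) (by simpa using hu)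
  have hl0 := hlan 0 (by simp; linarith)
  simp only [ofReal_zero, zero_mul, add_zero] at hl0
  have hl2 := hlan (2*t) (by rw [abs_mul]; norm_num; linarith)
  have hre1 : ∀ u : ℝ, 1 ≤ |u| → (1 / (((σ-1:ℝ):ℂ) + u * I)).re ≤ 1 := by
    intro u hu
    refine (re_le_norm _).trans ?_
    rw [norm_div, norm_one, div_le_one]
    · refine hu.trans ?_
      have := abs_im_le_norm (((σ-1:ℝ):ℂ) + u * I)
      simpa using this
    · have := abs_im_le_norm (((σ-1:ℝ):ℂ) + u * I)
      simp only [add_im, ofReal_im, mul_im, ofReal_re, I_im, mul_one, I_re, mul_zero, add_zero, zero_add] at this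
      linarith
  have hr1 := hre1 t ht1
  have hr2 := hre1 (2*t) (by rw [abs_mul]; norm_num; linarith)
  have hr0 : (1 / ((σ-1:ℝ):ℂ)).re = 160000 * L := by
    rw [← ofReal_one, ← ofReal_div, ofReal_re, hσ]; field_simp; ring
  set a := σ - s.re with ha
  have ha0 : 0 < a := by linarith
  have hq : (1/2000000)/L = (2/25) * ((1/160000)/L) := by ring
  have haup : a ≤ (27/25) * ((1/160000)/L) := by rw [hq] at hs; linarith
  have ha2 : a < 1/2 := by linarith
  have hl1 := SSY_lan' hT (s := (σ:ℂ) + t * I) (by simpa using hσ1) (by simpa using hσ2) (by simp; linarith) ha0 ha2 (by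
    rw [← hz]; congr 1; apply Complex.ext <;> simp [ha, t])
  have hainv : (25/27) * (160000 * L) ≤ 1 / a := by
    rw [le_div_iff₀ ha0]
    calc (25/27) * (160000 * L) * a ≤ (25/27) * (160000 * L) * ((27/25) * ((1/160000)/L)) := by gcongr
      _ = 1 := by field_simp
  simp only [add_re, sub_re] at h341
  have e3 : ∀ z : ℂ, (3 * z).re = 3 * z.re := by intro z; simp
  have e4 : ∀ z : ℂ, (4 * z).re = 4 * z.re := by intro z; simp
  rw [e3, e4, sub_re, sub_re, hr0] at h341
  linarith

theorem SSY_zf : ∃ c : ℝ, 0 < c ∧ c ≤ 1 ∧ ∀ T : ℝ, 3 ≤ T → ∀ s : ℂ, |s.im| ≤ T → 1 - c / Real.log T ≤ s.re →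
    riemannZeta₁ s ≠ 0 := by
  set K : Set ℂ := (fun t : ℝ => (1:ℂ) + t * I) '' Icc (-1) 1
  have hK : IsCompact K := isCompact_Icc.image (by fun_prop)
  have hUo : IsOpen {s | riemannZeta₁ s ≠ 0} := isOpen_ne_fun differentiable_riemannZeta₁.continuous continuous_const
  obtain ⟨δ, hδ, hsub⟩ := hK.exists_thickening_subset_open hUo (by
    rintro _ ⟨t, -, rfl⟩
    exact SSZ_ne (by simp))
  refine ⟨min (δ/2) (1/2000000), by positivity, (min_le_right _ _).trans (by norm_num), fun T hT s ht hs => ?_⟩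
  have hL := SSY_logT hT
  rcases le_or_gt 1 |s.im| with h | h
  · refine SSY_zf1 hT h ht (le_trans ?_ hs)
    gcongr; exact min_le_right _ _
  · by_cases h1 : 1 ≤ s.re
    · exact SSZ_ne h1
    · push Not at h1
      apply hsub
      rw [mem_thickening_iff]
      refine ⟨1 + s.im * I, ⟨s.im, ⟨(abs_lt.mp h).1.le, (abs_lt.mp h).2.le⟩, rfl⟩, ?_⟩
      have e : s - (1 + s.im * I) = ((s.re - 1 : ℝ) : ℂ) := by apply Complex.ext <;> simp
      rw [dist_eq_norm, e, norm_real, Real.norm_eq_abs, abs_of_neg (by linarith)]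
      have : min (δ/2) (1/2000000) / Real.log T ≤ δ/2 :=
        (div_le_self (by positivity) hL).trans (min_le_left _ _)
      linarith

theorem SSY_ld : ∃ c C : ℝ, 0 < c ∧ c ≤ 1/6 ∧ 0 < C ∧ ∀ T : ℝ, 3 ≤ T → ∀ s : ℂ, |s.im| ≤ T → 1 - c / Real.log T ≤ s.re →
    s.re ≤ 2 → riemannZeta₁ s ≠ 0 ∧ ‖deriv riemannZeta₁ s / riemannZeta₁ s‖ ≤ C * (Real.log T)^2 := by
  obtain ⟨c, hc, hc1, hzf⟩ := SSY_zf
  set e := c / 6 with he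
  have he0 : 0 < e := by positivity
  have he1 : e ≤ 1/6 := by linarith
  set A : ℝ := 4 + Real.log (230400 / e^2) with hA
  have hAl : 0 ≤ Real.log (230400 / e^2) := Real.log_nonneg (by rw [le_div_iff₀ (by positivity)]; nlinarith)
  have hA0 : 0 < A := by positivity
  refine ⟨e, 6 * A / e, he0, he1, by positivity, fun T hT s ht hs hs2 => ?_⟩
  have hL := SSY_logT hT
  have hT0 : 0 < T := by linarith
  set L := Real.log T with hLdef
  have hL0 : 0 < L := by linarith
  have hLT : L ≤ T := by have := Real.log_le_sub_one_of_pos hT0; linarith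
  have hel : e / L ≤ 1/6 := (div_le_self he0.le hL).trans he1
  have hel0 : 0 < e / L := by positivity
  set s0 : ℂ := s + (2 * (e/L) : ℝ) with hs0
  have hs0re : s0.re = s.re + 2 * (e/L) := by simp [hs0]
  have hs0im : s0.im = s.im := by simp [hs0]
  have hnz : ∀ w ∈ ball (0:ℂ) (4 * (e/L)), riemannZeta₁ (s0 + w) ≠ 0 := by
    intro w hw
    have hw' : ‖w‖ < 4 * (e/L) := by simpa using hw
    have hre := abs_le.mp ((abs_re_le_norm w).trans hw'.le)
    refine hzf (T^2) (le_trans hT (le_self_pow₀ (by linarith) (by norm_num))) _ ?_ ?_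
    · rw [add_im, hs0im]
      have := abs_im_le_norm w
      have := abs_add_le s.im w.im
      have hTT := mul_le_mul_of_nonneg_right hT hT0.le
      rw [sq]; linarith
    · rw [add_re, hs0re, Real.log_pow, ← hLdef]
      have : c / ((2:ℕ) * L) = 3 * (e/L) := by rw [he]; push_cast; field_simp; norm_num
      rw [this]; linarith [hre.1]
  refine ⟨hzf T hT s ht (le_trans ?_ hs), ?_⟩
  · gcongr; linarith
  · have hS : ∀ w ∈ ball (0:ℂ) (4 * (e/L)), ‖riemannZeta₁ (s0 + w)‖ ≤ 360 * T^2 := by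
      intro w hw
      have hw' : ‖w‖ < 4 * (e/L) := by simpa using hw
      have hre := abs_le.mp ((abs_re_le_norm w).trans hw'.le)
      refine (SSB2 (by rw [add_re, hs0re]; linarith [hre.1]) (by rw [add_re, hs0re]; linarith [hre.2])).trans ?_
      have h4 : ‖s0 + w‖ ≤ 3 + (T + 1) := by
        refine (norm_le_abs_re_add_abs_im _).trans ?_
        gcongr
        · rw [add_re, hs0re, abs_le]; constructor <;> linarith [hre.1, hre.2]
        · rw [add_im, hs0im]
          have := abs_im_le_norm w
          have := abs_add_le s.im w.im
          linarith
      calc 40 * (‖s0+w‖+1)^2 ≤ 40 * (3*T)^2 := by gcongr; linarith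
        _ = _ := by ring
    have hM : 360 * T^2 ≤ ‖riemannZeta₁ (s0 + 0)‖ * Real.exp (A * L) := by
      have h3 := SSZ_lower (s := s0) (by rw [hs0re]; linarith) (by rw [hs0re]; linarith)
      have h4 : (e/L)^2/640 ≤ ‖riemannZeta₁ s0‖ := by
        refine le_trans ?_ h3
        gcongr; rw [hs0re]; linarith
      have h5 : 230400 / e^2 * T^4 ≤ Real.exp (A * L) := by
        have e1 : A * L = L * Real.log (230400/e^2) + 4 * L := by rw [hA]; ring
        have e2 : T^4 = Real.exp (4 * L) := by
          rw [← Real.exp_log hT0, ← Real.exp_nat_mul]; norm_num [hLdef]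
        rw [e1, Real.exp_add, e2]
        gcongr
        rw [← Real.log_le_iff_le_exp (by positivity)]
        exact le_mul_of_one_le_left hAl hL
      rw [add_zero]
      calc 360 * T^2 = 360 * T^2 * 1 := by ring
        _ ≤ 360 * T^2 * (T/L)^2 := by
            gcongr
            apply one_le_pow₀
            rw [le_div_iff₀ hL0]; linarith
        _ = (e/L)^2/640 * (230400 / e^2 * T^4) := by field_simp; norm_num
        _ ≤ _ := by gcongr
    have := SSA0 (f := fun w => riemannZeta₁ (s0 + w)) (differentiable_riemannZeta₁.comp (by fun_prop))
      (R := 4 * (e/L)) (S := 360 * T^2) (M := A * L) (by positivity) (by positivity) hnz hS hM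
      (z := -(2 * (e/L) : ℝ)) (by rw [norm_neg, norm_real, Real.norm_of_nonneg (by positivity)]; linarith)
    rw [deriv_comp_const_add] at this
    have e5 : s0 + -((2 * (e/L) : ℝ):ℂ) = s := by rw [hs0]; ring
    rw [e5] at this
    refine this.trans (le_of_eq ?_)
    field_simp; ring

end

section
open Complex Metric Set Filter Topology

theorem SSC_harm (N : ℕ) : ∑ n ∈ Finset.Icc 1 N, 1 / (n:ℝ) ≤ 1 + Real.log N := by
  have := harmonic_le_one_add_log N
  rw [harmonic_eq_sum_Icc] at this
  push_cast at this
  simpa using this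

theorem SSC_recip {N m : ℕ} (hm : m ∈ Finset.Icc 1 N) :
    ∑ n ∈ Finset.Icc 1 N, 1 / |(m:ℝ) - n| ≤ 2 * (1 + Real.log N) := by
  have hm' := Finset.mem_Icc.mp hm
  have h1 : ∀ n ∈ Finset.Icc 1 N, 1 / |(m:ℝ) - n| ≤
      ∑ k ∈ Finset.Icc 1 N, ((if m + k = n then 1 / (k:ℝ) else 0) + (if n + k = m then 1/(k:ℝ) else 0)) := by
    intro n hn
    have hn' := Finset.mem_Icc.mp hn
    have hnn : ∀ k ∈ Finset.Icc 1 N, 0 ≤ ((if m + k = n then 1 / (k:ℝ) else 0) + (if n + k = m then 1/(k:ℝ) else 0)) := by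
      intro k _; split_ifs <;> positivity
    rcases lt_trichotomy m n with h | h | h
    · refine le_trans ?_ (Finset.single_le_sum hnn (Finset.mem_Icc.mpr (⟨by omega, by omega⟩ : 1 ≤ n - m ∧ n - m ≤ N)))
      rw [if_pos (by omega), if_neg (by omega), Nat.cast_sub h.le, abs_sub_comm, abs_of_nonneg]
      · simp
      · have : (m:ℝ) < n := by exact_mod_cast h
        linarith
    · rw [h]; simp only [sub_self, abs_zero, div_zero]; rw [h] at hnn; exact Finset.sum_nonneg hnn
    · refine le_trans ?_ (Finset.single_le_sum hnn (Finset.mem_Icc.mpr (⟨by omega, by omega⟩ : 1 ≤ m - n ∧ m - n ≤ N)))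
      rw [if_neg (by omega), if_pos (by omega), Nat.cast_sub h.le, abs_of_nonneg]
      · simp
      · have : (n:ℝ) < m := by exact_mod_cast h
        linarith
  refine (Finset.sum_le_sum h1).trans ?_
  rw [Finset.sum_comm]
  have h2 : ∀ k ∈ Finset.Icc 1 N, ∑ n ∈ Finset.Icc 1 N, ((if m + k = n then 1 / (k:ℝ) else 0) + (if n + k = m then 1/(k:ℝ) else 0)) ≤ 2 * (1 / (k:ℝ)) := by
    intro k _
    rw [Finset.sum_add_distrib, Finset.sum_ite_eq]
    have h3 : ∑ n ∈ Finset.Icc 1 N, (if n + k = m then 1/(k:ℝ) else 0) ≤ 1 / (k:ℝ) := by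
      calc ∑ n ∈ Finset.Icc 1 N, (if n + k = m then 1/(k:ℝ) else 0) ≤ ∑ n ∈ Finset.Icc 1 N, (if m - k = n then 1/(k:ℝ) else 0) := by
            refine Finset.sum_le_sum (fun n _ => ?_)
            split_ifs <;> first | omega | positivity | exact le_rfl
        _ ≤ _ := by rw [Finset.sum_ite_eq]; split_ifs <;> first | positivity | exact le_rfl
    have h4 : (if m + k ∈ Finset.Icc 1 N then 1 / (k:ℝ) else 0) ≤ 1 / (k:ℝ) := by
      split_ifs <;> first | positivity | exact le_rfl
    linarith
  refine (Finset.sum_le_sum h2).trans ?_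
  rw [← Finset.mul_sum]
  gcongr
  exact SSC_harm N

theorem SSC_log {m n : ℕ} (hm : 1 ≤ m) (h : m < n) : 1 / |Real.log n - Real.log m| ≤ 1 + (m:ℝ) / |(m:ℝ) - n| := by
  have hm0 : (0:ℝ) < m := by exact_mod_cast hm
  have hmn : (m:ℝ) < n := by exact_mod_cast h
  have hn0 : (0:ℝ) < n := by linarith
  have h1 : ((n:ℝ) - m) / n ≤ Real.log n - Real.log m := by
    rw [← Real.log_div hn0.ne' hm0.ne']
    have := Real.one_sub_inv_le_log_of_pos (x := (n:ℝ)/m) (by positivity)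
    rw [inv_div] at this
    rwa [sub_div, div_self hn0.ne']
  have h2 : 0 < ((n:ℝ) - m) / n := div_pos (by linarith) hn0
  rw [abs_of_nonneg (by linarith), abs_sub_comm (m:ℝ), abs_of_nonneg (by linarith : 0 ≤ (n:ℝ) - m)]
  have h3 : 0 < (n:ℝ) - m := by linarith
  calc 1 / (Real.log n - Real.log m) ≤ 1 / (((n:ℝ) - m) / n) := one_div_le_one_div_of_le h2 h1
    _ = 1 + m / ((n:ℝ) - m) := by field_simp; ring

theorem SSC_J {T : ℝ} (hT : 0 ≤ T) {m n : ℕ} (hm : 1 ≤ m) (hn : 1 ≤ n) :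
    ‖∫ t in (-T)..T, (m:ℂ) ^ (-(t * I)) * starRingEnd ℂ ((n:ℂ) ^ (-(t*I)))‖ ≤
      (if m = n then 2 * T else 0) + 2 + 2 * (min (m:ℝ) n / |(m:ℝ) - n|) := by
  have hcp : ∀ (k : ℕ), 1 ≤ k → ∀ t : ℝ, (k:ℂ) ^ (-(t * I)) = exp (-(t * Real.log k) * I) := by
    intro k hk t
    rw [Complex.cpow_def_of_ne_zero (by exact_mod_cast (by omega : k ≠ 0)), Complex.natCast_log]
    congr 1; ring
  have hcp2 : ∀ (k : ℕ), 1 ≤ k → ∀ t : ℝ, starRingEnd ℂ ((k:ℂ) ^ (-(t * I))) = exp ((t * Real.log k) * I) := by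
    intro k hk t
    rw [hcp k hk, ← Complex.exp_conj, map_mul, map_neg, map_mul, conj_ofReal, conj_ofReal, conj_I]; congr 1; ring
  have e : ∀ t : ℝ, (m:ℂ) ^ (-(t * I)) * starRingEnd ℂ ((n:ℂ) ^ (-(t*I))) = exp ((((Real.log n - Real.log m : ℝ):ℂ) * I) * t) := by
    intro t
    rw [hcp m hm, hcp2 n hn, ← Complex.exp_add]; congr 1; push_cast; ring
  simp_rw [e]
  by_cases h : m = n
  · subst h
    simp only [if_true, sub_self]
    simp
    rw [← two_mul, norm_mul, norm_real, Real.norm_of_nonneg hT]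
    norm_num
  · rw [if_neg h, zero_add]
    have hlog : Real.log n - Real.log m ≠ 0 := by
      intro h2
      have := Real.log_injOn_pos (by simp; omega) (by simp; omega) (sub_eq_zero.mp h2)
      apply h; exact_mod_cast this.symm
    have hc : (((Real.log n - Real.log m : ℝ):ℂ) * I) ≠ 0 := mul_ne_zero (by exact_mod_cast hlog) I_ne_zero
    rw [integral_exp_mul_complex hc, norm_div, norm_mul, norm_I, mul_one, norm_real, Real.norm_eq_abs]
    have h1 : ∀ u : ℝ, ‖exp ((((Real.log n - Real.log m : ℝ):ℂ) * I) * u)‖ = 1 := by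
      intro u
      have e2 : (((Real.log n - Real.log m : ℝ):ℂ) * I) * u = (((Real.log n - Real.log m)*u : ℝ):ℂ) * I := by push_cast; ring
      rw [e2, Complex.norm_exp_ofReal_mul_I]
    have h2 := norm_sub_le (exp ((((Real.log n - Real.log m : ℝ):ℂ) * I) * T)) (exp ((((Real.log n - Real.log m : ℝ):ℂ) * I) * ((-T:ℝ):ℂ)))
    rw [h1, h1] at h2
    have h3 : 1 / |Real.log n - Real.log m| ≤ 1 + min (m:ℝ) n / |(m:ℝ) - n| := by
      rcases lt_or_gt_of_ne h with h | h
      · rw [min_eq_left (by exact_mod_cast h.le)]; exact SSC_log hm h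
      · rw [min_eq_right (by exact_mod_cast h.le), abs_sub_comm, abs_sub_comm (m:ℝ)]; exact SSC_log hn h
    calc _ ≤ 2 / |Real.log n - Real.log m| := by gcongr; linarith
      _ = 2 * (1 / |Real.log n - Real.log m|) := by ring
      _ ≤ 2 * (1 + min (m:ℝ) n / |(m:ℝ) - n|) := by gcongr
      _ = _ := by ring

theorem SSC_mv {T : ℝ} (hT : 0 ≤ T) (N : ℕ) (a : ℕ → ℂ) :
    ∫ t in (-T)..T, ‖∑ n ∈ Finset.Icc 1 N, a n * (n:ℂ) ^ (-(t * I))‖ ^ 2 ≤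
      2 * T * ∑ n ∈ Finset.Icc 1 N, ‖a n‖^2 + 2 * (∑ n ∈ Finset.Icc 1 N, ‖a n‖)^2 +
        4 * (1 + Real.log N) * ∑ n ∈ Finset.Icc 1 N, n * ‖a n‖^2 := by
  have hcont : ∀ n ∈ Finset.Icc 1 N, Continuous (fun t : ℝ => (n:ℂ) ^ (-((t:ℂ) * I))) := by
    intro n hn
    have : n ≠ 0 := by have := Finset.mem_Icc.mp hn; omega
    exact Continuous.const_cpow (by fun_prop) (Or.inl (by exact_mod_cast this))
  have e : ((∫ t in (-T)..T, ‖∑ n ∈ Finset.Icc 1 N, a n * (n:ℂ) ^ (-(t * I))‖ ^ 2 : ℝ) : ℂ) =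
      ∑ m ∈ Finset.Icc 1 N, ∑ n ∈ Finset.Icc 1 N, (a m * starRingEnd ℂ (a n)) *
        ∫ t in (-T)..T, (m:ℂ) ^ (-(t * I)) * starRingEnd ℂ ((n:ℂ) ^ (-(t*I))) := by
    rw [← intervalIntegral.integral_ofReal]
    have e1 : ∀ t : ℝ, ((‖∑ n ∈ Finset.Icc 1 N, a n * (n:ℂ) ^ (-(t * I))‖ ^ 2 : ℝ) : ℂ) =
        ∑ m ∈ Finset.Icc 1 N, ∑ n ∈ Finset.Icc 1 N, (a m * starRingEnd ℂ (a n)) *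
        ((m:ℂ) ^ (-(t * I)) * starRingEnd ℂ ((n:ℂ) ^ (-(t*I)))) := by
      intro t
      rw [← Complex.normSq_eq_norm_sq, ← Complex.mul_conj, map_sum, Finset.sum_mul_sum]
      refine Finset.sum_congr rfl (fun m _ => Finset.sum_congr rfl (fun n _ => ?_))
      rw [map_mul]; ring
    simp_rw [e1]
    have hci : ∀ m ∈ Finset.Icc 1 N, ∀ n ∈ Finset.Icc 1 N, Continuous (fun t : ℝ => (a m * starRingEnd ℂ (a n)) *
        ((m:ℂ) ^ (-((t:ℂ) * I)) * starRingEnd ℂ ((n:ℂ) ^ (-(t*I))))) := by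
      intro m hm n hn
      exact continuous_const.mul ((hcont m hm).mul (Complex.continuous_conj.comp (hcont n hn)))
    rw [intervalIntegral.integral_finsetSum (fun m hm =>
      (continuous_finsetSum _ (fun n hn => hci m hm n hn)).intervalIntegrable _ _)]
    refine Finset.sum_congr rfl (fun m hm => ?_)
    rw [intervalIntegral.integral_finsetSum (fun n hn => (hci m hm n hn).intervalIntegrable _ _)]
    refine Finset.sum_congr rfl (fun n hn => ?_)
    rw [intervalIntegral.integral_const_mul]
  have h1 : (∫ t in (-T)..T, ‖∑ n ∈ Finset.Icc 1 N, a n * (n:ℂ) ^ (-(t * I))‖ ^ 2) ≤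
     ∑ m ∈ Finset.Icc 1 N, ∑ n ∈ Finset.Icc 1 N, ‖a m‖ * ‖a n‖ * ((if m = n then 2 * T else 0) + 2 + 2 * (min (m:ℝ) n / |(m:ℝ) - n|)) := by
    refine (le_abs_self _).trans ?_
    rw [← Real.norm_eq_abs, ← norm_real, e]
    refine (norm_sum_le _ _).trans (Finset.sum_le_sum (fun m hm => (norm_sum_le _ _).trans (Finset.sum_le_sum (fun n hn => ?_))))
    rw [norm_mul, norm_mul, RCLike.norm_conj]
    gcongr
    exact SSC_J hT (Finset.mem_Icc.mp hm).1 (Finset.mem_Icc.mp hn).1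
  refine h1.trans ?_
  have h2 : ∀ m ∈ Finset.Icc 1 N, ∀ n ∈ Finset.Icc 1 N, ‖a m‖ * ‖a n‖ * ((if m = n then 2 * T else 0) + 2 + 2 * (min (m:ℝ) n / |(m:ℝ) - n|)) ≤
      (if m = n then 2 * T * ‖a m‖^2 else 0) + 2 * (‖a m‖ * ‖a n‖) + ((m * ‖a m‖^2) * (1 / |(m:ℝ) - n|) + (n * ‖a n‖^2) * (1/|(n:ℝ) - m|)) := by
    intro m _ n _
    have h3 : ‖a m‖ * ‖a n‖ * (if m = n then 2 * T else 0) = (if m = n then 2 * T * ‖a m‖^2 else 0) := by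
      split_ifs with h
      · rw [h]; ring
      · ring
    have h4 : ‖a m‖ * ‖a n‖ * (2 * min (m:ℝ) n) ≤ m * ‖a m‖^2 + n * ‖a n‖^2 := by
      have hmin : 0 ≤ min (m:ℝ) n := by positivity
      calc ‖a m‖ * ‖a n‖ * (2 * min (m:ℝ) n) = min (m:ℝ) n * (2 * ‖a m‖ * ‖a n‖) := by ring
        _ ≤ min (m:ℝ) n * (‖a m‖^2 + ‖a n‖^2) := by gcongr; exact two_mul_le_add_sq _ _
        _ = min (m:ℝ) n * ‖a m‖^2 + min (m:ℝ) n * ‖a n‖^2 := by ring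
        _ ≤ _ := by gcongr; exact min_le_left _ _; exact min_le_right _ _
    have h5 : ‖a m‖ * ‖a n‖ * (2 * (min (m:ℝ) n / |(m:ℝ) - n|)) ≤ (m * ‖a m‖^2 + n * ‖a n‖^2) * (1 / |(m:ℝ) - n|) := by
      calc _ = ‖a m‖ * ‖a n‖ * (2 * min (m:ℝ) n) * (1 / |(m:ℝ) - n|) := by ring
        _ ≤ _ := by gcongr
    rw [abs_sub_comm (n:ℝ) m, mul_add, mul_add, h3]
    linarith
  refine (Finset.sum_le_sum (fun m hm => Finset.sum_le_sum (h2 m hm))).trans ?_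
  simp only [Finset.sum_add_distrib]
  have e5 : ∑ m ∈ Finset.Icc 1 N, ∑ n ∈ Finset.Icc 1 N, (if m = n then 2 * T * ‖a m‖^2 else 0) = 2 * T * ∑ n ∈ Finset.Icc 1 N, ‖a n‖^2 := by
    rw [Finset.mul_sum]
    refine Finset.sum_congr rfl (fun m hm => ?_)
    rw [Finset.sum_ite_eq, if_pos hm]
  have e6 : ∑ m ∈ Finset.Icc 1 N, ∑ n ∈ Finset.Icc 1 N, 2 * (‖a m‖ * ‖a n‖) = 2 * (∑ n ∈ Finset.Icc 1 N, ‖a n‖)^2 := by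
    rw [sq, Finset.sum_mul_sum, Finset.mul_sum]
    simp_rw [Finset.mul_sum]
  have e7 : ∑ m ∈ Finset.Icc 1 N, ∑ n ∈ Finset.Icc 1 N, (m * ‖a m‖^2) * (1 / |(m:ℝ) - n|) ≤ 2 * (1 + Real.log N) * ∑ n ∈ Finset.Icc 1 N, n * ‖a n‖^2 := by
    rw [Finset.mul_sum]
    refine Finset.sum_le_sum (fun m hm => ?_)
    rw [← Finset.mul_sum, mul_comm]
    gcongr
    exact SSC_recip hm
  have e8 : ∑ m ∈ Finset.Icc 1 N, ∑ n ∈ Finset.Icc 1 N, (n * ‖a n‖^2) * (1 / |(n:ℝ) - m|) ≤ 2 * (1 + Real.log N) * ∑ n ∈ Finset.Icc 1 N, n * ‖a n‖^2 := by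
    rw [Finset.sum_comm]; exact e7
  rw [e5, e6]
  linarith

end

section
open Complex Metric Set Filter Topology

theorem SSD_d2 (x : ℕ) : ∑ n ∈ Finset.Icc 1 x, ((n.divisors.card:ℝ))^2 / n ≤ (1 + Real.log x)^4 := by
  classical
  have e1 : ∑ n ∈ Finset.Icc 1 x, ((n.divisors.card:ℝ))^2 / n =
      ∑ p ∈ (Finset.Icc 1 x).sigma (fun n => n.divisors ×ˢ n.divisors), 1 / (p.1:ℝ) := by
    rw [Finset.sum_sigma]
    refine Finset.sum_congr rfl (fun n _ => ?_)
    show _ = ∑ _ ∈ n.divisors ×ˢ n.divisors, 1 / (n:ℝ)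
    rw [Finset.sum_const, Finset.card_product, nsmul_eq_mul]; push_cast; ring
  set φ : (Σ _ : ℕ, ℕ × ℕ) → (ℕ × ℕ) × (ℕ × ℕ) := fun p =>
    ((Nat.gcd p.2.1 p.2.2, p.2.1 / Nat.gcd p.2.1 p.2.2), (p.2.2 / Nat.gcd p.2.1 p.2.2, p.1 / Nat.lcm p.2.1 p.2.2)) with hφ
  set h : (ℕ × ℕ) × (ℕ × ℕ) → ℝ := fun q => (1 / (q.1.1:ℝ) * (1/(q.1.2:ℝ))) * (1 / (q.2.1:ℝ) * (1/(q.2.2:ℝ))) with hh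
  set A := (Finset.Icc 1 x).sigma (fun n => n.divisors ×ˢ n.divisors) with hA
  have key : ∀ p ∈ A, 1 ≤ p.1 ∧ p.1 ≤ x ∧ p.2.1 ≠ 0 ∧ p.2.2 ≠ 0 ∧ p.2.1 ∣ p.1 ∧ p.2.2 ∣ p.1 := by
    rintro ⟨n, a, b⟩ hp
    simp only [hA, Finset.mem_sigma, Finset.mem_Icc, Finset.mem_product, Nat.mem_divisors] at hp
    obtain ⟨⟨h1, h2⟩, ⟨h3, h4⟩, h5, _⟩ := hp
    exact ⟨h1, h2, fun h => h4 (by simp only at h; rw [h] at h3; exact zero_dvd_iff.mp h3), fun h => h4 (by simp only at h; rw [h] at h5; exact zero_dvd_iff.mp h5), h3, h5⟩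
  have hprod : ∀ p ∈ A, p.2.1 = (φ p).1.1 * (φ p).1.2 ∧ p.2.2 = (φ p).1.1 * (φ p).2.1 ∧
      p.1 = (φ p).1.1 * (φ p).1.2 * ((φ p).2.1 * (φ p).2.2) := by
    rintro ⟨n, a, b⟩ hp
    obtain ⟨h1, h2, ha, hb, hda, hdb⟩ := key _ hp
    simp only [hφ] at *
    have ea := Nat.mul_div_cancel' (Nat.gcd_dvd_left a b)
    have eb := Nat.mul_div_cancel' (Nat.gcd_dvd_right a b)
    have el := Nat.mul_div_cancel' (Nat.lcm_dvd hda hdb)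
    refine ⟨ea.symm, eb.symm, ?_⟩
    rw [ea]
    have hl : Nat.lcm a b = a * (b / Nat.gcd a b) := by
      rw [Nat.lcm, Nat.mul_div_assoc _ (Nat.gcd_dvd_right a b)]
    rw [← mul_assoc, ← hl, el]
  have hinj : Set.InjOn φ A := by
    rintro p hp q hq hpq
    obtain ⟨a1, a2, a3⟩ := hprod p hp
    obtain ⟨b1, b2, b3⟩ := hprod q hq
    rw [hpq, ← b1] at a1
    rw [hpq, ← b2] at a2
    rw [hpq, ← b3] at a3
    obtain ⟨n, a, b⟩ := p
    obtain ⟨n', a', b'⟩ := q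
    simp only at a1 a2 a3
    subst a1 a2 a3
    rfl
  have hval : ∀ p ∈ A, 1 / (p.1:ℝ) = h (φ p) := by
    intro p hp
    obtain ⟨-, -, a3⟩ := hprod p hp
    simp only [hh]
    conv_lhs => rw [a3]
    push_cast
    rw [one_div, one_div, one_div, one_div, one_div, mul_inv, mul_inv, mul_inv]
  set B := (Finset.Icc 1 x ×ˢ Finset.Icc 1 x) ×ˢ (Finset.Icc 1 x ×ˢ Finset.Icc 1 x) with hB
  have himg : A.image φ ⊆ B := by
    intro q hq
    obtain ⟨p, hp, rfl⟩ := Finset.mem_image.mp hq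
    obtain ⟨h1, h2, -⟩ := key p hp
    obtain ⟨-, -, a3⟩ := hprod p hp
    have hne : (φ p).1.1 * (φ p).1.2 * ((φ p).2.1 * (φ p).2.2) ≠ 0 := by omega
    have hd : ∀ d, d ∣ p.1 → d ≠ 0 → d ∈ Finset.Icc 1 x := by
      intro d hd h0
      have := Nat.le_of_dvd (by omega) hd
      exact Finset.mem_Icc.mpr ⟨by omega, by omega⟩
    simp only [mul_ne_zero_iff] at hne
    simp only [hB, Finset.mem_product]
    refine ⟨⟨hd _ ?_ hne.1.1, hd _ ?_ hne.1.2⟩, ⟨hd _ ?_ hne.2.1, hd _ ?_ hne.2.2⟩⟩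
    · rw [a3]; exact (dvd_mul_right _ _).mul_right _
    · rw [a3]; exact (dvd_mul_left _ _).mul_right _
    · rw [a3]; exact (dvd_mul_right _ _).mul_left _
    · rw [a3]; exact (dvd_mul_left _ _).mul_left _
  rw [e1, Finset.sum_congr rfl hval, ← Finset.sum_image (f := h) hinj]
  refine (Finset.sum_le_sum_of_subset_of_nonneg himg (fun q _ _ => by simp only [hh]; positivity)).trans ?_
  have e2 : ∑ q ∈ B, h q = (∑ n ∈ Finset.Icc 1 x, 1 / (n:ℝ))^4 := by
    have g2 : ∑ q ∈ Finset.Icc 1 x ×ˢ Finset.Icc 1 x, (1 / (q.1:ℝ) * (1/(q.2:ℝ))) = (∑ n ∈ Finset.Icc 1 x, 1 / (n:ℝ))^2 := by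
      rw [pow_two, Finset.sum_mul_sum, Finset.sum_product]
    rw [show (∑ n ∈ Finset.Icc 1 x, 1 / (n:ℝ))^4 = (∑ n ∈ Finset.Icc 1 x, 1 / (n:ℝ))^2 * (∑ n ∈ Finset.Icc 1 x, 1 / (n:ℝ))^2 by ring, ← g2, Finset.sum_mul_sum, hB, Finset.sum_product]
  rw [e2]
  have : 0 ≤ ∑ n ∈ Finset.Icc 1 x, 1 / (n:ℝ) := Finset.sum_nonneg (fun n _ => by positivity)
  gcongr
  exact SSC_harm x

end

section
open Complex Metric Set Filter Topology

noncomputable def SSc (N : ℕ) : ℝ :=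
  (∑ n ∈ Finset.Icc 1 N, (ArithmeticFunction.moebius n : ℝ) / n) / (∑ n ∈ Finset.Ioc N (2*N), 1/(n:ℝ))

noncomputable def SSbt (N n : ℕ) : ℝ :=
  if n ≤ N then (ArithmeticFunction.moebius n : ℝ) else - SSc N

noncomputable def SSM (N : ℕ) (s : ℂ) : ℂ := ∑ n ∈ Finset.Icc 1 (2*N), (SSbt N n : ℂ) * (n:ℂ)^(-s)

theorem SSE_log {N : ℕ} (hN : 3 ≤ N) : 1 ≤ Real.log N := SSY_logT (by exact_mod_cast hN)

theorem SSE_mu (n : ℕ) : |(ArithmeticFunction.moebius n : ℝ)| ≤ 1 := by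
  have := ArithmeticFunction.abs_moebius_le_one (n := n)
  exact_mod_cast this

theorem SSE_den {N : ℕ} (hN : 3 ≤ N) : 1/2 ≤ ∑ n ∈ Finset.Ioc N (2*N), 1/(n:ℝ) := by
  have : ∑ n ∈ Finset.Ioc N (2*N), 1/((2*N:ℕ):ℝ) ≤ ∑ n ∈ Finset.Ioc N (2*N), 1/(n:ℝ) := by
    refine Finset.sum_le_sum (fun n hn => ?_)
    rw [Finset.mem_Ioc] at hn
    have h1 : (0:ℝ) < n := by exact_mod_cast (by omega : 0 < n)
    have h2 : (n:ℝ) ≤ ((2*N:ℕ):ℝ) := by exact_mod_cast hn.2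
    exact one_div_le_one_div_of_le h1 h2
  refine le_trans ?_ this
  rw [Finset.sum_const, Nat.card_Ioc, nsmul_eq_mul, show 2*N - N = N by omega]
  have h1 : (0:ℝ) < N := by exact_mod_cast (by omega : 0 < N)
  push_cast
  apply le_of_eq
  field_simp

theorem SSE_c {N : ℕ} (hN : 3 ≤ N) : |SSc N| ≤ 4 * Real.log N := by
  have hl := SSE_log hN
  have hd := SSE_den hN
  have hn : |∑ n ∈ Finset.Icc 1 N, (ArithmeticFunction.moebius n : ℝ) / n| ≤ 1 + Real.log N := by
    refine (Finset.abs_sum_le_sum_abs _ _).trans (le_trans ?_ (SSC_harm N))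
    refine Finset.sum_le_sum (fun n hn => ?_)
    rw [abs_div, Nat.abs_cast]
    gcongr
    exact SSE_mu n
  unfold SSc
  rw [abs_div, abs_of_pos (by linarith : 0 < ∑ n ∈ Finset.Ioc N (2*N), 1/(n:ℝ)), div_le_iff₀ (by linarith)]
  nlinarith

theorem SSE_bt {N : ℕ} (hN : 3 ≤ N) (n : ℕ) : |SSbt N n| ≤ 4 * Real.log N := by
  have hl := SSE_log hN
  unfold SSbt
  split_ifs
  · have := SSE_mu n; linarith
  · rw [abs_neg]; exact SSE_c hN

theorem SSE_M1 {N : ℕ} (hN : 3 ≤ N) : SSM N 1 = 0 := by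
  have hd := SSE_den hN
  have e : SSM N 1 = ((∑ n ∈ Finset.Icc 1 (2*N), SSbt N n / n : ℝ) : ℂ) := by
    unfold SSM
    push_cast
    refine Finset.sum_congr rfl (fun n hn => ?_)
    rw [Complex.cpow_neg_one, div_eq_mul_inv]
  rw [e]
  have hu : Finset.Icc 1 (2*N) = Finset.Icc 1 N ∪ Finset.Ioc N (2*N) := by
    ext n; simp only [Finset.mem_union, Finset.mem_Icc, Finset.mem_Ioc]; omega
  have hdj : Disjoint (Finset.Icc 1 N) (Finset.Ioc N (2*N)) := by
    rw [Finset.disjoint_left]; intro n; simp only [Finset.mem_Icc, Finset.mem_Ioc]; omega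
  rw [hu, Finset.sum_union hdj]
  have e1 : ∑ n ∈ Finset.Icc 1 N, SSbt N n / n = ∑ n ∈ Finset.Icc 1 N, (ArithmeticFunction.moebius n : ℝ) / n := by
    refine Finset.sum_congr rfl (fun n hn => ?_)
    rw [Finset.mem_Icc] at hn
    simp [SSbt, hn.2]
  have e2 : ∑ n ∈ Finset.Ioc N (2*N), SSbt N n / n = - SSc N * ∑ n ∈ Finset.Ioc N (2*N), 1/(n:ℝ) := by
    rw [Finset.mul_sum]
    refine Finset.sum_congr rfl (fun n hn => ?_)
    rw [Finset.mem_Ioc] at hn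
    simp only [SSbt, if_neg (not_le.mpr hn.1)]
    ring
  rw [e1, e2]
  have : SSc N * ∑ n ∈ Finset.Ioc N (2*N), 1/(n:ℝ) = ∑ n ∈ Finset.Icc 1 N, (ArithmeticFunction.moebius n : ℝ) / n := by
    unfold SSc
    rw [div_mul_cancel₀]; linarith
  rw [neg_mul, this, add_neg_cancel]; simp

theorem SSM_diff (N : ℕ) : Differentiable ℂ (SSM N) := by
  intro s
  unfold SSM
  refine DifferentiableAt.fun_sum (fun n hn => ?_)
  have hn0 : (n:ℂ) ≠ 0 := by
    rw [Finset.mem_Icc] at hn; exact_mod_cast (by omega : n ≠ 0)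
  exact (differentiableAt_id.neg.const_cpow (Or.inl hn0)).const_mul _

theorem SSE_pow {x n : ℕ} {κ σ : ℝ} (hn : 1 ≤ n) (hx : n ≤ x) (hk : 0 ≤ κ) (hs : 1 - κ ≤ σ) :
    (n:ℝ)^(-σ) ≤ (x:ℝ)^κ * (1/(n:ℝ)) := by
  have h1 : (1:ℝ) ≤ n := by exact_mod_cast hn
  calc (n:ℝ)^(-σ) ≤ (n:ℝ)^(κ + (-1)) := Real.rpow_le_rpow_of_exponent_le h1 (by linarith)
    _ = (n:ℝ)^κ * (1/(n:ℝ)) := by rw [Real.rpow_add (by linarith), Real.rpow_neg_one, one_div]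
    _ ≤ _ := by gcongr

theorem SSE_e6 {N x : ℕ} {m : ℕ} (hN : 3 ≤ N) (hx : x ≤ N^m) : (x:ℝ)^(1/Real.log N) ≤ Real.exp m := by
  have hl := SSE_log hN
  have h0 : (0:ℝ) < N := by exact_mod_cast (by omega : 0 < N)
  have hx' : (x:ℝ) ≤ (N:ℝ)^m := by exact_mod_cast hx
  calc (x:ℝ)^(1/Real.log N) ≤ ((N:ℝ)^m)^(1/Real.log N) := by gcongr
    _ = Real.exp m := by
      rw [Real.rpow_def_of_pos (by positivity), Real.log_pow]
      congr 1; field_simp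

theorem SSE_norm {n : ℕ} (hn : 1 ≤ n) (s : ℂ) : ‖(n:ℂ)^(-s)‖ = (n:ℝ)^(-s.re) := by
  rw [Complex.norm_natCast_cpow_of_pos (by omega)]; simp

/-- bound for M in half planes -/
theorem SSE_Mb {N : ℕ} (hN : 3 ≤ N) {κ : ℝ} (hk : 0 ≤ κ) {s : ℂ} (hs : 1 - κ ≤ s.re) :
    ‖SSM N s‖ ≤ 12 * (Real.log N)^2 * ((2*N:ℕ):ℝ)^κ := by
  have hl := SSE_log hN
  have h0 : (0:ℝ) < N := by exact_mod_cast (by omega : 0 < N)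
  have hh : Real.log ((2*N:ℕ):ℝ) ≤ 2 * Real.log N := by
    have : ((2*N:ℕ):ℝ) ≤ (N:ℝ)^2 := by
      have h3 : (3:ℝ) ≤ N := by exact_mod_cast hN
      push_cast; nlinarith
    calc _ ≤ Real.log ((N:ℝ)^2) := Real.log_le_log (by push_cast; linarith) this
      _ = _ := by rw [Real.log_pow]; norm_num
  unfold SSM
  refine (norm_sum_le _ _).trans ?_
  calc ∑ n ∈ Finset.Icc 1 (2*N), ‖(SSbt N n : ℂ) * (n:ℂ)^(-s)‖
      ≤ ∑ n ∈ Finset.Icc 1 (2*N), 4 * Real.log N * (((2*N:ℕ):ℝ)^κ * (1/(n:ℝ))) := by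
        refine Finset.sum_le_sum (fun n hn => ?_)
        rw [Finset.mem_Icc] at hn
        rw [norm_mul, SSE_norm hn.1, Complex.norm_real, Real.norm_eq_abs]
        have := SSE_bt hN n
        have := SSE_pow hn.1 hn.2 hk hs
        gcongr
    _ = 4 * Real.log N * ((2*N:ℕ):ℝ)^κ * ∑ n ∈ Finset.Icc 1 (2*N), 1/(n:ℝ) := by
        rw [Finset.mul_sum]; refine Finset.sum_congr rfl (fun n _ => by ring)
    _ ≤ 4 * Real.log N * ((2*N:ℕ):ℝ)^κ * (3 * Real.log N) := by
        gcongr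
        refine (SSC_harm _).trans ?_
        linarith
    _ = _ := by ring

theorem SSE_M' {N : ℕ} (hN : 3 ≤ N) {s : ℂ} (hs : 1 - 1/Real.log N ≤ s.re) :
    ‖deriv (SSM N) s‖ ≤ 24 * Real.exp 6 * (Real.log N)^3 := by
  have hl := SSE_log hN
  have h0 : (0:ℝ) < N := by exact_mod_cast (by omega : 0 < N)
  have hh : Real.log ((2*N:ℕ):ℝ) ≤ 2 * Real.log N := by
    have : ((2*N:ℕ):ℝ) ≤ (N:ℝ)^2 := by
      have h3 : (3:ℝ) ≤ N := by exact_mod_cast hN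
      push_cast; nlinarith
    calc _ ≤ Real.log ((N:ℝ)^2) := Real.log_le_log (by push_cast; linarith) this
      _ = _ := by rw [Real.log_pow]; norm_num
  have hd : HasDerivAt (SSM N) (∑ n ∈ Finset.Icc 1 (2*N), (SSbt N n : ℂ) * ((n:ℂ)^(-s) * Complex.log n * (-1))) s := by
    unfold SSM
    refine HasDerivAt.fun_sum (fun n hn => ?_)
    have hn0 : (n:ℂ) ≠ 0 := by
      rw [Finset.mem_Icc] at hn; exact_mod_cast (by omega : n ≠ 0)
    exact ((hasDerivAt_id s).neg.const_cpow (Or.inl hn0)).const_mul _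
  rw [hd.deriv]
  refine (norm_sum_le _ _).trans ?_
  have hk : (0:ℝ) ≤ 1/Real.log N := by positivity
  have h6 : ((2*N:ℕ):ℝ)^(1/Real.log N) ≤ Real.exp 6 := by
    refine (SSE_e6 (m := 2) hN (by nlinarith)).trans ?_
    apply Real.exp_le_exp.mpr; norm_num
  calc ∑ n ∈ Finset.Icc 1 (2*N), ‖(SSbt N n : ℂ) * ((n:ℂ)^(-s) * Complex.log n * (-1))‖
      ≤ ∑ n ∈ Finset.Icc 1 (2*N), 4 * Real.log N * ((Real.exp 6 * (1/(n:ℝ))) * (2 * Real.log N)) := by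
        refine Finset.sum_le_sum (fun n hn => ?_)
        rw [Finset.mem_Icc] at hn
        rw [norm_mul, norm_mul, norm_mul, SSE_norm hn.1, Complex.norm_real, Real.norm_eq_abs, norm_neg, norm_one, mul_one, ← Complex.natCast_log, Complex.norm_real, Real.norm_eq_abs]
        have h1 := SSE_bt hN n
        have h2 := SSE_pow hn.1 hn.2 hk hs
        have h3 : (1:ℝ) ≤ n := by exact_mod_cast hn.1
        have h4 : |Real.log n| ≤ 2 * Real.log N := by
          rw [abs_of_nonneg (Real.log_nonneg h3)]
          exact (Real.log_le_log (by linarith) (by exact_mod_cast hn.2)).trans hh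
        have h5 : (n:ℝ)^(-s.re) ≤ Real.exp 6 * (1/(n:ℝ)) := h2.trans (by gcongr)
        gcongr
    _ = 8 * (Real.log N)^2 * Real.exp 6 * ∑ n ∈ Finset.Icc 1 (2*N), 1/(n:ℝ) := by
        rw [Finset.mul_sum]; refine Finset.sum_congr rfl (fun n _ => by ring)
    _ ≤ 8 * (Real.log N)^2 * Real.exp 6 * (3 * Real.log N) := by
        gcongr
        refine (SSC_harm _).trans ?_
        linarith
    _ = _ := by ring

noncomputable def SSD' (N : ℕ) : ℂ → ℂ := dslope (SSM N) 1

theorem SSD'_mul {N : ℕ} (hN : 3 ≤ N) (s : ℂ) : (s - 1) * SSD' N s = SSM N s := by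
  have := sub_smul_dslope (SSM N) 1 s
  rw [SSE_M1 hN, sub_zero, smul_eq_mul] at this
  exact this

theorem SSD'_diff (N : ℕ) : Differentiable ℂ (SSD' N) := by
  have h := (Complex.differentiableOn_dslope (f := SSM N) (c := 1) (s := Set.univ) Filter.univ_mem).mpr (SSM_diff N).differentiableOn
  exact differentiableOn_univ.mp h

theorem SSD'_b {N : ℕ} (hN : 3 ≤ N) {s : ℂ} (hs : 1 - 1/Real.log N ≤ s.re) :
    ‖SSD' N s‖^2 ≤ (24 * Real.exp 6 * (Real.log N)^3)^2 * (2 * (1 + s.im^2)⁻¹) := by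
  have hl := SSE_log hN
  set K := 24 * Real.exp 6 * (Real.log N)^3 with hK
  have hk : (0:ℝ) ≤ 1/Real.log N := by positivity
  have hK0 : 0 < K := by positivity
  have b1 : ‖SSD' N s‖ ≤ K := by
    by_cases h1 : s = 1
    · subst h1
      rw [SSD', dslope_same]
      exact SSE_M' hN hs
    · have hc : Convex ℝ {z : ℂ | 1 - 1/Real.log N ≤ z.re} := convex_halfSpace_re_ge _
      have := hc.norm_image_sub_le_of_norm_deriv_le (f := SSM N) (C := K) (x := 1) (y := s) (fun z _ => SSM_diff N z)
        (fun z hz => SSE_M' hN hz) (by show 1 - 1/Real.log N ≤ (1:ℂ).re; rw [Complex.one_re]; linarith) hs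
      rw [SSE_M1 hN, sub_zero, ← SSD'_mul hN, norm_mul, mul_comm] at this
      have h2 : 0 < ‖s - 1‖ := norm_pos_iff.mpr (sub_ne_zero.mpr h1)
      exact le_of_mul_le_mul_right this h2
  have b2 : |s.im| * ‖SSD' N s‖ ≤ K := by
    have h1 : |s.im| ≤ ‖s - 1‖ := by simpa using Complex.abs_im_le_norm (s - 1)
    calc |s.im| * ‖SSD' N s‖ ≤ ‖s-1‖ * ‖SSD' N s‖ := by gcongr
      _ = ‖SSM N s‖ := by rw [← norm_mul, SSD'_mul hN]
      _ ≤ 12 * (Real.log N)^2 * ((2*N:ℕ):ℝ)^(1/Real.log N) := SSE_Mb hN hk hs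
      _ ≤ 12 * (Real.log N)^2 * Real.exp 6 := by
        gcongr
        refine (SSE_e6 (m := 2) hN (by nlinarith)).trans ?_
        apply Real.exp_le_exp.mpr; norm_num
      _ ≤ K := by
        rw [hK]
        have : (0:ℝ) < Real.exp 6 * (Real.log N)^2 := by positivity
        nlinarith
  have c1 : ‖SSD' N s‖^2 ≤ K^2 := by gcongr
  have c2 : s.im^2 * ‖SSD' N s‖^2 ≤ K^2 := by
    rw [← sq_abs s.im, ← mul_pow]; gcongr
  rw [← mul_assoc, ← div_eq_mul_inv, le_div_iff₀ (by positivity)]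
  nlinarith

end

section
open Complex Metric Set Filter Topology

noncomputable def SSq (N X n : ℕ) : ℝ :=
  ∑ p ∈ (Finset.Icc 1 X ×ˢ Finset.Icc 1 (2*N)).filter (fun p => p.1 * p.2 = n), SSbt N p.2

theorem SSq_prod (N X : ℕ) (s : ℂ) :
    SSS X s * SSM N s = ∑ n ∈ Finset.Icc 1 (X*(2*N)), (SSq N X n : ℂ) * (n:ℂ)^(-s) := by
  unfold SSS SSM
  rw [Finset.sum_mul_sum, ← Finset.sum_product']
  rw [← Finset.sum_fiberwise_of_maps_to (s := Finset.Icc 1 X ×ˢ Finset.Icc 1 (2*N)) (t := Finset.Icc 1 (X*(2*N))) (g := fun p => p.1*p.2)]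
  · refine Finset.sum_congr rfl (fun n hn => ?_)
    unfold SSq
    push_cast
    rw [Finset.sum_mul]
    refine Finset.sum_congr rfl (fun p hp => ?_)
    rw [Finset.mem_filter] at hp
    rw [← hp.2, Nat.cast_mul, Complex.natCast_mul_natCast_cpow]
    ring
  · intro p hp
    rw [Finset.mem_product, Finset.mem_Icc, Finset.mem_Icc] at hp
    rw [Finset.mem_Icc]
    exact ⟨Nat.mul_pos hp.1.1 hp.2.1, Nat.mul_le_mul hp.1.2 hp.2.2⟩

theorem SSq_bd {N X n : ℕ} (hN : 3 ≤ N) : |SSq N X n| ≤ 4 * Real.log N * n.divisors.card := by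
  have hl := SSE_log hN
  unfold SSq
  refine (Finset.abs_sum_le_sum_abs _ _).trans ((Finset.sum_le_card_nsmul _ _ _ (fun p _ => SSE_bt hN p.2)).trans ?_)
  rw [nsmul_eq_mul, mul_comm]
  gcongr
  refine Finset.card_le_card_of_injOn (fun p => p.1) ?_ ?_
  · intro p hp
    simp only [Finset.coe_filter, Finset.mem_product, Finset.mem_Icc, Set.mem_ofPred_eq] at hp
    simp only [Finset.mem_coe, Nat.mem_divisors]
    refine ⟨⟨p.2, hp.2.symm⟩, ?_⟩
    have := Nat.mul_pos hp.1.1.1 hp.1.2.1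
    omega
  · intro p hp q hq h
    simp only [Finset.coe_filter, Finset.mem_product, Finset.mem_Icc, Set.mem_ofPred_eq] at hp hq h
    have e : p.1 * p.2 = p.1 * q.2 := by rw [hp.2, h, hq.2]
    exact Prod.ext h (Nat.eq_of_mul_eq_mul_left (by omega) e)

theorem SSq_small {N X n : ℕ} (hX : N ≤ X) (h1 : 1 ≤ n) (hn : n ≤ N) : SSq N X n = if n = 1 then 1 else 0 := by
  have e : (Finset.Icc 1 X ×ˢ Finset.Icc 1 (2*N)).filter (fun p => p.1 * p.2 = n) = n.divisorsAntidiagonal := by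
    ext p
    simp only [Finset.mem_filter, Finset.mem_product, Finset.mem_Icc, Nat.mem_divisorsAntidiagonal]
    constructor
    · rintro ⟨_, h⟩; exact ⟨h, by omega⟩
    · rintro ⟨h, h0⟩
      have a1 : 0 < p.1 := Nat.pos_of_ne_zero (fun h' => by rw [h'] at h; simp at h; omega)
      have a2 : 0 < p.2 := Nat.pos_of_ne_zero (fun h' => by rw [h'] at h; simp at h; omega)
      have b1 : p.1 ≤ n := Nat.le_of_dvd h1 ⟨p.2, h.symm⟩
      have b2 : p.2 ≤ n := Nat.le_of_dvd h1 ⟨p.1, by rw [mul_comm]; exact h.symm⟩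
      refine ⟨⟨⟨a1, by omega⟩, a2, by omega⟩, h⟩
  unfold SSq
  rw [e]
  have e2 : ∑ p ∈ n.divisorsAntidiagonal, SSbt N p.2 = ∑ p ∈ n.divisorsAntidiagonal, (ArithmeticFunction.moebius p.2 : ℝ) := by
    refine Finset.sum_congr rfl (fun p hp => ?_)
    rw [Nat.mem_divisorsAntidiagonal] at hp
    have b2 : p.2 ≤ n := Nat.le_of_dvd h1 ⟨p.1, by rw [mul_comm]; exact hp.1.symm⟩
    simp [SSbt, b2.trans hn]
  rw [e2]
  have h := congrArg (fun f => f n) ArithmeticFunction.coe_zeta_mul_moebius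
  simp only [ArithmeticFunction.mul_apply, ArithmeticFunction.one_apply] at h
  have h' : ∑ p ∈ n.divisorsAntidiagonal, (ArithmeticFunction.moebius p.2) = if n = 1 then 1 else 0 := by
    rw [← h]
    refine Finset.sum_congr rfl (fun p hp => ?_)
    rw [Nat.mem_divisorsAntidiagonal] at hp
    have : p.1 ≠ 0 := fun h' => by rw [h'] at hp; simp at hp; omega
    simp [ArithmeticFunction.natCoe_apply, ArithmeticFunction.zeta_apply, this]
  exact_mod_cast h'

noncomputable def SSr (N X n : ℕ) : ℝ := SSq N X n - if n = 1 then 1 else 0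

theorem SSr_prod {N X : ℕ} (hN : 3 ≤ N) (hX : N ≤ X) (s : ℂ) :
    SSS X s * SSM N s - 1 = ∑ n ∈ Finset.Icc 1 (X*(2*N)), (SSr N X n : ℂ) * (n:ℂ)^(-s) := by
  rw [SSq_prod]
  have : (1:ℂ) = ∑ n ∈ Finset.Icc 1 (X*(2*N)), ((if n = 1 then 1 else 0 : ℝ) : ℂ) * (n:ℂ)^(-s) := by
    rw [Finset.sum_eq_single 1]
    · simp
    · intro b _ hb; simp [hb]
    · intro h; exfalso; apply h; rw [Finset.mem_Icc]; exact ⟨le_rfl, Nat.mul_pos (by omega) (by omega)⟩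
  rw [this]
  rw [← Finset.sum_sub_distrib]
  refine Finset.sum_congr rfl (fun n _ => ?_)
  unfold SSr; push_cast; ring

theorem SSr_small {N X n : ℕ} (hX : N ≤ X) (h1 : 1 ≤ n) (hn : n ≤ N) : SSr N X n = 0 := by
  unfold SSr; rw [SSq_small hX h1 hn, sub_self]

theorem SSr_bd {N X n : ℕ} (hN : 3 ≤ N) (hX : N ≤ X) (h1 : 1 ≤ n) : |SSr N X n| ≤ 4 * Real.log N * n.divisors.card := by
  have hl := SSE_log hN
  by_cases hn : n ≤ N
  · rw [SSr_small hX h1 hn, abs_zero]; positivity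
  · unfold SSr; rw [if_neg (by omega), sub_zero]; exact SSq_bd hN

theorem SSF_G {N : ℕ} (hN : 3 ≤ N) {σ : ℝ} (hσ : 1 - 1/Real.log N ≤ σ) :
    ∫ t in (-(N:ℝ))..N, ‖SSS (N^4) (σ + t*I) * SSM N (σ + t*I) - 1‖^2 ≤ 10^10 * Real.exp 12 * (Real.log N)^10 := by
  have hl := SSE_log hN
  set ℓ := Real.log N with hℓ
  have hX : N ≤ N^4 := Nat.le_self_pow (by norm_num) N
  set N' := N^4*(2*N) with hN'
  have hN6 : N' ≤ N^6 := by
    have : 2*N ≤ N^2 := by rw [sq]; exact Nat.mul_le_mul_right N (by omega)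
    calc N' ≤ N^4 * N^2 := Nat.mul_le_mul_left _ this
      _ = N^6 := by ring
  have hN0 : (0:ℝ) < N := by exact_mod_cast (by omega : 0 < N)
  have hN'0 : (0:ℝ) < N' := by rw [hN']; push_cast; positivity
  have hlog : 1 + Real.log N' ≤ 7 * ℓ := by
    have : Real.log N' ≤ Real.log ((N:ℝ)^6) := Real.log_le_log hN'0 (by exact_mod_cast hN6)
    rw [Real.log_pow] at this
    push_cast at this
    linarith
  have hlog0 : 0 ≤ 1 + Real.log N' := by
    have : 0 ≤ Real.log (N':ℝ) := Real.log_natCast_nonneg _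
    linarith
  set a : ℕ → ℂ := fun n => (SSr N (N^4) n : ℂ) * ((n:ℝ)^(-σ) : ℝ) with ha
  have e : ∀ t : ℝ, SSS (N^4) (σ + t*I) * SSM N (σ + t*I) - 1 = ∑ n ∈ Finset.Icc 1 N', a n * (n:ℂ)^(-(t*I)) := by
    intro t
    rw [SSr_prod hN hX]
    refine Finset.sum_congr rfl (fun n hn => ?_)
    rw [Finset.mem_Icc] at hn
    have hn0 : (n:ℂ) ≠ 0 := by exact_mod_cast (by omega : n ≠ 0)
    simp only [ha]
    rw [mul_assoc, neg_add, Complex.cpow_add _ _ hn0, Complex.ofReal_cpow (Nat.cast_nonneg n)]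
    push_cast; rfl
  have hab : ∀ n ∈ Finset.Icc 1 N', ‖a n‖ ≤ (4 * ℓ * Real.exp 6) * (n.divisors.card / n) := by
    intro n hn
    rw [Finset.mem_Icc] at hn
    simp only [ha]
    rw [norm_mul, Complex.norm_real, Complex.norm_real, Real.norm_eq_abs, Real.norm_of_nonneg (by positivity)]
    have h1 := SSr_bd hN hX hn.1
    have h2 := SSE_pow hn.1 hn.2 (by positivity) hσ
    have h3 := SSE_e6 (m := 6) hN hN6
    have h4 : (n:ℝ)^(-σ) ≤ Real.exp 6 * (1/(n:ℝ)) := h2.trans (by gcongr; exact_mod_cast h3)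
    calc _ ≤ (4 * ℓ * n.divisors.card) * (Real.exp 6 * (1/(n:ℝ))) := by gcongr
      _ = _ := by ring
  have ha0 : ∀ n, 1 ≤ n → n ≤ N → a n = 0 := by
    intro n h1 h2; simp only [ha]; rw [SSr_small hX h1 h2]; simp
  have hS : ∑ n ∈ Finset.Icc 1 N', ((n.divisors.card:ℝ))^2 / n ≤ (7*ℓ)^4 := (SSD_d2 N').trans (by gcongr)
  have e6 : Real.exp 6 ^2 = Real.exp 12 := by rw [← Real.exp_nat_mul]; norm_num
  have s1 : ∑ n ∈ Finset.Icc 1 N', ‖a n‖ ≤ (4 * ℓ * Real.exp 6) * (7*ℓ)^4 := by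
    calc _ ≤ ∑ n ∈ Finset.Icc 1 N', (4 * ℓ * Real.exp 6) * (((n.divisors.card:ℝ))^2 / n) := by
          refine Finset.sum_le_sum (fun n hn => (hab n hn).trans ?_)
          rw [Finset.mem_Icc] at hn
          have : 1 ≤ n.divisors.card := Finset.card_pos.mpr ⟨1, Nat.one_mem_divisors.mpr (by omega)⟩
          have : (1:ℝ) ≤ n.divisors.card := by exact_mod_cast this
          gcongr
          exact le_self_pow₀ this (by norm_num)
      _ ≤ _ := by rw [← Finset.mul_sum]; gcongr
  have s2 : ∑ n ∈ Finset.Icc 1 N', n * ‖a n‖^2 ≤ (16 * ℓ^2 * Real.exp 12) * (7*ℓ)^4 := by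
    calc _ ≤ ∑ n ∈ Finset.Icc 1 N', (16 * ℓ^2 * Real.exp 12) * (((n.divisors.card:ℝ))^2 / n) := by
          refine Finset.sum_le_sum (fun n hn => ?_)
          have h1 := hab n hn
          rw [Finset.mem_Icc] at hn
          have hn0 : (0:ℝ) < n := by exact_mod_cast (by omega : 0 < n)
          calc n * ‖a n‖^2 ≤ n * ((4 * ℓ * Real.exp 6) * (n.divisors.card / n))^2 := by gcongr
            _ = _ := by rw [← e6]; field_simp; ring
      _ ≤ _ := by rw [← Finset.mul_sum]; gcongr
  have s3 : N * ∑ n ∈ Finset.Icc 1 N', ‖a n‖^2 ≤ ∑ n ∈ Finset.Icc 1 N', n * ‖a n‖^2 := by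
    rw [Finset.mul_sum]
    refine Finset.sum_le_sum (fun n hn => ?_)
    rw [Finset.mem_Icc] at hn
    by_cases h : n ≤ N
    · rw [ha0 n hn.1 h]; simp
    · have : (N:ℝ) ≤ n := by exact_mod_cast (by omega : N ≤ n)
      gcongr
  have mv := SSC_mv (T := N) hN0.le N' a
  simp_rw [e]
  refine mv.trans ?_
  have s1' : (∑ n ∈ Finset.Icc 1 N', ‖a n‖)^2 ≤ ((4 * ℓ * Real.exp 6) * (7*ℓ)^4)^2 := by
    gcongr
  have s4 : 4*(1+Real.log N')*∑ n ∈ Finset.Icc 1 N', n * ‖a n‖^2 ≤ 4*(7*ℓ)*((16 * ℓ^2 * Real.exp 12) * (7*ℓ)^4) := by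
    gcongr
  have p1 : ℓ^6 ≤ ℓ^10 := pow_le_pow_right₀ hl (by norm_num)
  have p2 : ℓ^7 ≤ ℓ^10 := pow_le_pow_right₀ hl (by norm_num)
  have E := Real.exp_pos 12
  have q1 := mul_le_mul_of_nonneg_left p1 E.le
  have q2 := mul_le_mul_of_nonneg_left p2 E.le
  have q3 : 0 < Real.exp 12 * ℓ^10 := by positivity
  have r1 : ((4 * ℓ * Real.exp 6) * (7*ℓ)^4)^2 = 16 * 7^8 * (Real.exp 12 * ℓ^10) := by rw [← e6]; ring
  have r2 : 4*(7*ℓ)*((16 * ℓ^2 * Real.exp 12) * (7*ℓ)^4) = 448 * 7^4 * (Real.exp 12 * ℓ^7) := by ring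
  have r3 : (16 * ℓ^2 * Real.exp 12) * (7*ℓ)^4 = 16 * 7^4 * (Real.exp 12 * ℓ^6) := by ring
  rw [r1] at s1'
  rw [r2] at s4
  rw [r3] at s2
  linarith

end

section
open Complex Metric Set Filter Topology

theorem SSG_sq (x y z : ℝ) : (x+y+z)^2 ≤ 3*x^2 + 3*y^2 + 3*z^2 := by
  nlinarith [sq_nonneg (x-y), sq_nonneg (y-z), sq_nonneg (x-z)]

noncomputable def SSR (N : ℕ) (s : ℂ) : ℂ := riemannZeta₁ s * SSD' N s - 1

theorem SSR_diff (N : ℕ) : Differentiable ℂ (SSR N) :=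
  (differentiable_riemannZeta₁.mul (SSD'_diff N)).sub_const 1

theorem SSR_eq {N : ℕ} (hN : 3 ≤ N) {s : ℂ} (hs : 1/2 ≤ s.re) (hs3 : s.re ≤ 3) :
    ‖SSR N s‖ ≤ ‖SSS (N^4) s * SSM N s - 1‖ + ((N^4:ℕ):ℝ)^(1-s.re) * ‖SSD' N s‖ + 32 * ‖s‖ * ((N^4:ℕ):ℝ)^(-s.re) * ‖SSM N s‖ := by
  have hX : 1 ≤ N^4 := Nat.one_le_pow _ _ (by omega)
  have h := SSB1 hX hs hs3
  set E := riemannZeta₁ s - (s-1)*SSS (N^4) s - ((N^4:ℕ):ℂ)^(1-s) with hE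
  have e : SSR N s = (SSS (N^4) s * SSM N s - 1) + ((N^4:ℕ):ℂ)^(1-s) * SSD' N s + E * SSD' N s := by
    rw [← SSD'_mul hN, hE, SSR]; ring
  rw [e]
  refine (norm_add₃_le).trans ?_
  have h1 : ‖((N^4:ℕ):ℂ)^(1-s) * SSD' N s‖ = ((N^4:ℕ):ℝ)^(1-s.re) * ‖SSD' N s‖ := by
    rw [norm_mul, Complex.norm_natCast_cpow_of_pos (by omega)]; simp
  have h2 : ‖E * SSD' N s‖ ≤ 32 * ‖s‖ * ((N^4:ℕ):ℝ)^(-s.re) * ‖SSM N s‖ := by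
    rw [norm_mul, ← SSD'_mul hN, norm_mul]
    calc ‖E‖ * ‖SSD' N s‖ ≤ (32*‖s‖*‖s-1‖*((N^4:ℕ):ℝ)^(-s.re)) * ‖SSD' N s‖ := by gcongr
      _ = _ := by ring
  rw [h1]
  linarith

theorem SSG_R : ∃ C : ℝ, 0 < C ∧ ∀ N : ℕ, 3 ≤ N → ∀ σ : ℝ, 1 - 1/Real.log N ≤ σ → 1/2 ≤ σ → σ ≤ 2 →
    ∫ t in (-(N:ℝ))..N, ‖SSR N (σ + t*I)‖^2 ≤ C * (Real.log N)^10 := by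
  refine ⟨3 * (10^10 * Real.exp 12) + 3 * ((Real.exp 4)^2 * (24 * Real.exp 6)^2 * (2 * Real.pi)) + 6 * (768 * Real.exp 6)^2, by positivity, ?_⟩
  intro N hN σ h1 h2 h3
  have hl := SSE_log hN
  set ℓ := Real.log N with hℓ
  have hN3 : (3:ℝ) ≤ N := by exact_mod_cast hN
  have hX : 1 ≤ N^4 := Nat.one_le_pow _ _ (by omega)
  have hX1 : (1:ℝ) ≤ ((N^4:ℕ):ℝ) := by exact_mod_cast hX
  have hE := SSE_e6 (m := 4) (x := N^4) hN le_rfl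
  have hX4 : ((N^4:ℕ):ℝ)^(1-σ) ≤ Real.exp 4 := by
    refine (Real.rpow_le_rpow_of_exponent_le hX1 (by linarith : 1 - σ ≤ 1/ℓ)).trans ?_
    exact_mod_cast hE
  have key : ∀ t ∈ Icc (-(N:ℝ)) N, ‖SSR N (σ + t*I)‖^2 ≤ 3 * ‖SSS (N^4) (σ + t*I) * SSM N (σ + t*I) - 1‖^2
      + 3 * ((Real.exp 4)^2 * ((24 * Real.exp 6 * ℓ^3)^2 * (2 * (1 + t^2)⁻¹))) + 3 * ((768 * Real.exp 6 * ℓ^2)^2 / N) := by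
    intro t ht
    set s : ℂ := σ + t*I with hs
    have sre : s.re = σ := by simp [hs]
    have sim : s.im = t := by simp [hs]
    have := SSR_eq hN (s := s) (by rw [sre]; exact h2) (by rw [sre]; linarith)
    have a2 : (((N^4:ℕ):ℝ)^(1-s.re) * ‖SSD' N s‖)^2 ≤ (Real.exp 4)^2 * ((24 * Real.exp 6 * ℓ^3)^2 * (2 * (1 + t^2)⁻¹)) := by
      rw [mul_pow, sre]
      have := SSD'_b hN (s := s) (by rw [sre]; exact h1)
      rw [sim] at this
      gcongr
    have b1 : ‖s‖ ≤ 2 * N := by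
      have : ‖s‖ ≤ |s.re| + |s.im| := Complex.norm_le_abs_re_add_abs_im s
      rw [sre, sim, abs_of_nonneg (by linarith)] at this
      have := abs_le.mpr ht
      linarith
    have b2 : ((N^4:ℕ):ℝ)^(-s.re) ≤ Real.exp 4 * (1/(N:ℝ)^4) := by
      rw [sre]
      refine (SSE_pow (κ := 1/ℓ) hX le_rfl (by positivity) h1).trans ?_
      have : ((4:ℕ):ℝ) = 4 := by norm_num
      rw [this] at hE
      push_cast at hE ⊢
      gcongr
    have b3 : ‖SSM N s‖ ≤ 12 * ℓ^2 * Real.exp 2 := by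
      refine (SSE_Mb hN (κ := 1/ℓ) (by positivity) (by rw [sre]; exact h1)).trans ?_
      gcongr
      exact_mod_cast (SSE_e6 (m := 2) hN (by rw [sq]; exact Nat.mul_le_mul_right N (by omega)))
    have a3 : (32 * ‖s‖ * ((N^4:ℕ):ℝ)^(-s.re) * ‖SSM N s‖)^2 ≤ (768 * Real.exp 6 * ℓ^2)^2 / N := by
      have e6 : Real.exp 6 = Real.exp 4 * Real.exp 2 := by rw [← Real.exp_add]; norm_num
      calc (32 * ‖s‖ * ((N^4:ℕ):ℝ)^(-s.re) * ‖SSM N s‖)^2 ≤ (32 * (2*N) * (Real.exp 4 * (1/(N:ℝ)^4)) * (12 * ℓ^2 * Real.exp 2))^2 := by gcongr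
        _ = (768 * Real.exp 6 * ℓ^2)^2 / (N:ℝ)^6 := by rw [e6]; field_simp; ring
        _ ≤ _ := by
          gcongr
          exact le_self_pow₀ (by linarith) (by norm_num)
    calc ‖SSR N s‖^2 ≤ (‖SSS (N^4) s * SSM N s - 1‖ + ((N^4:ℕ):ℝ)^(1-s.re) * ‖SSD' N s‖ + 32 * ‖s‖ * ((N^4:ℕ):ℝ)^(-s.re) * ‖SSM N s‖)^2 := by gcongr
      _ ≤ 3 * ‖SSS (N^4) s * SSM N s - 1‖^2 + 3 * (((N^4:ℕ):ℝ)^(1-s.re) * ‖SSD' N s‖)^2 + 3 * (32 * ‖s‖ * ((N^4:ℕ):ℝ)^(-s.re) * ‖SSM N s‖)^2 := by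
        exact SSG_sq _ _ _
      _ ≤ _ := by gcongr
  have cl : Continuous (fun t : ℝ => (σ:ℂ) + t*I) := by fun_prop
  have c1 : Continuous (fun t : ℝ => ‖SSR N (σ + t*I)‖^2) := (((SSR_diff N).continuous.comp cl).norm).pow 2
  have c2 : Continuous (fun t : ℝ => 3 * ‖SSS (N^4) (σ + t*I) * SSM N (σ + t*I) - 1‖^2) :=
    (((((SSS_diff (N^4)).continuous.comp cl).mul ((SSM_diff N).continuous.comp cl)).sub continuous_const).norm.pow 2).const_mul 3
  have c3 : Continuous (fun t : ℝ => 3 * ((Real.exp 4)^2 * ((24 * Real.exp 6 * ℓ^3)^2 * (2 * (1 + t^2)⁻¹)))) := by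
    have : Continuous (fun t : ℝ => (1 + t^2)⁻¹) := Continuous.inv₀ (by fun_prop) (fun t => by positivity)
    fun_prop
  have c23 : Continuous (fun t : ℝ => 3 * ‖SSS (N^4) (σ + t*I) * SSM N (σ + t*I) - 1‖^2 + 3 * ((Real.exp 4)^2 * ((24 * Real.exp 6 * ℓ^3)^2 * (2 * (1 + t^2)⁻¹)))) := c2.add c3
  have c4 : Continuous (fun t : ℝ => 3 * ‖SSS (N^4) (σ + t*I) * SSM N (σ + t*I) - 1‖^2 + 3 * ((Real.exp 4)^2 * ((24 * Real.exp 6 * ℓ^3)^2 * (2 * (1 + t^2)⁻¹))) + 3 * ((768 * Real.exp 6 * ℓ^2)^2 / N)) := c23.add continuous_const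
  have hle : -(N:ℝ) ≤ N := by linarith
  refine (intervalIntegral.integral_mono_on hle (c1.intervalIntegrable _ _) (c4.intervalIntegrable _ _) key).trans ?_
  rw [intervalIntegral.integral_add (c23.intervalIntegrable _ _) (continuous_const.intervalIntegrable _ _),
    intervalIntegral.integral_add (c2.intervalIntegrable _ _) (c3.intervalIntegrable _ _)]
  simp only [intervalIntegral.integral_const_mul, intervalIntegral.integral_const, integral_inv_one_add_sq, smul_eq_mul]
  have hG := SSF_G hN h1
  have ha : Real.arctan N - Real.arctan (-N) ≤ Real.pi := by
    have := Real.arctan_lt_pi_div_two N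
    have := Real.neg_pi_div_two_lt_arctan (-N)
    linarith
  have p1 : ℓ^6 ≤ ℓ^10 := pow_le_pow_right₀ hl (by norm_num)
  have p2 : ℓ^4 ≤ ℓ^10 := pow_le_pow_right₀ hl (by norm_num)
  have t2 : 3 * ((Real.exp 4)^2 * ((24 * Real.exp 6 * ℓ^3)^2 * (2 * (Real.arctan N - Real.arctan (-N))))) ≤ 3 * ((Real.exp 4)^2 * (24 * Real.exp 6)^2 * (2 * Real.pi)) * ℓ^10 := by
    calc _ ≤ 3 * ((Real.exp 4)^2 * ((24 * Real.exp 6 * ℓ^3)^2 * (2 * Real.pi))) := by gcongr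
      _ = 3 * ((Real.exp 4)^2 * (24 * Real.exp 6)^2 * (2 * Real.pi)) * ℓ^6 := by ring
      _ ≤ _ := by gcongr
  have t3 : (N - -(N:ℝ)) * (3 * ((768 * Real.exp 6 * ℓ^2)^2 / N)) ≤ 6 * (768 * Real.exp 6)^2 * ℓ^10 := by
    calc _ = 6 * (768 * Real.exp 6)^2 * ℓ^4 := by field_simp; ring
      _ ≤ _ := by gcongr
  linarith

theorem SSG_Z {N : ℕ} (hN : 3 ≤ N) {κ : ℝ} (hk : 0 ≤ κ) {s : ℂ} (h0 : 1/2 ≤ s.re) (hs : 1 - κ ≤ s.re) (h3 : s.re ≤ 3)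
    (ht : |s.im| ≤ N + 1) : ‖riemannZeta₁ s‖ ≤ 300 * (1 + |s.im|) * ((N:ℝ)^κ * Real.log N) := by
  have hl := SSE_log hN
  set ℓ := Real.log N with hℓ
  have hN3 : (3:ℝ) ≤ N := by exact_mod_cast hN
  have h := SSB1 (X := N) (by omega) h0 h3
  have hS : ‖SSS N s‖ ≤ (N:ℝ)^κ * (1 + ℓ) := by
    unfold SSS
    calc _ ≤ ∑ n ∈ Finset.Icc 1 N, ‖(n:ℂ)^(-s)‖ := norm_sum_le _ _
      _ ≤ ∑ n ∈ Finset.Icc 1 N, (N:ℝ)^κ * (1/(n:ℝ)) := by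
        refine Finset.sum_le_sum (fun n hn => ?_)
        rw [Finset.mem_Icc] at hn
        rw [SSE_norm hn.1]; exact SSE_pow hn.1 hn.2 hk hs
      _ ≤ _ := by rw [← Finset.mul_sum]; gcongr; exact SSC_harm N
  have hXs : ‖(N:ℂ)^(1-s)‖ ≤ (N:ℝ)^κ := by
    rw [Complex.norm_natCast_cpow_of_pos (by omega)]
    exact Real.rpow_le_rpow_of_exponent_le (by linarith) (by simp; linarith)
  have hP := SSE_pow (n := N) (x := N) (by omega) le_rfl hk hs
  have n1 : ‖s‖ ≤ 3 + |s.im| := (Complex.norm_le_abs_re_add_abs_im s).trans (by rw [abs_of_nonneg (by linarith)]; linarith)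
  have n2 : ‖s-1‖ ≤ 2 + |s.im| := by
    refine (Complex.norm_le_abs_re_add_abs_im (s-1)).trans ?_
    simp only [Complex.sub_re, Complex.one_re, Complex.sub_im, Complex.one_im, sub_zero]
    gcongr; rw [abs_le]; constructor <;> linarith
  set τ := |s.im| with hτ
  have hτ0 : 0 ≤ τ := abs_nonneg _
  set p := (N:ℝ)^κ with hp
  have hp1 : 1 ≤ p := Real.one_le_rpow (by linarith) hk
  have e : riemannZeta₁ s = (riemannZeta₁ s - (s-1)*SSS N s - (N:ℂ)^(1-s)) + (s-1)*SSS N s + (N:ℂ)^(1-s) := by ring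
  rw [e]
  refine (norm_add₃_le).trans ?_
  rw [norm_mul]
  have t1 : 32*‖s‖*‖s-1‖*(N:ℝ)^(-s.re) ≤ 32 * (3*N) * (2+τ) * (p * (1/(N:ℝ))) := by
    gcongr
    linarith
  have t1' : 32 * (3*N) * (2+τ) * (p * (1/(N:ℝ))) = 96 * (2+τ) * p := by field_simp; norm_num
  have t2 : ‖s-1‖ * ‖SSS N s‖ ≤ (2+τ) * (p * (1+ℓ)) := by gcongr
  have q : p ≤ p * ℓ := le_mul_of_one_le_right (by linarith) (by linarith)
  have q2 : 0 ≤ τ * p := by positivity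
  have q3 : τ * p ≤ τ * (p * ℓ) := by gcongr
  have : ‖riemannZeta₁ s - (s-1)*SSS N s - (N:ℂ)^(1-s)‖ + ‖s-1‖ * ‖SSS N s‖ + ‖(N:ℂ)^(1-s)‖ ≤ 96 * (2+τ) * p + (2+τ) * (p * (1+ℓ)) + p := by linarith
  linarith

end

section
open Complex Metric Set Filter Topology

noncomputable def SSFF (s : ℂ) : ℂ := - riemannZeta₀ s - deriv riemannZeta₁ s / riemannZeta₁ s

noncomputable def SSAA (N : ℕ) (s : ℂ) : ℂ :=
  (- riemannZeta₀ s * riemannZeta₁ s - deriv riemannZeta₁ s) * SSD' N s * (2 - riemannZeta₁ s * SSD' N s)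

theorem SSH_split (N : ℕ) {s : ℂ} (h : riemannZeta₁ s ≠ 0) : SSFF s = SSAA N s + SSFF s * (SSR N s)^2 := by
  unfold SSFF SSAA SSR
  field_simp
  ring

theorem SSAA_diff (N : ℕ) : Differentiable ℂ (SSAA N) := by
  unfold SSAA
  have h1 := differentiable_riemannZeta₁
  have h0 := differentiable_riemannZeta₀
  have h2 : Differentiable ℂ (deriv riemannZeta₁) := h1.deriv
  have h3 := SSD'_diff N
  exact (((h0.neg.mul h1).sub h2).mul h3).mul ((differentiable_const 2).sub (h1.mul h3))

theorem SSH_P {N : ℕ} (hN : 3 ≤ N) : ((N:ℝ)^((1:ℝ)/50) * Real.log N)^8 ≤ 30^8 * (N:ℝ)^((1:ℝ)/2) := by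
  have hl := SSE_log hN
  have hN3 : (3:ℝ) ≤ N := by exact_mod_cast hN
  have h1 : Real.log N ≤ (N:ℝ)^((1:ℝ)/30) / (1/30) := Real.log_le_rpow_div (by linarith) (by norm_num)
  have h2 : (N:ℝ)^((1:ℝ)/50) * Real.log N ≤ 30 * (N:ℝ)^((1:ℝ)/16) := by
    calc _ ≤ (N:ℝ)^((1:ℝ)/50) * ((N:ℝ)^((1:ℝ)/30) / (1/30)) := by gcongr
      _ = 30 * (N:ℝ)^((1:ℝ)/50 + 1/30) := by rw [Real.rpow_add (by linarith)]; ring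
      _ ≤ _ := by gcongr <;> linarith
  calc _ ≤ (30 * (N:ℝ)^((1:ℝ)/16))^8 := by gcongr
    _ = _ := by rw [mul_pow, ← Real.rpow_natCast, ← Real.rpow_natCast, ← Real.rpow_mul (by linarith)]; norm_num

theorem SSH_0 (s : ℂ) : (s - 1) * riemannZeta₀ s = riemannZeta₁ s - 1 := by
  unfold riemannZeta₁; ring

set_option maxHeartbeats 800000 in
theorem SSH_A : ∃ C : ℝ, 1 ≤ C ∧ ∀ N : ℕ, 3 ≤ N → ∀ s : ℂ, 99/100 ≤ s.re → s.re ≤ 2 → |s.im| ≤ N → 1/100 ≤ ‖s - 1‖ →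
    ‖SSAA N s‖ ≤ C * (N:ℝ)^((1:ℝ)/2) ∧ (Real.log N)^2 * ‖SSR N s‖^2 ≤ C * (N:ℝ)^((1:ℝ)/2) := by
  refine ⟨10^50 * 30^8, by norm_num, ?_⟩
  intro N hN s h1 h2 ht hs
  have hl := SSE_log hN
  have hN3 : (3:ℝ) ≤ N := by exact_mod_cast hN
  have hP := SSH_P hN
  set ℓ := Real.log N with hℓ
  set q := (N:ℝ)^((1:ℝ)/50) with hq
  have hq1 : 1 ≤ q := Real.one_le_rpow (by linarith) (by norm_num)
  set P := q * ℓ with hPd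
  have hP1 : 1 ≤ P := one_le_mul_of_one_le_of_one_le hq1 hl
  have hlP : ℓ ≤ P := le_mul_of_one_le_left (by linarith) hq1
  set ρ := ‖s - 1‖ with hρ
  have hρ0 : 0 < ρ := by linarith
  have him : |s.im| ≤ ρ := by simpa using Complex.abs_im_le_norm (s - 1)
  have hZ : ‖riemannZeta₁ s‖ ≤ 10^5 * P * ρ := by
    have := SSG_Z hN (κ := 1/50) (by norm_num) (s := s) (by linarith) (by linarith) (by linarith) (by linarith)
    refine this.trans ?_
    have : 1 + |s.im| ≤ 101 * ρ := by linarith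
    calc _ ≤ 300 * (101 * ρ) * P := by gcongr
      _ ≤ _ := by have : 0 < ρ * P := by positivity
                  linarith
  have hZ' : ‖deriv riemannZeta₁ s‖ ≤ 10^7 * P * ρ := by
    have : ‖deriv riemannZeta₁ s‖ ≤ (300 * (102 * ρ) * P) / (1/100) := by
      refine Complex.norm_deriv_le_of_forall_mem_sphere_norm_le (by norm_num) differentiable_riemannZeta₁.diffContOnCl ?_
      intro z hz
      rw [mem_sphere, dist_eq_norm] at hz
      have b1 : |z.re - s.re| ≤ 1/100 := by rw [← hz]; simpa using Complex.abs_re_le_norm (z - s)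
      have b2 : |z.im - s.im| ≤ 1/100 := by rw [← hz]; simpa using Complex.abs_im_le_norm (z - s)
      have b3 : |z.im| ≤ |s.im| + 1/100 := by
        have := abs_sub_abs_le_abs_sub z.im s.im; linarith
      rw [abs_le] at b1
      have := SSG_Z hN (κ := 1/50) (by norm_num) (s := z) (by linarith) (by linarith) (by linarith) (by linarith)
      refine this.trans ?_
      have : 1 + |z.im| ≤ 102 * ρ := by linarith
      gcongr
    refine this.trans ?_
    have : 0 < ρ * P := by positivity
    linarith
  have h0 : ‖riemannZeta₀ s‖ ≤ 10^6 * P := by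
    have e := SSH_0 s
    have : ρ * ‖riemannZeta₀ s‖ ≤ 10^5 * P * ρ + 1 := by
      rw [hρ, ← norm_mul, e]
      refine (norm_sub_le _ _).trans ?_
      rw [norm_one]; linarith
    have h3 : 1 ≤ 100 * P * ρ := by linarith [mul_le_mul_of_nonneg_right hP1 hρ0.le]
    have : ρ * ‖riemannZeta₀ s‖ ≤ ρ * (10^6 * P) := by
      have : 0 < ρ * P := by positivity
      linarith
    exact le_of_mul_le_mul_left this hρ0
  have hM : ρ * ‖SSD' N s‖ ≤ 24 * P^2 := by
    rw [hρ, ← norm_mul, SSD'_mul hN]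
    refine (SSE_Mb hN (κ := 1/50) (by norm_num) (by linarith)).trans ?_
    have : ((2*N:ℕ):ℝ)^((1:ℝ)/50) ≤ 2 * q := by
      push_cast
      rw [Real.mul_rpow (by norm_num) (by linarith)]
      gcongr
      calc (2:ℝ)^((1:ℝ)/50) ≤ 2^(1:ℝ) := Real.rpow_le_rpow_of_exponent_le (by norm_num) (by norm_num)
        _ = 2 := by norm_num
    calc _ ≤ 12 * ℓ^2 * (2 * q) := by gcongr
      _ ≤ 24 * P^2 := by
        have : q ≤ q^2 := le_self_pow₀ hq1 (by norm_num)
        have : q * ℓ^2 ≤ q^2*ℓ^2 := by gcongr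
        rw [hPd, mul_pow]; linarith
  have hZD : ‖riemannZeta₁ s * SSD' N s‖ ≤ 10^7 * P^3 := by
    rw [norm_mul]
    calc _ ≤ 10^5 * P * ρ * ‖SSD' N s‖ := by gcongr
      _ = 10^5 * P * (ρ * ‖SSD' N s‖) := by ring
      _ ≤ 10^5 * P * (24 * P^2) := by gcongr
      _ ≤ _ := by have : 0 < P^3 := by positivity
                  linarith
  have hR : ‖SSR N s‖ ≤ 10^8 * P^3 := by
    unfold SSR
    refine (norm_sub_le _ _).trans ?_
    rw [norm_one]
    have : 1 ≤ P^3 := one_le_pow₀ hP1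
    linarith
  have p78 : P^7 ≤ P^8 := pow_le_pow_right₀ hP1 (by norm_num)
  constructor
  · have a1 : ‖(- riemannZeta₀ s * riemannZeta₁ s - deriv riemannZeta₁ s)‖ ≤ 10^12 * P^2 * ρ := by
      refine (norm_sub_le _ _).trans ?_
      rw [norm_mul, norm_neg]
      have : ‖riemannZeta₀ s‖ * ‖riemannZeta₁ s‖ ≤ (10^6 * P) * (10^5 * P * ρ) := by gcongr
      have : P * ρ ≤ P^2 * ρ := by gcongr; exact le_self_pow₀ hP1 (by norm_num)
      have : 0 < P^2*ρ := by positivity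
      linarith
    have a2 : ‖(2 - riemannZeta₁ s * SSD' N s)‖ ≤ 10^8 * P^3 := by
      refine (norm_sub_le _ _).trans ?_
      have : 1 ≤ P^3 := one_le_pow₀ hP1
      have : ‖(2:ℂ)‖ = 2 := by simp
      linarith
    unfold SSAA
    rw [norm_mul, norm_mul]
    calc _ ≤ (10^12 * P^2 * ρ) * ‖SSD' N s‖ * (10^8 * P^3) := by gcongr
      _ = 10^20 * P^5 * (ρ * ‖SSD' N s‖) := by ring
      _ ≤ 10^20 * P^5 * (24 * P^2) := by gcongr
      _ = 24 * 10^20 * P^7 := by ring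
      _ ≤ 24 * 10^20 * (30^8 * (N:ℝ)^((1:ℝ)/2)) := by gcongr; linarith
      _ ≤ _ := by
        rw [← mul_assoc]; gcongr <;> norm_num
  · calc _ ≤ P^2 * (10^8 * P^3)^2 := by gcongr
      _ = 10^16 * P^8 := by ring
      _ ≤ 10^16 * (30^8 * (N:ℝ)^((1:ℝ)/2)) := by gcongr
      _ ≤ _ := by
        rw [← mul_assoc]; gcongr <;> norm_num

theorem SSH_F : ∃ c C : ℝ, 0 < c ∧ c ≤ 1/6 ∧ 1 ≤ C ∧ ∀ N : ℕ, 3 ≤ N → ∀ s : ℂ, |s.im| ≤ N →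
    1 - c/Real.log N ≤ s.re → s.re ≤ 2 → riemannZeta₁ s ≠ 0 ∧ ‖SSFF s‖ ≤ C * (Real.log N)^2 := by
  obtain ⟨c, C, hc, hc6, hC, H⟩ := SSY_ld
  obtain ⟨K, hK⟩ := (isCompact_closedBall (1:ℂ) 1).exists_bound_of_continuousOn (f := riemannZeta₀) differentiable_riemannZeta₀.continuous.continuousOn
  refine ⟨c, C + |K| + 600 * Real.exp 1 + 1, hc, hc6, by have := Real.exp_pos 1; have := abs_nonneg K; linarith, ?_⟩
  intro N hN s ht h1 h2
  have hl := SSE_log hN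
  have hN3 : (3:ℝ) ≤ N := by exact_mod_cast hN
  obtain ⟨hz, hb⟩ := H N hN3 s ht h1 h2
  refine ⟨hz, ?_⟩
  set ℓ := Real.log N with hℓ
  have hcl : c/ℓ ≤ 1/ℓ := by gcongr; linarith
  have hcl2 : c/ℓ ≤ 1/2 := by rw [div_le_iff₀ (by linarith)]; linarith
  have h0 : ‖riemannZeta₀ s‖ ≤ |K| + 600 * Real.exp 1 * ℓ + 1 := by
    have hE := Real.exp_pos 1
    by_cases hs : ‖s - 1‖ ≤ 1
    · have := hK s (by rw [mem_closedBall, dist_eq_norm]; exact hs)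
      have := le_abs_self K
      have : 0 ≤ 600 * Real.exp 1 * ℓ := by positivity
      linarith
    · push Not at hs
      have him : |s.im| ≤ ‖s-1‖ := by simpa using Complex.abs_im_le_norm (s - 1)
      have hZ := SSG_Z hN (κ := 1/ℓ) (by positivity) (s := s) (by linarith) (by linarith) (by linarith) (by linarith)
      have e6 := SSE_e6 (m := 1) (x := N) hN (by simp)
      rw [Nat.cast_one] at e6
      have hZ2 : ‖riemannZeta₁ s‖ ≤ 600 * Real.exp 1 * ℓ * ‖s-1‖ := by
        refine hZ.trans ?_
        calc _ ≤ 300 * (2 * ‖s-1‖) * (Real.exp 1 * ℓ) := by gcongr; linarith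
          _ = _ := by ring
      have e := SSH_0 s
      have : ‖s-1‖ * ‖riemannZeta₀ s‖ ≤ ‖s-1‖ * (600 * Real.exp 1 * ℓ + 1) := by
        rw [← norm_mul, e]
        refine (norm_sub_le _ _).trans ?_
        rw [norm_one]; linarith
      have := le_of_mul_le_mul_left this (by linarith)
      have := abs_nonneg K
      linarith
  unfold SSFF
  refine (norm_sub_le _ _).trans ?_
  rw [norm_neg]
  have hE := Real.exp_pos 1
  have hA := abs_nonneg K
  have l2 : ℓ ≤ ℓ^2 := le_self_pow₀ hl (by norm_num)
  have l3 : 1 ≤ ℓ^2 := one_le_pow₀ hl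
  have : |K| ≤ |K| * ℓ^2 := le_mul_of_one_le_right hA l3
  have : Real.exp 1 * ℓ ≤ Real.exp 1 * ℓ^2 := by gcongr
  linarith

end

section
open Complex Metric Set Filter Topology MeasureTheory

noncomputable def SSK (v : ℝ) (s : ℂ) : ℂ := (v:ℂ)^(s+1) / (s*(s+1))

theorem SSI_den {σ t : ℝ} (hσ : 1 ≤ σ) : ‖(1:ℂ) / (((σ:ℂ) + t*I) * (σ + t*I + 1))‖ ≤ (1+t^2)⁻¹ := by
  rw [norm_div, norm_one, norm_mul, one_div]
  apply inv_anti₀ (by positivity)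
  have h1 : ‖((σ:ℂ) + t*I)‖^2 = σ^2 + t^2 := by
    rw [← Complex.normSq_eq_norm_sq, Complex.normSq_add_mul_I]
  have h2 : ‖((σ:ℂ) + t*I)‖ ≤ ‖((σ:ℂ) + t*I + 1)‖ := by
    have h3 : ‖((σ:ℂ) + t*I + 1)‖^2 = (σ+1)^2 + t^2 := by
      rw [← Complex.normSq_eq_norm_sq, show (σ:ℂ) + t*I + 1 = ((σ+1:ℝ):ℂ) + t*I by push_cast; ring, Complex.normSq_add_mul_I]
    apply le_of_sq_le_sq _ (norm_nonneg _)
    rw [h1, h3]; nlinarith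
  nlinarith [norm_nonneg ((σ:ℂ) + t*I)]

theorem SSI_ne {σ t : ℝ} (hσ : 1 ≤ σ) : ((σ:ℂ) + t*I) * (σ + t*I + 1) ≠ 0 := by
  apply mul_ne_zero
  · intro h; have := congrArg Complex.re h; simp at this; linarith
  · intro h; have := congrArg Complex.re h; simp at this; linarith

theorem SSI_cont {σ : ℝ} (hσ : 1 ≤ σ) : Continuous (fun t : ℝ => (1:ℂ) / (((σ:ℂ) + t*I) * (σ + t*I + 1))) := by
  refine Continuous.div continuous_const (by fun_prop) (fun t => SSI_ne hσ)

theorem SSI_int {σ : ℝ} (hσ : 1 ≤ σ) : Integrable (fun t : ℝ => (1:ℂ) / (((σ:ℂ) + t*I) * (σ + t*I + 1))) := by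
  refine integrable_inv_one_add_sq.mono' (SSI_cont hσ).aestronglyMeasurable ?_
  exact Filter.Eventually.of_forall (fun t => SSI_den hσ)

theorem SSI_1 {σ x : ℝ} (hσ : 1 ≤ σ) (hx : 0 < x) :
    ((max (1-x) 0 : ℝ) : ℂ) = (1/(2*Real.pi) : ℝ) • ∫ t : ℝ, (x:ℂ)^(-((σ:ℂ) + t*I)) • ((1:ℂ) / (((σ:ℂ) + t*I) * (σ + t*I + 1))) := by
  set f : ℝ → ℂ := fun t => indicator (Ioc 0 1) (fun _ => 1 : ℝ → ℂ) t - indicator (Ioc 0 1) (fun t => (t:ℂ)^(1:ℂ) : ℝ → ℂ) t with hf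
  have hm : ∀ s : ℂ, 0 < s.re → HasMellin f s (1/(s*(s+1))) := by
    intro s hs
    have h1 := hasMellin_one_Ioc hs
    have h2 := hasMellin_cpow_Ioc (1:ℂ) (s := s) (by simp; linarith)
    have h3 := hasMellin_sub h1.1 h2.1
    rw [h1.2, h2.2] at h3
    have hs0 : s ≠ 0 := fun h => by rw [h] at hs; simp at hs
    have hs1 : s + 1 ≠ 0 := fun h => by
      have := congrArg Complex.re h; simp at this; linarith
    have e : 1 / s - 1/(s+1) = 1/(s*(s+1)) := by field_simp; ring
    rw [e] at h3
    exact h3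
  have hval : ∀ u : ℝ, 0 < u → f u = ((max (1-u) 0 : ℝ) : ℂ) := by
    intro u hu
    simp only [hf, Set.indicator, Set.mem_Ioc]
    by_cases h : u ≤ 1
    · rw [if_pos ⟨hu, h⟩, if_pos ⟨hu, h⟩, max_eq_left (by linarith), Complex.cpow_one]; push_cast; rfl
    · rw [if_neg (by tauto), if_neg (by tauto), max_eq_right (by linarith)]; simp
  have hσ0 : 0 < ((σ:ℂ)).re := by simp; linarith
  have hre : ∀ t : ℝ, 0 < ((σ:ℂ) + t*I).re := fun t => by simp; linarith
  have hmt : ∀ t : ℝ, mellin f ((σ:ℂ) + t*I) = 1 / (((σ:ℂ) + t*I) * (σ + t*I + 1)) := fun t => (hm _ (hre t)).2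
  have hc : ContinuousAt f x := by
    have : Continuous (fun u : ℝ => ((max (1-u) 0 : ℝ) : ℂ)) := by fun_prop
    refine this.continuousAt.congr ?_
    filter_upwards [lt_mem_nhds hx] with u hu using (hval u hu).symm
  have := mellinInv_mellin_eq σ f hx (hm _ hσ0).1 (by
    unfold VerticalIntegrable
    simp_rw [hmt]; exact SSI_int hσ) hc
  rw [hval x hx] at this
  rw [← this, mellinInv]
  simp_rw [hmt]

theorem SSI_2 {σ v : ℝ} {n : ℕ} (hσ : 1 ≤ σ) (hv : 0 < v) (hn : 1 ≤ n) :
    ((max (v-n) 0 : ℝ) : ℂ) = (1/(2*Real.pi) : ℝ) • ∫ t : ℝ, (n:ℂ)^(-((σ:ℂ) + t*I)) * SSK v ((σ:ℂ) + t*I) := by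
  have hn0 : (0:ℝ) < n := by exact_mod_cast hn
  have h := SSI_1 (x := n / v) hσ (by positivity)
  have e : ((max (v-n) 0 : ℝ) : ℂ) = v * ((max (1-n/v) 0 : ℝ) : ℂ) := by
    rw [← Complex.ofReal_mul, mul_max_of_nonneg _ _ hv.le]
    congr 2
    · field_simp
    · simp
  rw [e, h, mul_smul_comm, ← integral_const_mul]
  congr 1
  apply integral_congr_ae
  refine Filter.Eventually.of_forall (fun t => ?_)
  simp only
  have hvc : (v:ℂ) ≠ 0 := by exact_mod_cast hv.ne'
  rw [SSK, Complex.cpow_add _ _ hvc, Complex.cpow_one]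
  have : ((n/v : ℝ):ℂ)^(-((σ:ℂ) + t*I)) = (n:ℂ)^(-((σ:ℂ) + t*I)) * (v:ℂ)^((σ:ℂ) + t*I) := by
    rw [div_eq_mul_inv, Complex.ofReal_mul, Complex.mul_cpow_ofReal_nonneg hn0.le (by positivity), Complex.ofReal_inv, Complex.inv_cpow, Complex.cpow_neg (v:ℂ), inv_inv]
    · simp
    · rw [Complex.arg_ofReal_of_nonneg hv.le]; exact Real.pi_pos.ne
  rw [this, smul_eq_mul]
  ring

theorem SSK_bd {σ t v : ℝ} (hσ : 1 ≤ σ) (hv : 0 < v) : ‖SSK v ((σ:ℂ) + t*I)‖ ≤ v^(σ+1) * (1+t^2)⁻¹ := by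
  rw [SSK, div_eq_mul_one_div, norm_mul, Complex.norm_cpow_eq_rpow_re_of_pos hv]
  have : ((σ:ℂ) + t*I + 1).re = σ + 1 := by simp
  rw [this]
  gcongr
  exact SSI_den hσ

theorem SSK_cont {σ v : ℝ} (hσ : 1 ≤ σ) (hv : 0 < v) : Continuous (fun t : ℝ => SSK v ((σ:ℂ) + t*I)) := by
  unfold SSK
  have hvc : (v:ℂ) ≠ 0 := by exact_mod_cast hv.ne'
  refine Continuous.div ?_ (by fun_prop) (fun t => SSI_ne hσ)
  refine Continuous.const_cpow (by fun_prop) (Or.inl hvc)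

noncomputable def SSb (n : ℕ) : ℂ := (ArithmeticFunction.vonMangoldt n : ℂ) - 1

theorem SSI_F {s : ℂ} (hs : 1 < s.re) : LSeriesSummable SSb s ∧ LSeries SSb s = SSFF s := by
  have h1 : LSeriesSummable (fun n => (ArithmeticFunction.vonMangoldt n : ℂ)) s := ArithmeticFunction.LSeriesSummable_vonMangoldt hs
  have h2 : LSeriesSummable (1 : ℕ → ℂ) s := LSeriesSummable_one_iff.mpr hs
  have e : SSb = (fun n => (ArithmeticFunction.vonMangoldt n : ℂ)) - (1 : ℕ → ℂ) := by
    ext n; simp [SSb]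
  have hne : s ≠ 1 := by rintro rfl; simp at hs
  rw [e]
  refine ⟨h1.sub h2, ?_⟩
  rw [LSeries_sub h1 h2, ArithmeticFunction.LSeries_vonMangoldt_eq_deriv_riemannZeta_div hs, LSeries_one_eq_riemannZeta hs,
    SSZ_deriv hne (riemannZeta_ne_zero_of_one_le_re hs.le), riemannZeta_eq_inv_sub_add hne, SSFF]
  ring

theorem SSI_Fb {L : ℝ} (hL : 1 ≤ L) : ∑' n : ℕ, ‖LSeries.term SSb ((1+1/L:ℝ):ℂ) n‖ ≤ 3840 * L^2 := by
  have hL0 : 0 < L := by linarith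
  have hi : 1/L ≤ 1 := by rw [div_le_one hL0]; exact hL
  have hp : 0 < 1/(2*L) := by positivity
  have e2 : 1/L = 1/(2*L) + 1/(2*L) := by field_simp; norm_num
  have h1 : 1 < 1 + 1/(2*L) := by linarith
  have hsum : Summable (fun n : ℕ => ‖LSeries.term 1 ((1+1/(2*L):ℝ):ℂ) n‖) := by
    have : LSeriesSummable (1 : ℕ → ℂ) ((1+1/(2*L):ℝ):ℂ) := LSeriesSummable_one_iff.mpr (by rw [Complex.ofReal_re]; exact h1)
    exact this.norm
  have hb : ∀ n : ℕ, ‖LSeries.term SSb ((1+1/L:ℝ):ℂ) n‖ ≤ 3 * L * ‖LSeries.term 1 ((1+1/(2*L):ℝ):ℂ) n‖ := by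
    intro n
    by_cases hn : n = 0
    · subst hn; simp
    rw [LSeries.term_of_ne_zero hn, LSeries.term_of_ne_zero hn, norm_div, norm_div, Pi.one_apply, norm_one,
      Complex.norm_natCast_cpow_of_pos (by omega), Complex.norm_natCast_cpow_of_pos (by omega), Complex.ofReal_re, Complex.ofReal_re]
    have hn1 : (1:ℝ) ≤ n := by exact_mod_cast (by omega : 1 ≤ n)
    have hlog : Real.log n ≤ (n:ℝ)^(1/(2*L)) / (1/(2*L)) := Real.log_le_rpow_div (by linarith) hp
    have hone : 1 ≤ (n:ℝ)^(1/(2*L)) := Real.one_le_rpow hn1 hp.le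
    have hcoef : ‖SSb n‖ ≤ 3 * L * (n:ℝ)^(1/(2*L)) := by
      unfold SSb
      rw [show (ArithmeticFunction.vonMangoldt n : ℂ) - 1 = ((ArithmeticFunction.vonMangoldt n - 1 : ℝ) : ℂ) by push_cast; rfl, Complex.norm_real, Real.norm_eq_abs]
      have a1 : 0 ≤ ArithmeticFunction.vonMangoldt n := ArithmeticFunction.vonMangoldt_nonneg
      have a2 : ArithmeticFunction.vonMangoldt n ≤ Real.log n := ArithmeticFunction.vonMangoldt_le_log
      have a3 : (n:ℝ)^(1/(2*L)) / (1/(2*L)) = 2 * L * (n:ℝ)^(1/(2*L)) := by field_simp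
      rw [a3] at hlog
      have : |ArithmeticFunction.vonMangoldt n - 1| ≤ Real.log n + 1 := by rw [abs_le]; constructor <;> linarith
      nlinarith
    rw [e2, ← add_assoc, Real.rpow_add (by linarith) (1 + 1/(2*L))]
    calc _ ≤ (3 * L * (n:ℝ)^(1/(2*L))) / ((n:ℝ)^(1 + 1/(2*L)) * (n:ℝ)^(1/(2*L))) := by gcongr
      _ = _ := by field_simp
  have hs2 : Summable (fun n : ℕ => 3 * L * ‖LSeries.term 1 ((1+1/(2*L):ℝ):ℂ) n‖) := hsum.mul_left _
  have hle := Summable.tsum_le_tsum hb (Summable.of_nonneg_of_le (fun _ => norm_nonneg _) hb hs2) hs2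
  refine hle.trans ?_
  rw [tsum_mul_left]
  have := SSZ_real h1 (by linarith)
  calc _ ≤ 3 * L * (640 / (1 + 1/(2*L) - 1)) := by gcongr
    _ = _ := by field_simp; norm_num

theorem SSI_norm (σ t : ℝ) (n : ℕ) : ‖LSeries.term SSb ((σ:ℂ) + t*I) n‖ = ‖LSeries.term SSb (σ:ℂ) n‖ := by
  rw [LSeries.norm_term_eq, LSeries.norm_term_eq]; simp

theorem SSI_Fb2 {L : ℝ} (hL : 1 ≤ L) (t : ℝ) : ‖SSFF (((1+1/L:ℝ):ℂ) + t*I)‖ ≤ 3840 * L^2 := by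
  have hs : 1 < ((((1+1/L:ℝ):ℂ) + t*I)).re := by simp; linarith
  obtain ⟨h1, h2⟩ := SSI_F hs
  rw [← h2, LSeries]
  refine (norm_tsum_le_tsum_norm h1.norm).trans ?_
  simp_rw [SSI_norm]
  exact SSI_Fb hL

theorem SSI_5 {L v : ℝ} (hL : 1 ≤ L) (hv : 0 < v) {M : ℕ} (hM : v ≤ M) :
    ((∑ n ∈ Finset.Icc 1 M, (ArithmeticFunction.vonMangoldt n - 1) * max (v-n) 0 : ℝ) : ℂ) =
      (1/(2*Real.pi) : ℝ) • ∫ t : ℝ, SSFF (((1+1/L:ℝ):ℂ) + t*I) * SSK v (((1+1/L:ℝ):ℂ) + t*I) := by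
  set σ : ℝ := 1 + 1/L with hσd
  have hσ1 : 1 < σ := by have : 0 < 1/L := by positivity
                         linarith
  have hσ := hσ1.le
  have hre : ∀ t : ℝ, 1 < ((σ:ℂ) + t*I).re := fun t => by simp; exact hσ1
  set G : ℕ → ℝ → ℂ := fun n t => LSeries.term SSb ((σ:ℂ) + t*I) n * SSK v ((σ:ℂ) + t*I) with hG
  have hGb : ∀ n t, ‖G n t‖ ≤ (‖LSeries.term SSb (σ:ℂ) n‖ * v^(σ+1)) * (1+t^2)⁻¹ := by
    intro n t
    simp only [hG]
    rw [norm_mul, SSI_norm, mul_assoc]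
    gcongr
    exact SSK_bd hσ hv
  have hGc : ∀ n, Continuous (G n) := by
    intro n
    by_cases hn : n = 0
    · subst hn; simp only [hG, LSeries.term_zero, zero_mul]; exact continuous_const
    · simp only [hG]
      refine Continuous.mul ?_ (SSK_cont hσ hv)
      have hn0 : (n:ℂ) ≠ 0 := by exact_mod_cast hn
      simp_rw [LSeries.term_of_ne_zero hn]
      refine Continuous.div continuous_const (Continuous.const_cpow (by fun_prop) (Or.inl hn0)) (fun t => ?_)
      exact Complex.cpow_ne_zero_iff_of_exponent_ne_zero (fun h => by
        have := hre t; rw [h] at this; simp at this; linarith) |>.mpr hn0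
  have hGi : ∀ n, Integrable (G n) := fun n =>
    (integrable_inv_one_add_sq.const_mul _).mono' (hGc n).aestronglyMeasurable (Filter.Eventually.of_forall (hGb n))
  have hsum : Summable (fun n => ‖LSeries.term SSb (σ:ℂ) n‖) := by
    have := (SSI_F (hre 0)).1
    simpa using this.norm
  have hGs : Summable (fun n => ∫ t, ‖G n t‖) := by
    refine Summable.of_nonneg_of_le (fun n => integral_nonneg (fun t => norm_nonneg _)) (fun n => ?_) (hsum.mul_right (v^(σ+1) * Real.pi))
    calc ∫ t, ‖G n t‖ ≤ ∫ t, (‖LSeries.term SSb (σ:ℂ) n‖ * v^(σ+1)) * (1+t^2)⁻¹ :=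
          integral_mono (hGi n).norm (integrable_inv_one_add_sq.const_mul _) (hGb n)
      _ = _ := by rw [integral_const_mul, integral_univ_inv_one_add_sq]; ring
  have hmain := hasSum_integral_of_summable_integral_norm hGi hGs
  have hR : ∀ t, ∑' n, G n t = SSFF ((σ:ℂ) + t*I) * SSK v ((σ:ℂ) + t*I) := by
    intro t
    simp only [hG]
    rw [tsum_mul_right, ← (SSI_F (hre t)).2, LSeries]
  simp_rw [hR] at hmain
  have hn : ∀ n, (1/(2*Real.pi) : ℝ) • ∫ t, G n t = if n = 0 then 0 else SSb n * ((max (v-n) 0 : ℝ) : ℂ) := by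
    intro n
    by_cases hn : n = 0
    · subst hn; simp [hG]
    · rw [if_neg hn, SSI_2 hσ hv (by omega : 1 ≤ n), mul_smul_comm, ← integral_const_mul]
      congr 1
      apply integral_congr_ae
      refine Filter.Eventually.of_forall (fun t => ?_)
      simp only [hG]
      rw [LSeries.term_of_ne_zero hn, Complex.cpow_neg]
      ring
  have h2 := hmain.const_smul (1/(2*Real.pi) : ℝ)
  rw [← h2.tsum_eq]
  simp_rw [hn]
  rw [tsum_eq_sum (s := Finset.Icc 1 M)]
  · push_cast
    refine Finset.sum_congr rfl (fun n hn => ?_)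
    rw [Finset.mem_Icc] at hn
    rw [if_neg (by omega), SSb]
  · intro n hn
    rw [Finset.mem_Icc] at hn
    by_cases h0 : n = 0
    · simp [h0]
    · have : v ≤ n := hM.trans (by exact_mod_cast (by omega : M ≤ n))
      rw [if_neg h0, max_eq_right (by linarith)]; simp

end

section
open Complex Metric Set Filter Topology MeasureTheory

noncomputable def SSK4 (v H Δ : ℝ) (s : ℂ) : ℂ := (SSK (v+H+Δ) s - SSK (v+H) s) - (SSK (v+Δ) s - SSK v s)

theorem SSK_der {x : ℝ} {s : ℂ} (hx : 0 < x) (hs : 0 < s.re) : HasDerivAt (fun y : ℝ => SSK y s) ((x:ℂ)^s / s) x := by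
  have hne : s ≠ -1 := by rintro rfl; simp at hs; linarith
  have h := (hasDerivAt_ofReal_cpow_const' hx.ne' hne).div_const s
  refine h.congr_deriv rfl |>.congr_of_eventuallyEq (Filter.Eventually.of_forall (fun y => ?_))
  simp only [SSK]
  rw [div_div, mul_comm s]

theorem SSJ_1 {v H Δ : ℝ} {s : ℂ} (hv : 0 < v) (hH : 0 ≤ H) (hΔ : 0 ≤ Δ) (hs : 0 < s.re) (hs1 : s.re ≤ 1) :
    ‖SSK4 v H Δ s‖ ≤ H * Δ * v^(s.re - 1) := by
  have hs0 : s ≠ 0 := by rintro rfl; simp at hs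
  have inner : ∀ a, 0 ≤ a → ‖((v+a+Δ:ℝ):ℂ)^s / s - ((v+a:ℝ):ℂ)^s / s‖ ≤ Δ * v^(s.re - 1) := by
    intro a ha
    have hd : ∀ x ∈ Icc (v+a) (v+a+Δ), HasDerivWithinAt (fun y : ℝ => (y:ℂ)^s / s) ((x:ℂ)^(s-1)) (Icc (v+a) (v+a+Δ)) x := by
      intro x hx
      have h := hasDerivAt_ofReal_cpow_const' (x := x) (r := s - 1) (by linarith [hx.1] : 0 < x).ne' (fun h => hs0 (by linear_combination h))
      rw [show s - 1 + 1 = s by ring] at h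
      exact h.hasDerivWithinAt
    have := norm_image_sub_le_of_norm_deriv_le_segment' hd (C := v^(s.re-1)) (fun x hx => ?_) (v+a+Δ) ⟨by linarith, le_rfl⟩
    · rw [show v+a+Δ - (v+a) = Δ by ring] at this
      rw [mul_comm Δ]; exact this
    · rw [Complex.norm_cpow_eq_rpow_re_of_pos (by linarith [hx.1])]
      simp only [Complex.sub_re, Complex.one_re]
      exact Real.rpow_le_rpow_of_nonpos hv (by linarith [hx.1]) (by linarith)
  have hd : ∀ x ∈ Icc 0 H, HasDerivWithinAt (fun a : ℝ => SSK (v+a+Δ) s - SSK (v+a) s)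
      (((v+x+Δ:ℝ):ℂ)^s / s - ((v+x:ℝ):ℂ)^s / s) (Icc 0 H) x := by
    intro x hx
    have h1 : HasDerivAt (fun a : ℝ => SSK (v+a+Δ) s) (((v+x+Δ:ℝ):ℂ)^s / s) x := by
      have := (SSK_der (x := x + (v+Δ)) (s := s) (by linarith [hx.1]) hs).comp_add_const x (v+Δ)
      have e : (fun a => SSK (v+a+Δ) s) = fun x => SSK (x+(v+Δ)) s := by ext a; congr 1; ring
      rw [e, show v+x+Δ = x+(v+Δ) by ring]; exact this
    have h2 : HasDerivAt (fun a : ℝ => SSK (v+a) s) (((v+x:ℝ):ℂ)^s / s) x := by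
      have := (SSK_der (x := x + v) (s := s) (by linarith [hx.1]) hs).comp_add_const x v
      have e : (fun a => SSK (v+a) s) = fun x => SSK (x+v) s := by ext a; congr 1; ring
      rw [e, add_comm v x]; exact this
    exact (h1.sub h2).hasDerivWithinAt
  have := norm_image_sub_le_of_norm_deriv_le_segment' hd (C := Δ * v^(s.re-1)) (fun x hx => inner x hx.1) H ⟨hH, le_rfl⟩
  simp only [add_zero, sub_zero] at this
  unfold SSK4
  refine this.trans (le_of_eq (by ring))

theorem SSJ_2 {v H Δ L : ℝ} {s : ℂ} (hv : 3 ≤ v) (hL : Real.log v = L) (hH : 0 ≤ H) (hΔ : 0 ≤ Δ) (hHv : H ≤ v) (hΔv : Δ ≤ v)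
    (hs : 0 < s.re) (hs1 : s.re ≤ 1 + 1/L) (ht : s.im ≠ 0) :
    ‖SSK4 v H Δ s‖ ≤ 36 * Real.exp 2 * v^2 / s.im^2 := by
  have hL1 : 1 ≤ L := by rw [← hL]; exact SSY_logT hv
  have key : ∀ x, v ≤ x → x ≤ 3 * v → ‖SSK x s‖ ≤ 9 * Real.exp 2 * v^2 / s.im^2 := by
    intro x hx1 hx2
    have hx0 : 0 < x := by linarith
    rw [SSK, norm_div, Complex.norm_cpow_eq_rpow_re_of_pos hx0, norm_mul]
    have a1 : |s.im| ≤ ‖s‖ := Complex.abs_im_le_norm s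
    have a2 : |s.im| ≤ ‖s+1‖ := by simpa using Complex.abs_im_le_norm (s+1)
    have a3 : s.im^2 ≤ ‖s‖ * ‖s+1‖ := by
      rw [← sq_abs, pow_two]; gcongr
    have a4 : 0 < s.im^2 := by positivity
    have b1 : x^((s+1).re) ≤ 9 * Real.exp 2 * v^2 := by
      calc x^((s+1).re) ≤ (3*v)^((s+1).re) := by
            apply Real.rpow_le_rpow hx0.le hx2; simp; linarith
        _ ≤ (3*v)^((2:ℝ) + 1/L) := by
            apply Real.rpow_le_rpow_of_exponent_le (by linarith); simp only [Complex.add_re, Complex.one_re]; linarith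
        _ = (3*v)^(2:ℝ) * (3*v)^(1/L) := by rw [Real.rpow_add (by linarith)]
        _ ≤ (3*v)^(2:ℝ) * (v^2)^(1/L) := by gcongr; nlinarith
        _ = _ := by
          rw [Real.rpow_two, Real.rpow_def_of_pos (x := v^2) (by positivity), Real.log_pow, hL]
          have : ((2:ℕ):ℝ) * L * (1/L) = 2 := by field_simp; norm_num
          rw [this]; ring
    gcongr
  have k1 := key (v+H+Δ) (by linarith) (by linarith)
  have k2 := key (v+H) (by linarith) (by linarith)
  have k3 := key (v+Δ) (by linarith) (by linarith)
  have k4 := key v (by linarith) (by linarith)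
  have e : 36 * Real.exp 2 * v^2 / s.im^2 = 4 * (9 * Real.exp 2 * v^2 / s.im^2) := by ring
  unfold SSK4
  have := norm_sub_le (SSK (v+H+Δ) s - SSK (v+H) s) (SSK (v+Δ) s - SSK v s)
  have := norm_sub_le (SSK (v+H+Δ) s) (SSK (v+H) s)
  have := norm_sub_le (SSK (v+Δ) s) (SSK v s)
  linarith

theorem SSK_diff {v : ℝ} (hv : 0 < v) {s : ℂ} (hs : 0 < s.re) : DifferentiableAt ℂ (SSK v) s := by
  unfold SSK
  have hvc : (v:ℂ) ≠ 0 := by exact_mod_cast hv.ne'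
  have hs0 : s ≠ 0 := fun h => by rw [h] at hs; simp at hs
  have hs1 : s + 1 ≠ 0 := fun h => by
    have := congrArg Complex.re h; simp at this; linarith
  refine DifferentiableAt.div ?_ (by fun_prop) (mul_ne_zero hs0 hs1)
  exact DifferentiableAt.const_cpow (by fun_prop) (Or.inl hvc)

theorem SSK4_diff {v H Δ : ℝ} (hv : 0 < v) (hH : 0 ≤ H) (hΔ : 0 ≤ Δ) {s : ℂ} (hs : 0 < s.re) : DifferentiableAt ℂ (SSK4 v H Δ) s := by
  unfold SSK4
  exact ((SSK_diff (by linarith) hs).sub (SSK_diff (by linarith) hs)).sub ((SSK_diff (by linarith) hs).sub (SSK_diff (by linarith) hs))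

theorem SSJ_shift {f : ℂ → ℂ} {a b T B : ℝ} (hab : a ≤ b) (hT : 0 ≤ T)
    (hf : ∀ s : ℂ, a ≤ s.re → s.re ≤ b → |s.im| ≤ T → DifferentiableAt ℂ f s)
    (hB : ∀ s : ℂ, a ≤ s.re → s.re ≤ b → |s.im| = T → ‖f s‖ ≤ B) :
    ‖∫ t in (-T)..T, f (b + t*I)‖ ≤ ‖∫ t in (-T)..T, f (a + t*I)‖ + 2 * (B * (b-a)) := by
  have h := Complex.integral_boundary_rect_eq_zero_of_differentiableOn f (⟨a, -T⟩) (⟨b, T⟩) (by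
    intro s hs
    rw [Complex.mem_reProdIm, uIcc_of_le hab, uIcc_of_le (by linarith : -T ≤ T)] at hs
    exact (hf s hs.1.1 hs.1.2 (abs_le.mpr hs.2)).differentiableWithinAt)
  simp only at h
  have b1 : ∀ T' : ℝ, |T'| = T → ‖∫ x in a..b, f (x + T' * I)‖ ≤ B * (b-a) := by
    intro T' hT'
    have := intervalIntegral.norm_integral_le_of_norm_le_const (a := a) (b := b) (f := fun x : ℝ => f (x + T' * I)) (C := B) (fun x hx => by
      rw [uIoc_of_le hab] at hx
      exact hB _ (by simp; linarith [hx.1]) (by simp; exact hx.2) (by simpa using hT'))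
    rwa [abs_of_nonneg (by linarith)] at this
  have c1 := b1 (-T) (by rw [abs_neg, abs_of_nonneg hT])
  have c2 := b1 T (abs_of_nonneg hT)
  have e : I • ∫ t in (-T)..T, f (b + t*I) = I • (∫ t in (-T)..T, f (a + t*I)) - (∫ x in a..b, f (x + (-T:ℝ) * I)) + (∫ x in a..b, f (x + T * I)) := by
    linear_combination h
  have n1 : ‖I • ∫ t in (-T)..T, f (b + t*I)‖ = ‖∫ t in (-T)..T, f (b + t*I)‖ := by simp
  have n2 : ‖I • ∫ t in (-T)..T, f (a + t*I)‖ = ‖∫ t in (-T)..T, f (a + t*I)‖ := by simp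
  rw [← n1, e, ← n2]
  have m1 := norm_add_le (I • (∫ t in (-T)..T, f (a + t*I)) - (∫ x in a..b, f (x + (-T:ℝ) * I))) (∫ x in a..b, f (x + T * I))
  have m2 := norm_sub_le (I • (∫ t in (-T)..T, f (a + t*I))) (∫ x in a..b, f (x + (-T:ℝ) * I))
  linarith

theorem SSJ_tail {g : ℝ → ℂ} {T B : ℝ} (hT : 0 < T) (hg : Integrable g) (hb : ∀ t, T ≤ |t| → ‖g t‖ ≤ B / t^2) (hB : 0 ≤ B) :
    ‖∫ t, g t‖ ≤ ‖∫ t in (-T)..T, g t‖ + 2 * Real.pi * B / T := by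
  rw [intervalIntegral.integral_of_le (by linarith), ← integral_add_compl (measurableSet_Ioc : MeasurableSet (Ioc (-T) T)) hg]
  refine (norm_add_le _ _).trans ?_
  gcongr
  have hI : Integrable (fun t : ℝ => (1 + (t/T)^2)⁻¹) := integrable_inv_one_add_sq.comp_div hT.ne'
  have hI2 : Integrable (fun t : ℝ => 2 * B / T^2 * (1 + (t/T)^2)⁻¹) := hI.const_mul _
  calc ‖∫ t in (Ioc (-T) T)ᶜ, g t‖ ≤ ∫ t in (Ioc (-T) T)ᶜ, 2 * B / T^2 * (1 + (t/T)^2)⁻¹ := by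
        refine norm_integral_le_of_norm_le hI2.integrableOn ?_
        refine (ae_restrict_iff' (measurableSet_Ioc.compl)).mpr (Filter.Eventually.of_forall (fun t ht => ?_))
        have ht' : T ≤ |t| := by
          by_contra h
          push Not at h
          rw [abs_lt] at h
          exact ht ⟨h.1, h.2.le⟩
        refine (hb t ht').trans ?_
        have h2 : T^2 ≤ t^2 := by rw [← sq_abs t]; gcongr
        have h3 : 0 < t^2 := by have : 0 < T^2 := by positivity
                                linarith
        rw [← div_eq_mul_inv, div_div, div_le_div_iff₀ h3 (by positivity)]
        have : T^2 * (1 + (t/T)^2) = T^2 + t^2 := by field_simp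
        rw [this]
        nlinarith
    _ ≤ ∫ t, 2 * B / T^2 * (1 + (t/T)^2)⁻¹ := setIntegral_le_integral hI2 (Filter.Eventually.of_forall (fun t => by simp only [Pi.zero_apply]; positivity))
    _ = 2 * Real.pi * B / T := by
      rw [integral_const_mul]
      have := Measure.integral_comp_div (fun t : ℝ => (1+t^2)⁻¹) T
      rw [this, integral_univ_inv_one_add_sq, abs_of_pos hT, smul_eq_mul]
      field_simp

end

section
open Complex Metric Set Filter Topology MeasureTheory

theorem SSFF_diff {s : ℂ} (h : riemannZeta₁ s ≠ 0) : DifferentiableAt ℂ SSFF s := by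
  unfold SSFF
  have h1 := differentiable_riemannZeta₁
  have h2 : Differentiable ℂ (deriv riemannZeta₁) := h1.deriv
  exact (differentiable_riemannZeta₀ s).neg.sub ((h2 s).div (h1 s) h)

noncomputable def SSW (v H Δ x : ℝ) : ℝ := (max (v+H+Δ-x) 0 - max (v+H-x) 0) - (max (v+Δ-x) 0 - max (v-x) 0)

noncomputable def SST (M : ℕ) (v H Δ : ℝ) : ℝ := ∑ n ∈ Finset.Icc 1 M, (ArithmeticFunction.vonMangoldt n - 1) * SSW v H Δ n

theorem SSL_int {L v : ℝ} (hL : 1 ≤ L) (hv : 0 < v) :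
    Integrable (fun t : ℝ => SSFF (((1+1/L:ℝ):ℂ) + t*I) * SSK v (((1+1/L:ℝ):ℂ) + t*I)) := by
  have hp : 0 < 1/L := by positivity
  have hF : Continuous (fun t : ℝ => SSFF (((1+1/L:ℝ):ℂ) + t*I)) := by
    rw [continuous_iff_continuousAt]
    intro t
    have hc : ContinuousAt (fun t : ℝ => (((1+1/L:ℝ):ℂ) + t*I)) t := by fun_prop
    exact ContinuousAt.comp (f := fun t : ℝ => (((1+1/L:ℝ):ℂ) + t*I)) (SSFF_diff (SSZ_ne (by simp; linarith))).continuousAt hc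
  have hK := SSK_cont (σ := 1+1/L) (v := v) (by linarith) hv
  refine ((integrable_inv_one_add_sq.const_mul (v^(1+1/L+1))).const_mul (3840*L^2)).mono' (hF.mul hK).aestronglyMeasurable ?_
  refine Filter.Eventually.of_forall (fun t => ?_)
  rw [norm_mul]
  exact mul_le_mul (SSI_Fb2 hL t) (SSK_bd (by linarith) hv) (norm_nonneg _) (by positivity)

theorem SSL_1 {L v H Δ : ℝ} (hL : 1 ≤ L) (hv : 0 < v) (hH : 0 ≤ H) (hΔ : 0 ≤ Δ) {M : ℕ} (hM : v + H + Δ ≤ M) :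
    Integrable (fun t : ℝ => SSFF (((1+1/L:ℝ):ℂ) + t*I) * SSK4 v H Δ (((1+1/L:ℝ):ℂ) + t*I)) ∧
    ((SST M v H Δ : ℝ) : ℂ) =
      (1/(2*Real.pi) : ℝ) • ∫ t : ℝ, SSFF (((1+1/L:ℝ):ℂ) + t*I) * SSK4 v H Δ (((1+1/L:ℝ):ℂ) + t*I) := by
  have i1 := SSL_int hL (v := v+H+Δ) (by linarith)
  have i2 := SSL_int hL (v := v+H) (by linarith)
  have i3 := SSL_int hL (v := v+Δ) (by linarith)
  have i4 := SSL_int hL (v := v) (by linarith)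
  have e1 := SSI_5 hL (v := v+H+Δ) (by linarith) (M := M) (by linarith)
  have e2 := SSI_5 hL (v := v+H) (by linarith) (M := M) (by linarith)
  have e3 := SSI_5 hL (v := v+Δ) (by linarith) (M := M) (by linarith)
  have e4 := SSI_5 hL (v := v) (by linarith) (M := M) (by linarith)
  have hfe : (fun t : ℝ => SSFF (((1+1/L:ℝ):ℂ) + t*I) * SSK4 v H Δ (((1+1/L:ℝ):ℂ) + t*I)) =
    fun t : ℝ => (SSFF (((1+1/L:ℝ):ℂ) + t*I) * SSK (v+H+Δ) (((1+1/L:ℝ):ℂ) + t*I) - SSFF (((1+1/L:ℝ):ℂ) + t*I) * SSK (v+H) (((1+1/L:ℝ):ℂ) + t*I))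
      - (SSFF (((1+1/L:ℝ):ℂ) + t*I) * SSK (v+Δ) (((1+1/L:ℝ):ℂ) + t*I) - SSFF (((1+1/L:ℝ):ℂ) + t*I) * SSK (v) (((1+1/L:ℝ):ℂ) + t*I)) := by
    ext t; unfold SSK4; ring
  rw [hfe]
  have j1 : Integrable (fun t : ℝ => SSFF (((1+1/L:ℝ):ℂ) + t*I) * SSK (v+H+Δ) (((1+1/L:ℝ):ℂ) + t*I) - SSFF (((1+1/L:ℝ):ℂ) + t*I) * SSK (v+H) (((1+1/L:ℝ):ℂ) + t*I)) := i1.sub i2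
  have j2 : Integrable (fun t : ℝ => SSFF (((1+1/L:ℝ):ℂ) + t*I) * SSK (v+Δ) (((1+1/L:ℝ):ℂ) + t*I) - SSFF (((1+1/L:ℝ):ℂ) + t*I) * SSK (v) (((1+1/L:ℝ):ℂ) + t*I)) := i3.sub i4
  refine ⟨j1.sub j2, ?_⟩
  rw [integral_sub j1 j2]
  rw [integral_sub i1 i2, integral_sub i3 i4, smul_sub, smul_sub, smul_sub, ← e1, ← e2, ← e3, ← e4]
  unfold SST SSW
  push_cast
  rw [← Finset.sum_sub_distrib, ← Finset.sum_sub_distrib, ← Finset.sum_sub_distrib]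
  refine Finset.sum_congr rfl (fun n _ => by ring)

set_option maxHeartbeats 1000000 in
theorem SSL_main : ∃ c C : ℝ, 0 < c ∧ 1 ≤ C ∧ ∀ N M : ℕ, 3 ≤ N → ∀ v H Δ : ℝ, 3 ≤ v → 0 ≤ H → 0 ≤ Δ → H ≤ v → Δ ≤ v →
    v + H + Δ ≤ M → |SST M v H Δ| ≤ C * (H * Δ * ((N:ℝ)^((3:ℝ)/2) * v^(-(1/100) : ℝ) + (Real.log N)^12 * v^(-c/Real.log N))
      + v^2 * ((Real.log v)^2 / N)) := by
  obtain ⟨CA, hCA, hA⟩ := SSH_A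
  obtain ⟨c0, CF, hc0, hc06, hCF, hF⟩ := SSH_F
  obtain ⟨CR, hCR, hR⟩ := SSG_R
  set c := min c0 (1/100) with hcd
  have hc : 0 < c := lt_min hc0 (by norm_num)
  have hcc : c ≤ c0 := min_le_left _ _
  have hc1 : c ≤ 1/100 := min_le_right _ _
  set K : ℝ := 36 * Real.exp 2 with hK
  have hK0 : 0 < K := by positivity
  refine ⟨c, 2*CA + CF*CR + 4*(CA*K) + 4*(CF*CA*K) + 7680*Real.pi*K, hc, ?_, ?_⟩
  · have : 0 < CF * CR := by positivity
    have : 0 < 4*(CF*CA*K) + 7680*Real.pi*K := by positivity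
    have : 0 < CA * K := by positivity
    linarith
  intro N M hN v H Δ hv hH hΔ hHv hΔv hM
  have hN3 : (3:ℝ) ≤ N := by exact_mod_cast hN
  have hN0 : (0:ℝ) < N := by linarith
  set L := Real.log v with hLd
  have hL1 : 1 ≤ L := SSY_logT hv
  set ℓ := Real.log N with hℓd
  have hℓ1 : 1 ≤ ℓ := SSE_log hN
  have hv0 : 0 < v := by linarith
  have hLi : 1/L ≤ 1 := by rw [div_le_one (by linarith)]; exact hL1
  have hLp : 0 < 1/L := by positivity
  have hcl : c/ℓ ≤ 1/100 := by rw [div_le_iff₀ (by linarith)]; linarith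
  have hcl0 : 0 < c/ℓ := by positivity
  obtain ⟨hint, heq⟩ := SSL_1 hL1 hv0 hH hΔ hM
  have t1 := SSJ_tail (T := N) (B := 3840*L^2*(K*v^2)) hN0 hint (fun t ht => by
    have ht0 : t ≠ 0 := by rintro rfl; simp at ht; linarith
    rw [norm_mul, mul_div_assoc]
    refine mul_le_mul (SSI_Fb2 hL1 t) ?_ (norm_nonneg _) (by positivity)
    have := SSJ_2 (s := ((1+1/L:ℝ):ℂ) + t*I) hv rfl hH hΔ hHv hΔv (by simp; positivity) (by simp [hLd]) (by simpa using ht0)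
    simpa [hK] using this) (by positivity)
  have hD0 : 0 ≤ H * Δ := by positivity
  -- nonvanishing on the contour
  have hz : ∀ s : ℂ, 1 - c/ℓ ≤ s.re → s.re ≤ 1 + 1/L → |s.im| ≤ N → riemannZeta₁ s ≠ 0 ∧ ‖SSFF s‖ ≤ CF * ℓ^2 := by
    intro s h1 h2 h3
    have : c/ℓ ≤ c0/ℓ := by gcongr
    exact hF N hN s h3 (by linarith) (by linarith)
  have him : ∀ s : ℂ, |s.im| = N → 1/100 ≤ ‖s-1‖ := by
    intro s h
    have := Complex.abs_im_le_norm (s-1)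
    simp only [Complex.sub_im, Complex.one_im, sub_zero] at this
    linarith
  have hsq : ∀ s : ℂ, |s.im| = N → s.im^2 = (N:ℝ)^2 := fun s h => by rw [← sq_abs, h]
  have hKs : ∀ s : ℂ, 99/100 ≤ s.re → s.re ≤ 1 + 1/L → |s.im| = N → ‖SSK4 v H Δ s‖ ≤ K * v^2 / (N:ℝ)^2 := by
    intro s h1 h2 h3
    have := SSJ_2 (s := s) hv rfl hH hΔ hHv hΔv (by linarith) h2 (by intro h; rw [h] at h3; simp at h3; linarith)
    rwa [hsq s h3] at this
  -- first piece
  have p1 := SSJ_shift (f := fun s => SSAA N s * SSK4 v H Δ s) (a := 99/100) (b := 1+1/L) (T := N) (B := CA * (N:ℝ)^((1:ℝ)/2) * (K * v^2 / (N:ℝ)^2))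
    (by linarith) hN0.le (fun s h1 h2 h3 => (SSAA_diff N s).mul (SSK4_diff hv0 hH hΔ (by linarith))) (fun s h1 h2 h3 => by
      rw [norm_mul]
      exact mul_le_mul (hA N hN s h1 (by linarith) h3.le (him s h3)).1 (hKs s h1 h2 h3) (norm_nonneg _) (by positivity))
  have p1v : ‖∫ t in (-(N:ℝ))..N, SSAA N (((99/100:ℝ):ℂ) + t*I) * SSK4 v H Δ (((99/100:ℝ):ℂ) + t*I)‖ ≤
      CA * (N:ℝ)^((1:ℝ)/2) * (H*Δ*v^(-(1/100):ℝ)) * (2*N) := by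
    have := intervalIntegral.norm_integral_le_of_norm_le_const (a := -(N:ℝ)) (b := N)
      (f := fun t : ℝ => SSAA N (((99/100:ℝ):ℂ) + t*I) * SSK4 v H Δ (((99/100:ℝ):ℂ) + t*I)) (C := CA * (N:ℝ)^((1:ℝ)/2) * (H*Δ*v^(-(1/100):ℝ))) (fun t ht => by
        rw [uIoc_of_le (by linarith)] at ht
        rw [norm_mul]
        refine mul_le_mul (hA N hN _ (by simp) (by simp; norm_num) (by simpa using abs_le.mpr ⟨ht.1.le, ht.2⟩) ?_).1 ?_ (norm_nonneg _) (by positivity)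
        · have := Complex.abs_re_le_norm ((((99/100:ℝ):ℂ) + t*I) - 1)
          refine le_trans ?_ this
          simp; norm_num
        · have := SSJ_1 (s := ((99/100:ℝ):ℂ) + t*I) hv0 hH hΔ (by simp) (by simp; norm_num)
          have e : (((99/100:ℝ):ℂ) + t*I).re - 1 = -(1/100) := by simp; norm_num
          rwa [e] at this)
    rwa [show |(N:ℝ) - -N| = 2*N by rw [abs_of_nonneg (by linarith)]; ring] at this
  -- second piece
  have p2 := SSJ_shift (f := fun s => SSFF s * (SSR N s)^2 * SSK4 v H Δ s) (a := 1 - c/ℓ) (b := 1+1/L) (T := N) (B := CF * CA * (N:ℝ)^((1:ℝ)/2) * (K * v^2 / (N:ℝ)^2))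
    (by linarith) hN0.le (fun s h1 h2 h3 => ((SSFF_diff (hz s h1 h2 h3).1).mul ((SSR_diff N s).pow 2)).mul (SSK4_diff hv0 hH hΔ (by linarith))) (fun s h1 h2 h3 => by
      rw [norm_mul]
      refine mul_le_mul ?_ (hKs s (by linarith) h2 h3) (norm_nonneg _) (by positivity)
      rw [norm_mul, norm_pow]
      calc ‖SSFF s‖ * ‖SSR N s‖^2 ≤ CF * ℓ^2 * ‖SSR N s‖^2 := by gcongr; exact (hz s h1 h2 h3.le).2
        _ = CF * (ℓ^2 * ‖SSR N s‖^2) := by ring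
        _ ≤ CF * (CA * (N:ℝ)^((1:ℝ)/2)) := 
            mul_le_mul_of_nonneg_left (hA N hN s (by linarith) (by linarith) h3.le (him s h3)).2 (by linarith)
        _ = _ := by ring)
  have p2v : ‖∫ t in (-(N:ℝ))..N, SSFF (((1-c/ℓ:ℝ):ℂ) + t*I) * (SSR N (((1-c/ℓ:ℝ):ℂ) + t*I))^2 * SSK4 v H Δ (((1-c/ℓ:ℝ):ℂ) + t*I)‖ ≤
      CF * ℓ^2 * (H*Δ*v^(-c/ℓ)) * (CR * ℓ^10) := by
    have hcR : Continuous (fun t : ℝ => CF * ℓ^2 * (H*Δ*v^(-c/ℓ)) * ‖SSR N (((1-c/ℓ:ℝ):ℂ) + t*I)‖^2) := by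
      have h1 := (SSR_diff N).continuous
      have h2 : Continuous (fun t : ℝ => SSR N (((1-c/ℓ:ℝ):ℂ) + t*I)) := h1.comp (by fun_prop)
      exact continuous_const.mul (h2.norm.pow 2)
    have := intervalIntegral.norm_integral_le_of_norm_le (a := -(N:ℝ)) (b := N) (μ := volume) (by linarith)
      (f := fun t : ℝ => SSFF (((1-c/ℓ:ℝ):ℂ) + t*I) * (SSR N (((1-c/ℓ:ℝ):ℂ) + t*I))^2 * SSK4 v H Δ (((1-c/ℓ:ℝ):ℂ) + t*I))
      (Filter.Eventually.of_forall (fun t ht => by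
        have er : (((1-c/ℓ:ℝ):ℂ) + t*I).re = 1 - c/ℓ := by simp
        have h1 := (hz (((1-c/ℓ:ℝ):ℂ) + t*I) er.ge (by rw [er]; linarith) (by simpa using abs_le.mpr ⟨ht.1.le, ht.2⟩)).2
        have h2 := SSJ_1 (s := ((1-c/ℓ:ℝ):ℂ) + t*I) hv0 hH hΔ (by rw [er]; linarith) (by rw [er]; linarith)
        have e : (((1-c/ℓ:ℝ):ℂ) + t*I).re - 1 = -c/ℓ := by rw [er]; ring
        rw [e] at h2
        rw [norm_mul, norm_mul, norm_pow]
        calc _ ≤ CF * ℓ^2 * ‖SSR N (((1-c/ℓ:ℝ):ℂ) + t*I)‖^2 * (H*Δ*v^(-c/ℓ)) := by gcongr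
          _ = CF * ℓ^2 * (H*Δ*v^(-c/ℓ)) * ‖SSR N (((1-c/ℓ:ℝ):ℂ) + t*I)‖^2 := by ring)) (hcR.intervalIntegrable _ _)
    refine this.trans ?_
    rw [intervalIntegral.integral_const_mul]
    have hl1 : c/ℓ ≤ 1/ℓ := by gcongr; linarith
    gcongr
    exact hR N hN (1-c/ℓ) (by linarith) (by linarith) (by linarith)
  -- split
  have hsplit : ∫ t in (-(N:ℝ))..N, SSFF (((1+1/L:ℝ):ℂ) + t*I) * SSK4 v H Δ (((1+1/L:ℝ):ℂ) + t*I) =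
      (∫ t in (-(N:ℝ))..N, SSAA N (((1+1/L:ℝ):ℂ) + t*I) * SSK4 v H Δ (((1+1/L:ℝ):ℂ) + t*I)) +
      ∫ t in (-(N:ℝ))..N, SSFF (((1+1/L:ℝ):ℂ) + t*I) * (SSR N (((1+1/L:ℝ):ℂ) + t*I))^2 * SSK4 v H Δ (((1+1/L:ℝ):ℂ) + t*I) := by
    have hline : ∀ g : ℂ → ℂ, (∀ s : ℂ, s.re = 1 + 1/L → DifferentiableAt ℂ g s) → IntervalIntegrable (fun t : ℝ => g (((1+1/L:ℝ):ℂ) + t*I)) volume (-(N:ℝ)) N := by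
      intro g hg
      apply Continuous.intervalIntegrable
      rw [continuous_iff_continuousAt]
      intro t
      exact ContinuousAt.comp (f := fun t : ℝ => (((1+1/L:ℝ):ℂ) + t*I)) (hg _ (by simp)).continuousAt (by fun_prop)
    have hk : ∀ s : ℂ, s.re = 1 + 1/L → DifferentiableAt ℂ (SSK4 v H Δ) s := fun s h => SSK4_diff hv0 hH hΔ (by linarith)
    have hz' : ∀ s : ℂ, s.re = 1 + 1/L → riemannZeta₁ s ≠ 0 := fun s h => SSZ_ne (by linarith)
    rw [← intervalIntegral.integral_add (hline (fun s => SSAA N s * SSK4 v H Δ s) (fun s h => (SSAA_diff N s).mul (hk s h)))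
      (hline (fun s => SSFF s * (SSR N s)^2 * SSK4 v H Δ s) (fun s h => ((SSFF_diff (hz' s h)).mul ((SSR_diff N s).pow 2)).mul (hk s h)))]
    apply intervalIntegral.integral_congr
    intro t _
    have := SSH_split N (hz' (((1+1/L:ℝ):ℂ) + t*I) (by simp))
    simp only
    rw [← add_mul, ← this]
  rw [hsplit] at t1
  have t2 := t1.trans (add_le_add_left (norm_add_le _ _) _)
  have hS : |SST M v H Δ| ≤ ‖∫ t : ℝ, SSFF (((1+1/L:ℝ):ℂ) + t*I) * SSK4 v H Δ (((1+1/L:ℝ):ℂ) + t*I)‖ := by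
    rw [← Real.norm_eq_abs, ← Complex.norm_real, heq, norm_smul]
    have : ‖1/(2*Real.pi)‖ ≤ 1 := by
      rw [Real.norm_of_nonneg (by positivity), div_le_one (by positivity)]
      linarith [Real.pi_gt_three]
    exact mul_le_of_le_one_left (norm_nonneg _) this
  have q : (N:ℝ)^((1:ℝ)/2) * (N:ℝ) = (N:ℝ)^((3:ℝ)/2) := by
    rw [← Real.rpow_add_one hN0.ne']; norm_num
  have q2 : (N:ℝ)^((1:ℝ)/2) * (K * v^2 / (N:ℝ)^2) ≤ K * (v^2 * (L^2/N)) := by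
    have h1 : (N:ℝ)^((1:ℝ)/2) ≤ N := by
      calc (N:ℝ)^((1:ℝ)/2) ≤ (N:ℝ)^(1:ℝ) := Real.rpow_le_rpow_of_exponent_le (by linarith) (by norm_num)
        _ = N := Real.rpow_one _
    calc (N:ℝ)^((1:ℝ)/2) * (K * v^2 / (N:ℝ)^2) ≤ N * (K * v^2 / (N:ℝ)^2) := by gcongr
      _ = K * (v^2 * (1^2/N)) := by field_simp
      _ ≤ _ := by gcongr
  set X := v^2 * (L^2/N) with hX
  have hX0 : 0 ≤ X := by positivity
  set Y1 := (N:ℝ)^((3:ℝ)/2) * v^(-(1/100):ℝ) with hY1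
  set Y2 := ℓ^12 * v^(-c/ℓ) with hY2
  have hY10 : 0 ≤ Y1 := by positivity
  have hY20 : 0 ≤ Y2 := by positivity
  have r1 : CA * (N:ℝ)^((1:ℝ)/2) * (H*Δ*v^(-(1/100):ℝ)) * (2*N) = 2*CA*(H*Δ*Y1) := by
    rw [hY1, ← q]; ring
  have r2 : CF * ℓ^2 * (H*Δ*v^(-c/ℓ)) * (CR * ℓ^10) = CF*CR*(H*Δ*Y2) := by rw [hY2]; ring
  have r3 : 2 * (CA * (N:ℝ)^((1:ℝ)/2) * (K * v^2 / (N:ℝ)^2) * (1+1/L - 99/100)) ≤ 4*(CA*K)*X := by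
    calc _ ≤ 2 * (CA * (K * X) * 2) := by
          rw [mul_assoc CA]
          gcongr
          · linarith
          · linarith
      _ = _ := by ring
  have r4 : 2 * (CF * CA * (N:ℝ)^((1:ℝ)/2) * (K * v^2 / (N:ℝ)^2) * (1+1/L - (1 - c/ℓ))) ≤ 4*(CF*CA*K)*X := by
    calc _ ≤ 2 * (CF * CA * (K * X) * 2) := by
          rw [mul_assoc (CF*CA)]
          gcongr
          · linarith
          · linarith
      _ = _ := by ring
  have r5 : 2 * Real.pi * (3840*L^2*(K*v^2)) / N = 7680*Real.pi*K*X := by rw [hX]; ring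
  rw [r1] at p1v
  rw [r2] at p2v
  rw [r5] at t2
  have hfin : |SST M v H Δ| ≤ 2*CA*(H*Δ*Y1) + CF*CR*(H*Δ*Y2) + (4*(CA*K) + 4*(CF*CA*K) + 7680*Real.pi*K) * X := by
    linarith
  refine hfin.trans ?_
  have w1 : 0 ≤ H*Δ*Y1 := by positivity
  have w2 : 0 ≤ H*Δ*Y2 := by positivity
  have w3 : 0 ≤ CF*CR := by positivity
  have w4 : 0 ≤ 4*(CA*K) + 4*(CF*CA*K) + 7680*Real.pi*K := by positivity
  have x1 := mul_nonneg (add_nonneg w3 w4) w1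
  have x2 := mul_nonneg (add_nonneg (by linarith : 0 ≤ 2*CA) w4) w2
  have x3 := mul_nonneg (add_nonneg (by linarith : 0 ≤ 2*CA) w3) hX0
  linear_combination x1 + x2 + x3

end

section
open Complex Metric Set Filter Topology MeasureTheory

theorem SSN_0 {a A : ℝ} (n : ℕ) (ha : 0 < a) (hA : 0 < A) : ∃ m0 : ℝ, 1 ≤ m0 ∧ ∀ μ, m0 ≤ μ → μ^n * Real.exp (-a*μ) ≤ A := by
  have h := tendsto_rpow_mul_exp_neg_mul_atTop_nhds_zero n a ha
  obtain ⟨m, hm⟩ := Filter.eventually_atTop.mp (h.eventually (ge_mem_nhds hA))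
  refine ⟨max m 1, le_max_right _ _, fun μ hμ => ?_⟩
  have := hm μ ((le_max_left _ _).trans hμ)
  rwa [Real.rpow_natCast] at this

theorem SSN_1 {η : ℝ} (hη : 0 < η) : ∃ m0 : ℝ, 1 ≤ m0 ∧ ∀ μ Y v H Δ : ℝ, ∀ M : ℕ, m0 ≤ μ → Y = Real.exp (μ^5) → Y/2 ≤ v → v ≤ Y →
    Y * Real.exp (-2*μ^3) ≤ Δ → Δ ≤ H → H ≤ v → v + H + Δ ≤ M → |SST M v H Δ| ≤ η * (H * Δ) := by
  obtain ⟨c, C, hc, hC, hmain⟩ := SSL_main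
  have hA : 0 < η/(3*C) := by positivity
  obtain ⟨m1, hm1, h1⟩ := SSN_0 0 (a := 1) (by norm_num) hA
  obtain ⟨m2, hm2, h2⟩ := SSN_0 36 (a := c/12) (by positivity) (div_pos hA (by norm_num : (0:ℝ) < 6^12))
  obtain ⟨m3, hm3, h3⟩ := SSN_0 10 (a := 1) (by norm_num) hA
  refine ⟨max (max m1 m2) (max m3 60), (hm1.trans (le_max_left _ _)).trans (le_max_left _ _), ?_⟩
  intro μ Y v H Δ M hμ hY hv1 hv2 hΔ hΔH hHv hM
  have a1 := h1 μ (((le_max_left _ _).trans (le_max_left _ _)).trans hμ)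
  have a2 := h2 μ (((le_max_right _ _).trans (le_max_left _ _)).trans hμ)
  have a3 := h3 μ (((le_max_left _ _).trans (le_max_right _ _)).trans hμ)
  have hμ60 : 60 ≤ μ := ((le_max_right _ _).trans (le_max_right _ _)).trans hμ
  have hμ0 : 0 < μ := by linarith
  have hμ1 : 1 ≤ μ := by linarith
  have hμ2 : μ ≤ μ^2 := le_self_pow₀ hμ1 (by norm_num)
  have hμ3 : μ ≤ μ^3 := le_self_pow₀ hμ1 (by norm_num)
  have hμ5 : 3600*μ^3 ≤ μ^5 := by
    have h60 : (60:ℝ)^2 ≤ μ^2 := pow_le_pow_left₀ (by norm_num) hμ60 2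
    calc 3600*μ^3 = 60^2 * μ^3 := by norm_num
      _ ≤ μ^2 * μ^3 := mul_le_mul_of_nonneg_right h60 (pow_pos hμ0 3).le
      _ = μ^5 := by ring
  have hY0 : 0 < Y := by rw [hY]; exact Real.exp_pos _
  have hlY : Real.log Y = μ^5 := by rw [hY, Real.log_exp]
  have hY6 : 6 ≤ Y := by
    rw [hY]; have := Real.add_one_le_exp (μ^5); linarith
  have hv3 : 3 ≤ v := by linarith
  have hv0 : 0 < v := by linarith
  have hΔ0 : 0 < Δ := lt_of_lt_of_le (by positivity) hΔ
  have hH0 : 0 < H := by linarith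
  have hlv1 : μ^5/2 ≤ Real.log v := by
    have : Real.log (Y/2) ≤ Real.log v := Real.log_le_log (by positivity) hv1
    rw [Real.log_div hY0.ne' (by norm_num), hlY] at this
    have := Real.log_two_lt_d9
    linarith
  have hlv0 : 0 ≤ Real.log v := Real.log_nonneg (by linarith)
  have hlv2 : Real.log v ≤ μ^5 := by rw [← hlY]; exact Real.log_le_log hv0 hv2
  set N : ℕ := ⌈Real.exp (5*μ^3)⌉₊ with hNd
  have hN1 : Real.exp (5*μ^3) ≤ N := Nat.le_ceil _
  have hN2 : (N:ℝ) ≤ Real.exp (6*μ^3) := by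
    have h : (N:ℝ) < Real.exp (5*μ^3) + 1 := Nat.ceil_lt_add_one (Real.exp_pos _).le
    have e : Real.exp (6*μ^3) = Real.exp (5*μ^3) * Real.exp (μ^3) := by rw [← Real.exp_add]; ring_nf
    have e1 : 1 ≤ Real.exp (5*μ^3) := Real.one_le_exp (by positivity)
    have e2 := Real.add_one_le_exp (μ^3)
    have e3 := mul_le_mul_of_nonneg_left (show 2 ≤ Real.exp (μ^3) by linarith) (Real.exp_pos (5*μ^3)).le
    rw [e]; linarith
  have hN3' : (3:ℝ) ≤ N := by
    have := Real.add_one_le_exp (5*μ^3); linarith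
  have hN3 : 3 ≤ N := by exact_mod_cast hN3'
  have hN0 : (0:ℝ) < N := by linarith
  have hl1 := SSE_log hN3
  have hl2 : Real.log N ≤ 6*μ^3 := by
    rw [← Real.log_exp (6*μ^3)]; exact Real.log_le_log hN0 hN2
  have m := hmain N M hN3 v H Δ hv3 hH0.le hΔ0.le hHv (hΔH.trans hHv) hM
  have t1 : (N:ℝ)^((3:ℝ)/2) * v^(-(1/100) : ℝ) ≤ η/(3*C) := by
    refine le_trans ?_ a1
    rw [pow_zero, one_mul, Real.rpow_def_of_pos hN0, Real.rpow_def_of_pos hv0, ← Real.exp_add]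
    apply Real.exp_le_exp.mpr
    linarith
  have t2 : (Real.log N)^12 * v^(-c/Real.log N) ≤ η/(3*C) := by
    have b1 : (Real.log N)^12 ≤ 6^12 * μ^36 := by
      calc (Real.log N)^12 ≤ (6*μ^3)^12 := by gcongr
        _ = _ := by ring
    have b2 : v^(-c/Real.log N) ≤ Real.exp (-(c/12)*μ) := by
      rw [Real.rpow_def_of_pos hv0]
      apply Real.exp_le_exp.mpr
      have : c/12*μ ≤ Real.log v * (c/Real.log N) := by
        calc c/12*μ ≤ c/12*μ^2 := by gcongr
          _ = μ^5/2 * (c/(6*μ^3)) := by field_simp; ring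
          _ ≤ _ := by gcongr
      have e : Real.log v * (-c/Real.log N) = - (Real.log v * (c/Real.log N)) := by ring
      rw [e]; linarith
    calc _ ≤ 6^12 * μ^36 * Real.exp (-(c/12)*μ) := by gcongr
      _ = 6^12 * (μ^36 * Real.exp (-(c/12)*μ)) := by ring
      _ ≤ 6^12 * (η/(3*C)/6^12) := by gcongr
      _ = _ := by field_simp
  have t3 : v^2 * ((Real.log v)^2/N) ≤ H*Δ*(η/(3*C)) := by
    have b1 : Y^2 * Real.exp (-4*μ^3) ≤ H*Δ := by
      calc Y^2 * Real.exp (-4*μ^3) = (Y * Real.exp (-2*μ^3)) * (Y * Real.exp (-2*μ^3)) := by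
            have : Real.exp (-4*μ^3) = Real.exp (-2*μ^3) * Real.exp (-2*μ^3) := by rw [← Real.exp_add]; ring_nf
            rw [this]; ring
        _ ≤ H * Δ := by
          have : Y * Real.exp (-2*μ^3) ≤ H := hΔ.trans hΔH
          gcongr
    calc v^2 * ((Real.log v)^2/N) ≤ Y^2 * ((μ^5)^2/Real.exp (5*μ^3)) := by
          gcongr
      _ = Y^2 * Real.exp (-4*μ^3) * (μ^10 * Real.exp (-μ^3)) := by
          rw [div_eq_mul_inv, ← Real.exp_neg]
          have : Real.exp (-(5*μ^3)) = Real.exp (-4*μ^3) * Real.exp (-μ^3) := by rw [← Real.exp_add]; ring_nf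
          rw [this]; ring
      _ ≤ H*Δ*(η/(3*C)) := by
          refine mul_le_mul b1 (le_trans ?_ a3) (by positivity) (by positivity)
          gcongr
          linarith
  refine m.trans ?_
  have hHD : 0 < H*Δ := by positivity
  calc _ ≤ C * (H*Δ*(η/(3*C) + η/(3*C)) + H*Δ*(η/(3*C))) := by gcongr
    _ = _ := by field_simp; ring

theorem SSW_b {v H Δ x : ℝ} (hΔ : 0 ≤ Δ) (hH : Δ ≤ H) :
    Δ * ((if x ≤ v+H then 1 else 0) - (if x ≤ v+Δ then 1 else 0)) ≤ SSW v H Δ x ∧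
    SSW v H Δ x ≤ Δ * ((if x ≤ v+H+Δ then 1 else 0) - (if x ≤ v then 1 else 0)) := by
  unfold SSW
  constructor <;> split_ifs <;>
  rcases max_cases (v+H+Δ-x) 0 with h1 | h1 <;> rcases max_cases (v+H-x) 0 with h2 | h2 <;>
  rcases max_cases (v+Δ-x) 0 with h3 | h3 <;> rcases max_cases (v-x) 0 with h4 | h4 <;> linarith [h1.1, h1.2, h2.1, h2.2, h3.1, h3.2, h4.1, h4.2]

theorem SSN_sum (f : ℕ → ℝ) {b : ℝ} {M : ℕ} (hb : 0 ≤ b) (hM : b ≤ M) :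
    ∑ n ∈ Finset.Icc 1 M, f n * (if (n:ℝ) ≤ b then 1 else 0) = ∑ n ∈ Finset.Ioc 0 ⌊b⌋₊, f n := by
  simp only [mul_ite, mul_one, mul_zero]
  rw [← Finset.sum_filter]
  apply Finset.sum_congr _ (fun _ _ => rfl)
  ext n
  simp only [Finset.mem_filter, Finset.mem_Icc, Finset.mem_Ioc, Nat.le_floor_iff hb]
  constructor
  · rintro ⟨⟨h1, h2⟩, h3⟩; exact ⟨h1, h3⟩
  · rintro ⟨h1, h3⟩; exact ⟨⟨h1, by exact_mod_cast h3.trans hM⟩, h3⟩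

theorem SSN_2 {v H Δ : ℝ} {M : ℕ} (f : ℕ → ℝ) (hf : ∀ n, 0 ≤ f n) (hv : 0 ≤ v) (hΔ : 0 ≤ Δ) (hH : Δ ≤ H) (hM : v + H + Δ ≤ M) :
    Δ * (∑ n ∈ Finset.Ioc 0 ⌊v+H⌋₊, f n - ∑ n ∈ Finset.Ioc 0 ⌊v+Δ⌋₊, f n) ≤ ∑ n ∈ Finset.Icc 1 M, f n * SSW v H Δ n ∧
    ∑ n ∈ Finset.Icc 1 M, f n * SSW v H Δ n ≤ Δ * (∑ n ∈ Finset.Ioc 0 ⌊v+H+Δ⌋₊, f n - ∑ n ∈ Finset.Ioc 0 ⌊v⌋₊, f n) := by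
  rw [← SSN_sum f (b := v+H) (M := M) (by linarith) (by linarith), ← SSN_sum f (b := v+Δ) (M := M) (by linarith) (by linarith),
    ← SSN_sum f (b := v+H+Δ) (M := M) (by linarith) (by linarith), ← SSN_sum f (b := v) (M := M) (by linarith) (by linarith),
    ← Finset.sum_sub_distrib, ← Finset.sum_sub_distrib, Finset.mul_sum, Finset.mul_sum]
  constructor <;> refine Finset.sum_le_sum (fun n _ => ?_)
  · have := mul_le_mul_of_nonneg_left (SSW_b (v := v) (x := n) hΔ hH).1 (hf n)
    refine le_trans (le_of_eq (by ring)) this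
  · have := mul_le_mul_of_nonneg_left (SSW_b (v := v) (x := n) hΔ hH).2 (hf n)
    refine this.trans (le_of_eq (by ring))

theorem SSN_3 {η v H Δ : ℝ} {M : ℕ} (hv : 0 ≤ v) (hΔ : 0 < Δ) (hH : Δ ≤ H) (hM : v + H + Δ ≤ M) (h : |SST M v H Δ| ≤ η * (H*Δ)) :
    H - Δ - 1 - η*H ≤ Chebyshev.psi (v+H+Δ) - Chebyshev.psi v ∧ Chebyshev.psi (v+H) - Chebyshev.psi (v+Δ) ≤ H + Δ + 1 + η*H := by
  have hΛ := SSN_2 (M := M) (fun n => ArithmeticFunction.vonMangoldt n) (fun n => ArithmeticFunction.vonMangoldt_nonneg) hv hΔ.le hH hM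
  have h1 := SSN_2 (M := M) (fun n => 1) (fun n => zero_le_one) hv hΔ.le hH hM
  have e : SST M v H Δ = ∑ n ∈ Finset.Icc 1 M, ArithmeticFunction.vonMangoldt n * SSW v H Δ n - ∑ n ∈ Finset.Icc 1 M, 1 * SSW v H Δ n := by
    unfold SST; rw [← Finset.sum_sub_distrib]; refine Finset.sum_congr rfl (fun n _ => by ring)
  rw [e, abs_le] at h
  simp only [Finset.sum_const, Nat.card_Ioc, nsmul_eq_mul, mul_one, Nat.sub_zero] at h1
  have p : ∀ x, Chebyshev.psi x = ∑ n ∈ Finset.Ioc 0 ⌊x⌋₊, ArithmeticFunction.vonMangoldt n := fun x => rfl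
  rw [← p, ← p, ← p, ← p] at hΛ
  have f1 := Nat.lt_floor_add_one (v+H)
  have f2 := Nat.floor_le (a := v+Δ) (by linarith)
  have f3 := Nat.floor_le (a := v+H+Δ) (by linarith)
  have f4 := Nat.lt_floor_add_one v
  constructor
  · have := mul_le_mul_of_nonneg_left (by linarith : H - Δ - 1 ≤ (⌊v+H⌋₊:ℝ) - ⌊v+Δ⌋₊) hΔ.le
    refine le_of_mul_le_mul_left ?_ hΔ
    linarith [hΛ.2, h1.1, h.1]
  · have := mul_le_mul_of_nonneg_left (by linarith : (⌊v+H+Δ⌋₊:ℝ) - ⌊v⌋₊ ≤ H + Δ + 1) hΔ.le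
    refine le_of_mul_le_mul_left ?_ hΔ
    linarith [hΛ.1, h1.2, h.2]

theorem SSN_4 {δ : ℝ} (hδ : 0 < δ) : ∃ m0 : ℝ, 1 ≤ m0 ∧ ∀ μ y h : ℝ, m0 ≤ μ → y = Real.exp (μ^5) → y * Real.exp (-μ^3) ≤ h → h ≤ y/2 →
    |Chebyshev.psi (y+h) - Chebyshev.psi y - h| ≤ δ * h := by
  set κ := min (δ/8) (1/8) with hκ
  have hκ0 : 0 < κ := by positivity
  have hκ1 : κ ≤ δ/8 := min_le_left _ _
  have hκ2 : κ ≤ 1/8 := min_le_right _ _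
  obtain ⟨m1, hm1, H1⟩ := SSN_1 hκ0
  obtain ⟨m2, hm2, H2⟩ := SSN_0 0 (a := 1) (by norm_num) hκ0
  refine ⟨max m1 (max m2 10), hm1.trans (le_max_left _ _), ?_⟩
  intro μ y h hμ hy hh1 hh2
  have hμ1 : m1 ≤ μ := (le_max_left _ _).trans hμ
  have hμ10 : 10 ≤ μ := ((le_max_right _ _).trans (le_max_right _ _)).trans hμ
  have a2 := H2 μ (((le_max_left _ _).trans (le_max_right _ _)).trans hμ)
  rw [pow_zero, one_mul] at a2
  have hμ3 : μ ≤ μ^3 := le_self_pow₀ (by linarith) (by norm_num)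
  have hμ5 : 2*μ^3 ≤ μ^5 := by
    have h60 : (10:ℝ)^2 ≤ μ^2 := pow_le_pow_left₀ (by norm_num) hμ10 2
    have hp3 : 0 < μ^3 := pow_pos (by linarith) 3
    calc 2*μ^3 ≤ 10^2 * μ^3 := by linarith
      _ ≤ μ^2 * μ^3 := mul_le_mul_of_nonneg_right h60 hp3.le
      _ = μ^5 := by ring
  have hy0 : 0 < y := by rw [hy]; exact Real.exp_pos _
  have hh0 : 0 < h := lt_of_lt_of_le (by positivity) hh1
  have e3 : Real.exp (-μ^3) ≤ κ := le_trans (Real.exp_le_exp.mpr (by linarith)) a2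
  have hΔ : y * Real.exp (-2*μ^3) ≤ κ * h := by
    have : Real.exp (-2*μ^3) = Real.exp (-μ^3) * Real.exp (-μ^3) := by rw [← Real.exp_add]; ring_nf
    rw [this]
    calc y * (Real.exp (-μ^3) * Real.exp (-μ^3)) = Real.exp (-μ^3) * (y * Real.exp (-μ^3)) := by ring
      _ ≤ κ * h := by gcongr
  have hone : 1 ≤ κ * h := by
    refine le_trans ?_ hΔ
    rw [hy, ← Real.exp_add]
    exact Real.one_le_exp (by linarith)
  have hκh : κ * h ≤ h/8 := (mul_le_mul_of_nonneg_right hκ2 hh0.le).trans (by linarith)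
  have hκδ : κ * h ≤ δ/8*h := by gcongr
  obtain ⟨M, hM⟩ := exists_nat_ge (3*y)
  have lo := SSN_3 (η := κ) (v := y) (H := h - κ*h) (Δ := κ*h) (M := M) hy0.le (by positivity) (by linarith) (by linarith)
    (H1 μ y y (h-κ*h) (κ*h) M hμ1 hy (by linarith) le_rfl hΔ (by linarith) (by linarith) (by linarith))
  have up := SSN_3 (η := κ) (v := y - κ*h) (H := h + κ*h) (Δ := κ*h) (M := M) (by linarith) (by positivity) (by linarith) (by linarith)
    (H1 μ y (y-κ*h) (h+κ*h) (κ*h) M hμ1 hy (by linarith) (by linarith) hΔ (by linarith) (by linarith) (by linarith))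
  have l := lo.1
  have u := up.2
  rw [show y + (h-κ*h) + κ*h = y + h by ring] at l
  rw [show y - κ*h + (h+κ*h) = y + h by ring, show y - κ*h + κ*h = y by ring] at u
  have q : κ*(h-κ*h) ≤ κ*h := by linarith [mul_pos hκ0 (mul_pos hκ0 hh0)]
  have q2 : κ*(h+κ*h) ≤ 2*(κ*h) := by linarith [mul_pos hκ0 hh0, mul_le_mul_of_nonneg_left hκh hκ0.le]
  rw [abs_le]
  constructor <;> linarith

end

section
open Set Filter Topology MeasureTheory

noncomputable def SSP (x : ℝ) : ℝ := (((Finset.Ioc 0 ⌊x⌋₊).filter Nat.Prime).card : ℝ)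

noncomputable def SSG (y : ℝ) : ℝ := y * Real.exp (-(Real.log y)^((3:ℝ)/5))

theorem SSP_1 {a b : ℝ} (ha : 1 < a) (hab : a ≤ b) : SSP a ≤ SSP b ∧
    (SSP b - SSP a) * Real.log a ≤ Chebyshev.theta b - Chebyshev.theta a ∧
    Chebyshev.theta b - Chebyshev.theta a ≤ (SSP b - SSP a) * Real.log b := by
  have hfl : ⌊a⌋₊ ≤ ⌊b⌋₊ := Nat.floor_le_floor hab
  have e1 : SSP b - SSP a = ∑ n ∈ Finset.Ioc ⌊a⌋₊ ⌊b⌋₊, if n.Prime then (1:ℝ) else 0 := by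
    unfold SSP
    rw [Finset.card_filter, Finset.card_filter]
    push_cast
    rw [← Finset.sum_Ioc_consecutive _ (Nat.zero_le _) hfl]; ring
  have e2 : Chebyshev.theta b - Chebyshev.theta a = ∑ n ∈ Finset.Ioc ⌊a⌋₊ ⌊b⌋₊, if n.Prime then Real.log n else 0 := by
    unfold Chebyshev.theta
    rw [Finset.sum_filter, Finset.sum_filter, ← Finset.sum_Ioc_consecutive _ (Nat.zero_le _) hfl]; ring
  have hpos : 0 ≤ SSP b - SSP a := by
    rw [e1]; exact Finset.sum_nonneg (fun n _ => by split_ifs <;> norm_num)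
  refine ⟨by linarith, ?_, ?_⟩
  · rw [e1, e2, Finset.sum_mul]
    refine Finset.sum_le_sum (fun n hn => ?_)
    split_ifs
    · rw [one_mul]
      have := (Nat.floor_lt (by linarith)).mp (Finset.mem_Ioc.mp hn).1
      exact Real.log_le_log (by linarith) this.le
    · simp
  · rw [e1, e2, Finset.sum_mul]
    refine Finset.sum_le_sum (fun n hn => ?_)
    split_ifs
    · rw [one_mul]
      have h1 := (Nat.floor_lt (by linarith)).mp (Finset.mem_Ioc.mp hn).1
      have := (Nat.le_floor_iff (by linarith)).mp (Finset.mem_Ioc.mp hn).2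
      exact Real.log_le_log (by linarith) this
    · simp

theorem SSP_ii {a b : ℝ} (ha : 1 < a) (hb : 1 < b) : IntervalIntegrable (fun t => 1/Real.log t) volume a b := by
  apply ContinuousOn.intervalIntegrable
  intro t ht
  have h1 : 1 < t := lt_of_lt_of_le (lt_min ha hb) ht.1
  have h2 : Real.log t ≠ 0 := (Real.log_pos h1).ne'
  have h3 : ContinuousAt Real.log t := Real.continuousAt_log (by linarith)
  exact (continuousAt_const.div h3 h2).continuousWithinAt

theorem SSP_2 {a b : ℝ} (ha : 1 < a) (hab : a ≤ b) :
    b - a ≤ (∫ t in a..b, 1/Real.log t) * Real.log b ∧ (∫ t in a..b, 1/Real.log t) * Real.log a ≤ b - a := by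
  have hi := SSP_ii ha (by linarith : 1 < b)
  have la := Real.log_pos ha
  have lb := Real.log_pos (by linarith : 1 < b)
  have c1 : ∫ t in a..b, 1/Real.log b = (b-a) / Real.log b := by simp [div_eq_mul_inv]
  have c2 : ∫ t in a..b, 1/Real.log a = (b-a) / Real.log a := by simp [div_eq_mul_inv]
  constructor
  · rw [← div_le_iff₀ lb, ← c1]
    refine intervalIntegral.integral_mono_on hab (by simp) hi (fun t ht => ?_)
    have : 0 < Real.log t := Real.log_pos (by linarith [ht.1])
    exact one_div_le_one_div_of_le this (Real.log_le_log (by linarith [ht.1]) ht.2)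
  · rw [← le_div_iff₀ la, ← c2]
    refine intervalIntegral.integral_mono_on hab hi (by simp) (fun t ht => ?_)
    exact one_div_le_one_div_of_le la (Real.log_le_log (by linarith) ht.1)

theorem SSP_alg {κ δ l l' D J h : ℝ} (hκ0 : 0 < κ) (hκ1 : κ ≤ δ/5) (hκ2 : κ ≤ 1/5) (hlpos : 0 < l) (hll : l ≤ l') (hl'k : l' ≤ (1+κ)*l)
    (hD0 : 0 ≤ D) (hh : 0 < h) (T1 : D * l ≤ (1+2*κ)*h) (T2 : (1-2*κ)*h ≤ D * l') (i1 : h ≤ J * l') (i2 : J * l ≤ h) : |D - J| ≤ δ * J := by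
  have hJp : 0 < J := by
    have : 0 < J * l' := by linarith
    exact pos_of_mul_pos_left this (by linarith)
  have hJ0 : 0 ≤ J := hJp.le
  have hδJ : 0 < δ * J := mul_pos (by linarith) hJp
  have U : D ≤ (1+2*κ)*((1+κ)*J) := by
    refine le_of_mul_le_mul_right ?_ hlpos
    calc D * l ≤ (1+2*κ)*h := T1
      _ ≤ (1+2*κ)*(J*((1+κ)*l)) := by gcongr; exact i1.trans (by gcongr)
      _ = _ := by ring
  have V : (1-2*κ)*J ≤ D*(1+κ) := by
    refine le_of_mul_le_mul_right ?_ hlpos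
    calc (1-2*κ)*J*l = (1-2*κ)*(J*l) := by ring
      _ ≤ (1-2*κ)*h := by apply mul_le_mul_of_nonneg_left i2; linarith
      _ ≤ D*l' := T2
      _ ≤ D*((1+κ)*l) := by gcongr
      _ = _ := by ring
  have W1 : κ*J ≤ δ/5*J := by gcongr
  have W2 : κ*(κ*J) ≤ 1/5*(κ*J) := by gcongr
  have W0 : 0 ≤ κ*J := by positivity
  rw [abs_le]
  constructor
  · by_contra hc
    push Not at hc
    have : D*(1+κ) ≤ (J - δ*J)*(1+κ) := by gcongr; linarith
    linarith [mul_pos hκ0 hδJ]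
  · linarith

set_option maxHeartbeats 800000 in
theorem SSP_cell {δ : ℝ} (hδ : 0 < δ) : ∃ y0 : ℝ, 2 ≤ y0 ∧ ∀ y h : ℝ, y0 ≤ y → SSG y ≤ h → h ≤ y/2 →
    |SSP (y+h) - SSP y - ∫ t in y..(y+h), 1/Real.log t| ≤ δ * ∫ t in y..(y+h), 1/Real.log t := by
  set κ := min (δ/5) (1/5) with hκ
  have hκ0 : 0 < κ := by positivity
  have hκ1 : κ ≤ δ/5 := min_le_left _ _
  have hκ2 : κ ≤ 1/5 := min_le_right _ _
  obtain ⟨m1, hm1, H1⟩ := SSN_4 hκ0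
  obtain ⟨m2, hm2, H2⟩ := SSN_0 5 (a := 1) (by norm_num) (by positivity : 0 < κ/8)
  set m := max (max m1 m2) (max 2 (1/κ)) with hm
  have hmm1 : m1 ≤ m := (le_max_left _ _).trans (le_max_left _ _)
  have hmm2 : m2 ≤ m := (le_max_right _ _).trans (le_max_left _ _)
  have hmm3 : 2 ≤ m := (le_max_left _ _).trans (le_max_right _ _)
  have hmm4 : 1/κ ≤ m := (le_max_right _ _).trans (le_max_right _ _)
  refine ⟨Real.exp (m^5), ?_, ?_⟩
  · have := Real.add_one_le_exp (m^5)
    have : (1:ℝ) ≤ m^5 := one_le_pow₀ (by linarith)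
    linarith
  intro y h hy hh1 hh2
  have hy0 : 0 < y := lt_of_lt_of_le (Real.exp_pos _) hy
  have hlog : m^5 ≤ Real.log y := by rw [← Real.log_exp (m^5)]; exact Real.log_le_log (Real.exp_pos _) hy
  have hl0 : 0 ≤ Real.log y := le_trans (by positivity) hlog
  set μ := (Real.log y)^((1:ℝ)/5) with hμd
  have hμ5 : μ^5 = Real.log y := by
    rw [hμd, ← Real.rpow_natCast, ← Real.rpow_mul hl0]; norm_num
  have hμ3 : (Real.log y)^((3:ℝ)/5) = μ^3 := by
    rw [hμd, ← Real.rpow_natCast, ← Real.rpow_mul hl0]; norm_num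
  have hμ0 : 0 ≤ μ := Real.rpow_nonneg hl0 _
  have hmμ : m ≤ μ := by
    by_contra hc
    push Not at hc
    have := pow_lt_pow_left₀ hc hμ0 (n := 5) (by norm_num)
    linarith
  have hyμ : y = Real.exp (μ^5) := by rw [hμ5, Real.exp_log hy0]
  unfold SSG at hh1
  rw [hμ3] at hh1
  have hμ2 : 2 ≤ μ := hmm3.trans hmμ
  have A := H1 μ y h (hmm1.trans hmμ) hyμ hh1 hh2
  have B := H2 μ (hmm2.trans hmμ)
  have hμ5l : 1/κ ≤ μ^5 := by
    refine (hmm4.trans hmμ).trans ?_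
    calc μ = μ^1 := (pow_one _).symm
      _ ≤ μ^5 := pow_le_pow_right₀ (by linarith) (by norm_num)
  have hy2 : 4 ≤ y := by
    rw [hyμ]
    have := Real.add_one_le_exp (μ^5)
    have : (2:ℝ)^5 ≤ μ^5 := by gcongr
    linarith
  have hh0 : 0 < h := lt_of_lt_of_le (by positivity) hh1
  -- prime powers
  have C : 2 * √(y+h) * Real.log (y+h) ≤ κ * h := by
    have s1 : √(y+h) ≤ 2 * Real.exp (μ^5/2) := by
      rw [Real.sqrt_le_left (by positivity), mul_pow, ← Real.exp_nat_mul]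
      have : Real.exp ((2:ℕ) * (μ^5/2)) = y := by rw [hyμ]; congr 1; push_cast; ring
      rw [this]; linarith
    have s2 : Real.log (y+h) ≤ 2 * μ^5 := by
      have : Real.log (y+h) ≤ Real.log (y^2) := Real.log_le_log (by linarith)
        (by have := mul_le_mul_of_nonneg_right hy2 hy0.le; rw [sq]; linarith)
      rw [Real.log_pow] at this
      push_cast at this
      linarith
    have l0 : 0 ≤ Real.log (y+h) := Real.log_nonneg (by linarith)
    have hx : Real.exp (μ^5/2) = y * Real.exp (-μ^3) * Real.exp (-(μ^5/2 - μ^3)) := by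
      rw [hyμ, ← Real.exp_add, ← Real.exp_add]; congr 1; ring
    have hge : μ ≤ μ^5/2 - μ^3 := by
      have h4 : 4 ≤ μ^2 := le_trans (by norm_num) (pow_le_pow_left₀ (by norm_num) hμ2 2)
      have h5 : μ^5 = μ^3*μ^2 := by ring
      have h6 : μ^3 = μ*μ^2 := by ring
      have h7 : 4*μ ≤ μ^3 := by rw [h6]; linarith [mul_le_mul_of_nonneg_left h4 hμ0]
      have h8 : 4*μ^3 ≤ μ^5 := by rw [h5]; linarith [mul_le_mul_of_nonneg_left h4 (pow_nonneg hμ0 3)]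
      linarith
    calc 2 * √(y+h) * Real.log (y+h) ≤ 2 * (2 * Real.exp (μ^5/2)) * (2*μ^5) := by gcongr
      _ = y * Real.exp (-μ^3) * (8 * (μ^5 * Real.exp (-(μ^5/2 - μ^3)))) := by rw [hx]; ring
      _ ≤ h * (8 * (μ^5 * Real.exp (-1*μ))) := by
          gcongr
          linarith
      _ ≤ h * (8 * (κ/8)) := by gcongr
      _ = κ * h := by ring
  have d1 := Chebyshev.theta_le_psi y
  have d2 := Chebyshev.theta_le_psi (y+h)
  have d3 := Chebyshev.psi_sub_theta_le (x := y+h) (by linarith)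
  have d4 : Chebyshev.psi y - Chebyshev.theta y ≤ κ*h := by
    refine le_trans (Chebyshev.psi_sub_theta_le (x := y) (by linarith)) (le_trans ?_ C)
    have : 0 ≤ Real.log y := hl0
    gcongr <;> linarith
  obtain ⟨g0, g1, g2⟩ := SSP_1 (a := y) (b := y+h) (by linarith) (by linarith)
  obtain ⟨i1, i2⟩ := SSP_2 (a := y) (b := y+h) (by linarith) (by linarith)
  set D := SSP (y+h) - SSP y with hD
  set J := ∫ t in y..(y+h), 1/Real.log t with hJ
  set l := Real.log y with hl
  set l' := Real.log (y+h) with hl'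
  have hl1 : 1 ≤ κ * l := by
    rw [← hμ5]; rw [div_le_iff₀ hκ0] at hμ5l; linarith
  have hlpos : 0 < l := pos_of_mul_pos_right (lt_of_lt_of_le one_pos hl1) hκ0.le
  have hll : l ≤ l' := Real.log_le_log hy0 (by linarith)
  have hll2 : l' ≤ l + 1 := by
    have : l' ≤ Real.log (y * Real.exp 1) := Real.log_le_log (by linarith) (by
      have h2 : 2 ≤ Real.exp 1 := by linarith [Real.add_one_le_exp (1:ℝ)]
      calc y + h ≤ y * 2 := by linarith
        _ ≤ _ := by gcongr)
    rwa [Real.log_mul hy0.ne' (Real.exp_pos _).ne', Real.log_exp] at this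
  rw [show y + h - y = h by ring] at i1 i2
  rw [abs_le] at A
  exact SSP_alg hκ0 hκ1 hκ2 hlpos hll (by linarith) (by linarith) hh0 (by linarith) (by linarith) i1 i2

end

section
open Set Filter Topology MeasureTheory

theorem SSQ_G {A : ℝ} (hA : 0 < A) : ∃ y0 : ℝ, 2 ≤ y0 ∧ ∀ y, y0 ≤ y → SSG y ≤ y * A ∧ 1/A ≤ Real.log y := by
  have h1 : Tendsto (fun y : ℝ => (Real.log y)^((3:ℝ)/5)) atTop atTop := (tendsto_rpow_atTop (by norm_num)).comp Real.tendsto_log_atTop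
  have h2 : Tendsto (fun y : ℝ => Real.exp (-(Real.log y)^((3:ℝ)/5))) atTop (𝓝 0) := Real.tendsto_exp_neg_atTop_nhds_zero.comp h1
  obtain ⟨a, ha⟩ := eventually_atTop.mp (h2.eventually (ge_mem_nhds hA))
  obtain ⟨b, hb⟩ := eventually_atTop.mp (Real.tendsto_log_atTop.eventually_ge_atTop (1/A))
  refine ⟨max 2 (max a b), le_max_left _ _, fun y hy => ?_⟩
  have y2 : 2 ≤ y := (le_max_left _ _).trans hy
  refine ⟨?_, hb y (((le_max_right _ _).trans (le_max_right _ _)).trans hy)⟩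
  unfold SSG
  have := ha y (((le_max_left _ _).trans (le_max_right _ _)).trans hy)
  gcongr

theorem SSQ_main {δ : ℝ} (hδ : 0 < δ) : ∃ y0 : ℝ, 2 ≤ y0 ∧ ∀ y t : ℝ, y0 ≤ y → y ≤ t →
    |SSP t - SSP y - ∫ u in y..t, 1/Real.log u| ≤ δ * ((∫ u in y..t, 1/Real.log u) + SSG y) := by
  obtain ⟨ya, hya, hcell⟩ := SSP_cell (lt_min hδ one_pos)
  obtain ⟨yb, hyb, hG⟩ := SSQ_G (lt_min (by norm_num : (0:ℝ) < 1/5) (by positivity : 0 < δ/2))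
  refine ⟨max ya yb, hya.trans (le_max_left _ _), ?_⟩
  have big : ∀ n : ℕ, ∀ y t : ℝ, max ya yb ≤ y → y + SSG y ≤ t → t ≤ y * (5/4)^n →
      |SSP t - SSP y - ∫ u in y..t, 1/Real.log u| ≤ min δ 1 * ∫ u in y..t, 1/Real.log u := by
    intro n
    induction n with
    | zero =>
      intro y t hy h1 h2
      have hy2 : 2 ≤ y := hya.trans ((le_max_left _ _).trans hy)
      have : 0 < SSG y := by unfold SSG; positivity
      simp at h2; linarith
    | succ n ih =>
      intro y t hy h1 h2
      have hyA : ya ≤ y := (le_max_left _ _).trans hy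
      have hyB : yb ≤ y := (le_max_right _ _).trans hy
      have hy2 : 2 ≤ y := hya.trans hyA
      have g1 : ∀ y', y ≤ y' → SSG y' ≤ y'/5 := fun y' h => by
        have := (hG y' (hyB.trans h)).1
        have h5 : y' * min (1/5) (δ/2) ≤ y' * (1/5) := mul_le_mul_of_nonneg_left (min_le_left _ _) (by linarith)
        linarith
      by_cases hc : t ≤ y + y/2
      · have := hcell y (t-y) hyA (by linarith) (by linarith)
        rwa [show y + (t-y) = t by ring] at this
      · push Not at hc
        have c1 := hcell y (y/4) hyA (by linarith [g1 y le_rfl]) (by linarith)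
        have c2 := ih (y+y/4) t (by linarith) (by linarith [g1 (y+y/4) (by linarith)]) (by rw [pow_succ] at h2; linarith)
        have e := intervalIntegral.integral_add_adjacent_intervals (SSP_ii (a := y) (b := y+y/4) (by linarith) (by linarith)) (SSP_ii (a := y+y/4) (b := t) (by linarith) (by linarith))
        rw [← e]
        rw [abs_le] at c1 c2 ⊢
        constructor <;> linarith [c1.1, c1.2, c2.1, c2.2]
  intro y t hy hyt
  have hyA : ya ≤ y := (le_max_left _ _).trans hy
  have hyB : yb ≤ y := (le_max_right _ _).trans hy
  have hy2 : 2 ≤ y := hya.trans hyA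
  have hG0 : 0 < SSG y := by unfold SSG; positivity
  have hJ0 : 0 ≤ ∫ u in y..t, 1/Real.log u := intervalIntegral.integral_nonneg hyt (fun u hu => by
    have := Real.log_pos (by linarith [hu.1] : 1 < u); positivity)
  by_cases hc : y + SSG y ≤ t
  · obtain ⟨n, hn⟩ := pow_unbounded_of_one_lt (t/y) (by norm_num : (1:ℝ) < 5/4)
    rw [div_lt_iff₀ (by linarith)] at hn
    have := big n y t hy hc (by linarith)
    refine this.trans ?_
    gcongr
    · exact min_le_left _ _
    · linarith
  · push Not at hc
    obtain ⟨g1, g2⟩ := hG y hyB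
    have hm1 : min (1/5) (δ/2) ≤ 1/5 := min_le_left _ _
    have hm2 : min (1/5) (δ/2) ≤ δ/2 := min_le_right _ _
    have hm0 : 0 < min (1/5) (δ/2) := lt_min (by norm_num) (by positivity)
    have g3 : SSG y ≤ y/2 := by linarith [mul_le_mul_of_nonneg_left hm1 (by linarith : 0 ≤ y)]
    have c := hcell y (SSG y) hyA le_rfl g3
    have p1 := (SSP_1 (a := y) (b := t) (by linarith) hyt).1
    have p2 := (SSP_1 (a := t) (b := y + SSG y) (by linarith) hc.le).1
    have i1 := (SSP_2 (a := y) (b := t) (by linarith) hyt).2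
    have i2 := (SSP_2 (a := y) (b := y + SSG y) (by linarith) (by linarith)).2
    have hJ0' : 0 ≤ ∫ u in y..(y+SSG y), 1/Real.log u := intervalIntegral.integral_nonneg (by linarith) (fun u hu => by
      have := Real.log_pos (by linarith [hu.1] : 1 < u); positivity)
    set J := ∫ u in y..t, 1/Real.log u
    set J' := ∫ u in y..(y+SSG y), 1/Real.log u
    have hl : 0 < Real.log y := Real.log_pos (by linarith)
    have hlm : 1 ≤ Real.log y * (δ/2) := by
      rw [div_le_iff₀ hm0] at g2
      linarith [mul_le_mul_of_nonneg_left hm2 hl.le]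
    have hG0 : 0 ≤ SSG y := by unfold SSG; exact mul_nonneg (by linarith) (Real.exp_pos _).le
    have hlm2 := mul_le_mul_of_nonneg_right hlm hG0
    have k1 : J' ≤ δ/2 * SSG y := by
      refine le_of_mul_le_mul_right ?_ hl
      linarith
    have k2 : J ≤ δ/2 * SSG y := by
      refine le_of_mul_le_mul_right ?_ hl
      linarith
    have k3 : min δ 1 * J' ≤ 1 * J' := by gcongr; exact min_le_right _ _
    have k4 : 0 ≤ δ * J := by positivity
    rw [abs_le] at c ⊢
    constructor <;> linarith [c.1, c.2]

end

section
open Set Filter Topology MeasureTheory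



open Classical in
noncomputable def SSV (x y : ℝ) : Finset ℕ :=
  (Finset.Ioc 0 ⌊x⌋₊).filter (fun n => ∀ p : ℕ, p.Prime → p ∣ n → (p : ℝ) ≤ y)

theorem SSV_mem {x y : ℝ} (hx : 0 ≤ x) {n : ℕ} : n ∈ SSV x y ↔ 0 < n ∧ (n:ℝ) ≤ x ∧ ∀ p : ℕ, p.Prime → p ∣ n → (p : ℝ) ≤ y := by
  classical
  unfold SSV
  simp only [Finset.mem_filter, Finset.mem_Ioc, Nat.le_floor_iff hx, and_assoc]

theorem SSV_card {x y : ℝ} (hx : 0 ≤ x) : smoothCount x y = (SSV x y).card := by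
  unfold smoothCount
  rw [Nat.subtype_card (SSV x y) (fun n => SSV_mem hx)]

theorem SSU_pi {y : ℝ} (hy : 10 ≤ y) : y / 4 ≤ SSP y * Real.log y := by
  have h1 := Chebyshev.psi_le_primeCounting_mul_log' y
  have h2 := Chebyshev.psi_ge' (x := y) (by linarith)
  have e : ((Nat.primeCounting ⌊y⌋₊ : ℕ) : ℝ) = SSP y := by
    unfold SSP
    congr 1
    rw [Nat.primeCounting, Nat.primeCounting', Nat.count_eq_card_filter_range]
    congr 1
    ext n
    simp only [Finset.mem_filter, Finset.mem_range, Finset.mem_Ioc]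
    constructor
    · rintro ⟨h, hp⟩; exact ⟨⟨hp.pos, by omega⟩, hp⟩
    · rintro ⟨h, hp⟩; exact ⟨by omega, hp⟩
  rw [e] at h1
  have l2 := Real.log_two_gt_d9
  have l2' := Real.log_two_lt_d9
  have h3 : Real.log (y+2) ≤ 3 * Real.log 2 + ((y+2)/8 - 1) := by
    have : y + 2 = 2^3 * ((y+2)/8) := by ring
    rw [this, Real.log_mul (by norm_num) (by positivity), Real.log_pow]
    have := Real.log_le_sub_one_of_pos (by positivity : 0 < (y+2)/8)
    push_cast
    have e8 : 2^3 * ((y+2)/8) / 8 = (y+2)/8 := by ring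
    rw [e8]
    linarith
  nlinarith

theorem SSU_om {n : ℕ} {x : ℝ} (hn : 0 < n) (hx : (n:ℝ) ≤ x) (hx1 : 1 ≤ x) : n.primeFactors.card ≤ ⌊2 * Real.log x⌋₊ := by
  have h1 : 2 ^ n.primeFactors.card ≤ n := by
    refine le_trans (Finset.pow_card_le_prod _ _ 2 (fun p hp => (Nat.prime_of_mem_primeFactors hp).two_le)) ?_
    exact Nat.le_of_dvd hn (Nat.prod_primeFactors_dvd n)
  have h2 : (2:ℝ)^n.primeFactors.card ≤ x := le_trans (by exact_mod_cast h1) hx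
  have h3 := Real.log_le_log (by positivity) h2
  rw [Real.log_pow] at h3
  rw [Nat.le_floor_iff (by have := Real.log_nonneg hx1; positivity)]
  have := Real.log_two_gt_d9
  have h4 : (0:ℝ) ≤ n.primeFactors.card := by positivity
  nlinarith

theorem SSU_ct {x y : ℝ} (hy : 10 ≤ y) (hxy : y ≤ x) : (SSV (x/y) y).card * SSP y ≤ 2 * Real.log x * (SSV x y).card := by
  have hx0 : 0 ≤ x := by linarith
  have hlx := Real.log_nonneg (by linarith : 1 ≤ x)
  have hxy0 : 0 ≤ x/y := by positivity
  have h := Finset.card_le_mul_card_image_of_maps_to (s := SSV (x/y) y ×ˢ (Finset.Ioc 0 ⌊y⌋₊).filter Nat.Prime) (t := SSV x y)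
    (f := fun a => a.1 * a.2) (by
      rintro ⟨m, p⟩ h
      rw [Finset.mem_product, SSV_mem hxy0, Finset.mem_filter, Finset.mem_Ioc, Nat.le_floor_iff (by linarith)] at h
      obtain ⟨⟨h1, h2, h3⟩, ⟨h4, h5⟩, h6⟩ := h
      simp only at h1 h2 h3 h4 h5 h6
      rw [SSV_mem hx0]
      refine ⟨Nat.mul_pos h1 h4, ?_, ?_⟩
      · push_cast
        rw [le_div_iff₀ (by linarith)] at h2
        refine le_trans ?_ h2
        gcongr
      · intro q hq hd
        rcases (Nat.Prime.dvd_mul hq).mp hd with hd | hd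
        · exact h3 q hq hd
        · rw [(Nat.prime_dvd_prime_iff_eq hq h6).mp hd]; exact h5) ⌊2 * Real.log x⌋₊ (by
      intro n hn
      rw [SSV_mem hx0] at hn
      refine le_trans ?_ (SSU_om hn.1 hn.2.1 (by linarith))
      refine Finset.card_le_card_of_injOn (fun a => a.2) ?_ ?_
      · rintro ⟨m, p⟩ h
        simp only [Finset.coe_filter, Finset.mem_product, Finset.mem_filter, mem_setOf_eq] at h
        simp only [Finset.mem_coe, Nat.mem_primeFactors]
        exact ⟨h.1.2.2, ⟨m, by rw [← h.2]; ring⟩, hn.1.ne'⟩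
      · rintro ⟨m, p⟩ h ⟨m', p'⟩ h' hpp
        simp only [Finset.coe_filter, Finset.mem_product, Finset.mem_filter, mem_setOf_eq] at h h' hpp
        subst hpp
        have := h.2.trans h'.2.symm
        have := Nat.eq_of_mul_eq_mul_right h.1.2.2.pos this
        rw [this])
  rw [Finset.card_product] at h
  have h' : ((SSV (x/y) y).card : ℝ) * SSP y ≤ (⌊2 * Real.log x⌋₊ : ℝ) * (SSV x y).card := by
    unfold SSP; exact_mod_cast h
  refine h'.trans ?_
  gcongr
  exact Nat.floor_le (by positivity)

theorem SSU_small {ε : ℝ} (hε0 : 0 < ε) (hε : ε < 3/5) : ∃ y0 : ℝ, 10 ≤ y0 ∧ ∀ x y : ℝ, y0 ≤ y → y ≤ x →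
    Real.log x / Real.log y ≤ Real.exp ((Real.log y) ^ ((3 : ℝ) / 5 - ε)) → (SSV (x/y) y).card * SSG y ≤ (SSV x y).card := by
  obtain ⟨w0, hw0, hw⟩ := SSN_0 4 (a := 1/2) (by norm_num) (by norm_num : (0:ℝ) < 1/8)
  have t1 : Tendsto (fun y : ℝ => (Real.log y)^((3:ℝ)/5)) atTop atTop := (tendsto_rpow_atTop (by norm_num)).comp Real.tendsto_log_atTop
  have t2 : Tendsto (fun y : ℝ => (Real.log y)^ε) atTop atTop := (tendsto_rpow_atTop hε0).comp Real.tendsto_log_atTop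
  obtain ⟨y1, h1⟩ := eventually_atTop.mp ((t1.eventually_ge_atTop w0).and (t2.eventually_ge_atTop 2))
  refine ⟨max 10 y1, le_max_left _ _, ?_⟩
  intro x y hy hxy hu
  have hy10 : 10 ≤ y := (le_max_left _ _).trans hy
  obtain ⟨a1, a2⟩ := h1 y ((le_max_right _ _).trans hy)
  have hlpos : 0 < Real.log y := Real.log_pos (by linarith)
  have ct := SSU_ct hy10 hxy
  have hpi := SSU_pi hy10
  have b := hw _ a1
  set l := Real.log y with hl
  set w := l^((3:ℝ)/5) with hwd
  have hw1 : 1 ≤ w := hw0.trans a1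
  have e1 : l^((3:ℝ)/5 - ε) ≤ w/2 := by
    rw [Real.rpow_sub hlpos]
    gcongr
  have e2 : l^2 ≤ w^4 := by
    rw [hwd, ← Real.rpow_natCast, ← Real.rpow_natCast, ← Real.rpow_mul hlpos.le]
    apply Real.rpow_le_rpow_of_exponent_le _ (by norm_num)
    by_contra hc
    push Not at hc
    have := Real.rpow_lt_one hlpos.le hc (by norm_num : (0:ℝ) < 3/5)
    linarith
  have e3 : Real.log x ≤ Real.exp (w/2) * l := by
    rw [div_le_iff₀ hlpos] at hu
    refine hu.trans ?_
    gcongr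
  have hSG : SSG y = y * Real.exp (-w) := rfl
  set A : ℝ := ((SSV (x/y) y).card : ℝ) with hAd
  set B : ℝ := ((SSV x y).card : ℝ) with hBd
  have hA : 0 ≤ A := by positivity
  have hB : 0 ≤ B := by positivity
  have k1 : A * (y/4) ≤ 2 * (Real.exp (w/2) * l) * B * l := by
    calc A * (y/4) ≤ A * (SSP y * l) := by gcongr
      _ = A * SSP y * l := by ring
      _ ≤ 2 * Real.log x * B * l := by gcongr
      _ ≤ _ := by gcongr
  have ew : Real.exp (w/2) * Real.exp (-w) = Real.exp (-(1/2)*w) := by rw [← Real.exp_add]; ring_nf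
  calc A * SSG y = 4 * (A * (y/4)) * Real.exp (-w) := by rw [hSG]; ring
    _ ≤ 4 * (2 * (Real.exp (w/2) * l) * B * l) * Real.exp (-w) := by gcongr
    _ = 8 * B * (l^2 * (Real.exp (w/2) * Real.exp (-w))) := by ring
    _ ≤ 8 * B * (w^4 * Real.exp (-(1/2)*w)) := by rw [ew]; gcongr
    _ ≤ 8 * B * (1/8) := by gcongr
    _ = B := by ring

end

section
open Set Filter Topology MeasureTheory

noncomputable def SSXq (y b : ℝ) : Finset ℕ := (Finset.Ioc ⌊y⌋₊ ⌊b⌋₊).filter Nat.Prime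

theorem SSXq_card {y b : ℝ} (hab : y ≤ b) : ((SSXq y b).card : ℝ) = SSP b - SSP y := by
  have hfl : ⌊y⌋₊ ≤ ⌊b⌋₊ := Nat.floor_le_floor hab
  unfold SSP SSXq
  rw [Finset.card_filter, Finset.card_filter, Finset.card_filter]
  push_cast
  rw [← Finset.sum_Ioc_consecutive _ (Nat.zero_le _) hfl]; ring

theorem SSXq_mem {y b : ℝ} (hy : 0 ≤ y) (hb : 0 ≤ b) {p : ℕ} : p ∈ SSXq y b ↔ y < p ∧ (p:ℝ) ≤ b ∧ p.Prime := by
  unfold SSXq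
  simp only [Finset.mem_filter, Finset.mem_Ioc, Nat.le_floor_iff hb, Nat.floor_lt hy, and_assoc]

theorem SSX_count {x y z : ℝ} (hy : 2 ≤ y) (hyz : y ≤ z) (hzx : z ≤ x) :
    (semismoothCount x y z : ℝ) = (SSV x y).card + ∑ m ∈ SSV (x/y) y, (SSP (min z (x/m)) - SSP y) := by
  classical
  have hx0 : 0 ≤ x := by linarith
  have hxy0 : 0 ≤ x / y := by positivity
  have hmb : ∀ m ∈ SSV (x/y) y, y ≤ min z (x/m) := by
    intro m hm
    obtain ⟨m0, m1, _⟩ := (SSV_mem hxy0).mp hm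
    have m0' : (0:ℝ) < m := by exact_mod_cast m0
    refine le_min hyz ?_
    rw [le_div_iff₀ m0']
    rw [le_div_iff₀ (by linarith)] at m1
    linarith
  set T : Finset (Σ _ : ℕ, ℕ) := (SSV (x/y) y).sigma (fun m => SSXq y (min z (x/m))) with hT
  have hTmem : ∀ a : (Σ _ : ℕ, ℕ), a ∈ T ↔ (0 < a.1 ∧ (a.1:ℝ) ≤ x/y ∧ ∀ q : ℕ, q.Prime → q ∣ a.1 → (q : ℝ) ≤ y) ∧
      y < a.2 ∧ (a.2:ℝ) ≤ min z (x/a.1) ∧ a.2.Prime := by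
    intro a
    rw [hT, Finset.mem_sigma]
    constructor
    · rintro ⟨h1, h2⟩
      exact ⟨(SSV_mem hxy0).mp h1, (SSXq_mem (by linarith) (by linarith [hmb _ h1])).mp h2⟩
    · rintro ⟨h1, h2⟩
      have h1' := (SSV_mem hxy0).mpr h1
      exact ⟨h1', (SSXq_mem (by linarith) (by linarith [hmb _ h1'])).mpr h2⟩
  have hinj : Set.InjOn (fun a : (Σ _ : ℕ, ℕ) => a.1 * a.2) T := by
    rintro ⟨m, p⟩ ha ⟨m', p'⟩ hb hab
    have ha' := (hTmem _).mp ha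
    have hb' := (hTmem _).mp hb
    simp only at ha' hb' hab
    obtain ⟨⟨a0, a1, a2⟩, a3, a4, a5⟩ := ha'
    obtain ⟨⟨b0, b1, b2⟩, b3, b4, b5⟩ := hb'
    have hpp : p = p' := by
      have hd : p ∣ m' * p' := by rw [← hab]; exact dvd_mul_left _ _
      rcases (Nat.Prime.dvd_mul a5).mp hd with h | h
      · have := b2 p a5 h; linarith
      · exact (Nat.prime_dvd_prime_iff_eq a5 b5).mp h
    subst hpp
    have := Nat.eq_of_mul_eq_mul_right a5.pos hab
    subst this
    rfl
  set S : Finset ℕ := SSV x y ∪ T.image (fun a => a.1 * a.2) with hS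
  have hdisj : Disjoint (SSV x y) (T.image (fun a => a.1 * a.2)) := by
    rw [Finset.disjoint_left]
    intro n hn hn'
    obtain ⟨a, ha, rfl⟩ := Finset.mem_image.mp hn'
    obtain ⟨_, a3, a4, a5⟩ := (hTmem _).mp ha
    have := ((SSV_mem hx0).mp hn).2.2 a.2 a5 (dvd_mul_left _ _)
    linarith
  have hSc : semismoothCount x y z = S.card := by
    unfold semismoothCount
    rw [Nat.subtype_card S]
    intro n
    rw [hS, Finset.mem_union, Finset.mem_image, SSV_mem hx0]
    constructor
    · rintro (⟨h0, h1, h2⟩ | ⟨a, ha, rfl⟩)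
      · exact ⟨h0, h1, n, 1, by simp, h2, Or.inl rfl⟩
      · obtain ⟨⟨a0, a1, a2⟩, a3, a4, a5⟩ := (hTmem _).mp ha
        have a0' : (0:ℝ) < a.1 := by exact_mod_cast a0
        refine ⟨Nat.mul_pos a0 a5.pos, ?_, a.1, a.2, rfl, a2, Or.inr ⟨a5, a4.trans (min_le_left _ _)⟩⟩
        have := a4.trans (min_le_right _ _)
        rw [le_div_iff₀ a0'] at this
        push_cast
        linarith
    · rintro ⟨h0, h1, m, p, rfl, h2, h3⟩
      rcases h3 with rfl | ⟨h3, h4⟩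
      · left
        rw [mul_one] at *
        exact ⟨h0, h1, h2⟩
      · by_cases hp : (p:ℝ) ≤ y
        · left
          refine ⟨h0, h1, ?_⟩
          intro q hq hd
          rcases (Nat.Prime.dvd_mul hq).mp hd with h | h
          · exact h2 q hq h
          · rw [(Nat.prime_dvd_prime_iff_eq hq h3).mp h]; exact hp
        · right
          push Not at hp
          have m0 : 0 < m := Nat.pos_of_mul_pos_right h0
          have m0' : (0:ℝ) < m := by exact_mod_cast m0
          push_cast at h1
          refine ⟨⟨m, p⟩, (hTmem _).mpr ⟨⟨m0, ?_, h2⟩, hp, le_min h4 ?_, h3⟩, rfl⟩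
          · rw [le_div_iff₀ (by linarith)]
            have : (m:ℝ) * y ≤ m * p := by gcongr
            linarith
          · rw [le_div_iff₀ m0']; linarith
  rw [hSc, hS, Finset.card_union_of_disjoint hdisj, Finset.card_image_of_injOn hinj, hT, Finset.card_sigma]
  push_cast
  congr 1
  exact Finset.sum_congr rfl (fun m hm => SSXq_card (hmb m hm))

theorem SSX_int {x y z : ℝ} (hy : 2 ≤ y) (hyz : y ≤ z) (hzx : z ≤ x) :
    ∫ t in y..z, (smoothCount (x / t) y : ℝ) / Real.log t =
      ∑ m ∈ SSV (x/y) y, ∫ t in y..(min z (x/m)), 1/Real.log t := by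
  classical
  have hx0 : 0 ≤ x := by linarith
  have hxy0 : 0 ≤ x / y := by positivity
  have hmb : ∀ m ∈ SSV (x/y) y, y ≤ min z (x/m) := by
    intro m hm
    obtain ⟨m0, m1, _⟩ := (SSV_mem hxy0).mp hm
    have m0' : (0:ℝ) < m := by exact_mod_cast m0
    refine le_min hyz ?_
    rw [le_div_iff₀ m0']
    rw [le_div_iff₀ (by linarith)] at m1
    linarith
  have e1 : ∀ t ∈ Set.uIcc y z, (smoothCount (x / t) y : ℝ) / Real.log t =
      ∑ m ∈ SSV (x/y) y, Set.indicator {t : ℝ | t ≤ min z (x/m)} (fun t => 1/Real.log t) t := by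
    intro t ht
    rw [Set.uIcc_of_le hyz] at ht
    have ht0 : 0 < t := by linarith [ht.1]
    have hxt : 0 ≤ x / t := by positivity
    rw [SSV_card hxt]
    have : SSV (x/t) y = (SSV (x/y) y).filter (fun m : ℕ => t ≤ min z (x/m)) := by
      ext m
      rw [Finset.mem_filter, SSV_mem hxt, SSV_mem hxy0, le_min_iff]
      constructor
      · rintro ⟨h0, h1, h2⟩
        have m0' : (0:ℝ) < m := by exact_mod_cast h0
        refine ⟨⟨h0, h1.trans ?_, h2⟩, ht.2, ?_⟩
        · exact div_le_div_of_nonneg_left hx0 (by linarith) ht.1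
        · rw [le_div_iff₀ m0']; rw [le_div_iff₀ ht0] at h1; linarith
      · rintro ⟨⟨h0, h1, h2⟩, _, h3⟩
        have m0' : (0:ℝ) < m := by exact_mod_cast h0
        refine ⟨h0, ?_, h2⟩
        rw [le_div_iff₀ ht0]; rw [le_div_iff₀ m0'] at h3; linarith
    rw [this, Finset.card_filter]
    push_cast
    rw [Finset.sum_div]
    refine Finset.sum_congr rfl (fun m _ => ?_)
    rw [Set.indicator_apply]
    by_cases h : t ≤ min z (x/m)
    · rw [if_pos h, if_pos (show t ∈ {t : ℝ | t ≤ min z (x/m)} from h)]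
    · rw [if_neg h, if_neg (show ¬ t ∈ {t : ℝ | t ≤ min z (x/m)} from h), zero_div]
  rw [intervalIntegral.integral_congr e1, intervalIntegral.integral_finset_sum]
  · refine Finset.sum_congr rfl (fun m hm => ?_)
    exact intervalIntegral.integral_indicator ⟨hmb m hm, min_le_left _ _⟩
  · intro m hm
    have hi := SSP_ii (a := y) (b := z) (by linarith) (by linarith)
    rw [intervalIntegrable_iff] at hi ⊢
    exact hi.indicator measurableSet_Iic


end

/-- `Ψ(x,y,z) = (Ψ(x,y) + ∫_y^z Ψ(x/t,y)/log t dt)(1 + o(1))` as `y → ∞`,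
uniformly in the region `2 ≤ y ≤ z ≤ x`, `1 ≤ log(x/z)/log y`,
`log x/log y ≤ exp((log y)^{3/5−ε})`. -/
theorem semismooth_integral_asymptotic (ε : ℝ) (hε0 : 0 < ε) (hε : ε < 3 / 5) :
    ∀ δ : ℝ, 0 < δ → ∃ y₀ : ℝ, 2 ≤ y₀ ∧ ∀ x y z : ℝ,
      y₀ ≤ y → 2 ≤ y → y ≤ z → z ≤ x →
      1 ≤ Real.log (x / z) / Real.log y →
      Real.log (x / z) / Real.log y ≤ Real.log x / Real.log y →
      Real.log x / Real.log y ≤ Real.exp ((Real.log y) ^ ((3 : ℝ) / 5 - ε)) →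
      |(semismoothCount x y z : ℝ) -
          ((smoothCount x y : ℝ) + ∫ t in y..z, (smoothCount (x / t) y : ℝ) / Real.log t)|
        ≤ δ * ((smoothCount x y : ℝ) +
            ∫ t in y..z, (smoothCount (x / t) y : ℝ) / Real.log t) := by
  intro δ hδ
  obtain ⟨y1, hy1, h1⟩ := SSQ_main hδ
  obtain ⟨y2, hy2, h2⟩ := SSU_small hε0 hε
  refine ⟨max y1 y2, hy1.trans (le_max_left _ _), ?_⟩
  intro x y z hy h2y hyz hzx _ _ hu
  have hy1' : y1 ≤ y := (le_max_left _ _).trans hy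
  have hy2' : y2 ≤ y := (le_max_right _ _).trans hy
  have hsm := h2 x y hy2' (hyz.trans hzx) hu
  have hxy0 : 0 ≤ x / y := div_nonneg (by linarith) (by linarith)
  rw [SSX_int h2y hyz hzx, SSX_count h2y hyz hzx, SSV_card (by linarith : 0 ≤ x)]
  set I := ∑ m ∈ SSV (x/y) y, ∫ t in y..(min z (x/m)), 1/Real.log t with hI
  have e : ((SSV x y).card : ℝ) + ∑ m ∈ SSV (x/y) y, (SSP (min z (x/m)) - SSP y) - (((SSV x y).card : ℝ) + I)
      = ∑ m ∈ SSV (x/y) y, (SSP (min z (x/m)) - SSP y - ∫ t in y..(min z (x/m)), 1/Real.log t) := by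
    rw [Finset.sum_sub_distrib (fun m : ℕ => SSP (min z (x/m)) - SSP y), ← hI]; ring
  rw [e]
  have hb : ∑ m ∈ SSV (x/y) y, δ * ((∫ t in y..(min z (x/m)), 1/Real.log t) + SSG y)
      = δ * (I + (SSV (x/y) y).card * SSG y) := by
    rw [← Finset.mul_sum, Finset.sum_add_distrib, Finset.sum_const, nsmul_eq_mul]
  calc _ ≤ ∑ m ∈ SSV (x/y) y, |SSP (min z (x/m)) - SSP y - ∫ t in y..(min z (x/m)), 1/Real.log t| :=
        Finset.abs_sum_le_sum_abs _ _
    _ ≤ ∑ m ∈ SSV (x/y) y, δ * ((∫ t in y..(min z (x/m)), 1/Real.log t) + SSG y) := by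
        refine Finset.sum_le_sum (fun m hm => h1 y _ hy1' ?_)
        obtain ⟨m0, m1, _⟩ := (SSV_mem hxy0).mp hm
        have m0' : (0:ℝ) < m := by exact_mod_cast m0
        refine le_min hyz ?_
        rw [le_div_iff₀ m0']
        rw [le_div_iff₀ (by linarith)] at m1
        linarith
    _ = δ * (I + (SSV (x/y) y).card * SSG y) := hb
    _ ≤ δ * (((SSV x y).card : ℝ) + I) := by
        apply mul_le_mul_of_nonneg_left _ hδ.le
        linarith
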